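/- arXiv:1703.04424 — 6 statements merged into one kernel-verified Lean document; each statement's English description precedes it below -/
import Mathlib

section
/- There is an absolute constant C > 0 with the following property. Let a, b be integers and c a positive integer with gcd(ab, c) = 1, let D, N, U be real numbers ≥ 1, and let α : ℕ → ℂ and β : ℕ → ℂ be finitely supported sequences. Then ∫_{-U}^{U} | Σ_{D < d ≤ 2D, N < n ≤ 2N, gcd(dn,c)=1} α(d) β(n) e( (ad)^{-1} b n / c ) (n/d)^{it} | dt ≤ C c^{1/2} (D + U)^{1/2} (N + U)^{1/2} ‖α‖₂ ‖β‖₂, where (ad)^{-1} denotes any integer inverse of ad modulo c (the summand is independent of the choice of inverse). -/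
open Complex MeasureTheory

/-- `e x = exp(2 π i x)`. -/
noncomputable def e (x : ℝ) : ℂ := Complex.exp (2 * Real.pi * Complex.I * x)

/-- A sum of powers of `r ∈ [0, 1)` with distinct exponents is at most the geometric series. -/
theorem sum_pow_le_of_injOn {ι : Type*} {r : ℝ} (h0 : 0 ≤ r) (h1 : r < 1) (s : Finset ι)
    (φ : ι → ℕ) (hφ : Set.InjOn φ s) : ∑ m ∈ s, r ^ φ m ≤ (1 - r)⁻¹ := by
  classical
  rw [← Finset.sum_image (f := fun k => r ^ k) hφ, ← tsum_geometric_of_lt_one h0 h1]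
  exact (summable_geometric_of_lt_one h0 h1).sum_le_tsum _ fun k _ => pow_nonneg h0 k

theorem sum_exp_neg_mul_abs_sub_le {l : ℝ} (hl : 0 < l) (s : Finset ℕ) (d : ℕ) :
    ∑ m ∈ s, Real.exp (-(l * |(d : ℝ) - m|)) ≤ 2 * (1 + 1 / l) := by
  set r := Real.exp (-l) with hr
  have h0 : 0 ≤ r := (Real.exp_pos _).le
  have h1 : r < 1 := by rw [hr, Real.exp_lt_one_iff]; linarith
  have hpow (k : ℕ) : r ^ k = Real.exp (-(l * k)) := by
    rw [hr, ← Real.exp_nat_mul]; congr 1; ring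
  have hgeom : (1 - r)⁻¹ ≤ 1 + 1 / l := by
    have h2 : r * (1 + l) ≤ 1 := by
      have h3 : r * Real.exp l = 1 := by rw [hr, ← Real.exp_add]; simp
      nlinarith [Real.add_one_le_exp l]
    rw [inv_le_iff_one_le_mul₀ (by linarith)]
    have h4 : (1 + 1 / l) * (1 - r) = (1 + l - r * (1 + l)) / l := by field_simp; ring
    rw [h4, le_div_iff₀ hl]
    linarith
  rw [← Finset.sum_filter_add_sum_filter_not s (fun m => m ≤ d)]
  have hA : ∑ m ∈ s with m ≤ d, Real.exp (-(l * |(d : ℝ) - m|)) ≤ (1 - r)⁻¹ := by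
    refine le_trans (le_of_eq ?_) (sum_pow_le_of_injOn h0 h1 {m ∈ s | m ≤ d} (fun m => d - m) ?_)
    · refine Finset.sum_congr rfl fun m hm => ?_
      have hm' : m ≤ d := (Finset.mem_filter.1 hm).2
      rw [hpow, Nat.cast_sub hm', abs_of_nonneg (sub_nonneg.2 (Nat.cast_le.2 hm'))]
    · intro m hm k hk h
      simp only [Finset.coe_filter, Set.mem_ofPred_eq] at hm hk h
      omega
  have hB : ∑ m ∈ s with ¬ m ≤ d, Real.exp (-(l * |(d : ℝ) - m|)) ≤ (1 - r)⁻¹ := by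
    refine le_trans (le_of_eq ?_)
      (sum_pow_le_of_injOn h0 h1 {m ∈ s | ¬ m ≤ d} (fun m => m - d) ?_)
    · refine Finset.sum_congr rfl fun m hm => ?_
      have hm' : d ≤ m := (not_le.1 (Finset.mem_filter.1 hm).2).le
      rw [hpow, Nat.cast_sub hm', abs_sub_comm,
        abs_of_nonneg (sub_nonneg.2 (Nat.cast_le.2 hm'))]
    · intro m hm k hk h
      simp only [Finset.coe_filter, Set.mem_ofPred_eq] at hm hk h
      omega
  linarith

theorem exp_neg_sq_le (y : ℝ) : Real.exp (-y ^ 2) ≤ 2 * Real.exp (-y) := by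
  have h : Real.exp (-y ^ 2) ≤ Real.exp (Real.log 2 + -y) := by
    apply Real.exp_le_exp.2
    nlinarith [sq_nonneg (y - 1 / 2), Real.log_two_gt_d9]
  rwa [Real.exp_add, Real.exp_log two_pos] at h

/-- Schur's test for a symmetric kernel. -/
theorem sum_sum_mul_le_of_row_sum_le {ι : Type*} (s : Finset ι) (x : ι → ℝ) (K : ι → ι → ℝ)
    (hK : ∀ i j, 0 ≤ K i j) (hsymm : ∀ i j, K i j = K j i) {R : ℝ}
    (hR : ∀ i ∈ s, ∑ j ∈ s, K i j ≤ R) :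
    ∑ i ∈ s, ∑ j ∈ s, x i * x j * K i j ≤ R * ∑ i ∈ s, x i ^ 2 := by
  have h1 : ∑ i ∈ s, ∑ j ∈ s, x i ^ 2 * K i j ≤ R * ∑ i ∈ s, x i ^ 2 := by
    rw [Finset.mul_sum]
    refine Finset.sum_le_sum fun i hi => ?_
    rw [← Finset.mul_sum, mul_comm]
    exact mul_le_mul_of_nonneg_right (hR i hi) (sq_nonneg _)
  have h2 : ∑ i ∈ s, ∑ j ∈ s, x j ^ 2 * K i j = ∑ i ∈ s, ∑ j ∈ s, x i ^ 2 * K i j := by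
    rw [Finset.sum_comm]
    simp only [hsymm]
  have h3 : ∑ i ∈ s, ∑ j ∈ s, x i * x j * K i j ≤
      ∑ i ∈ s, ∑ j ∈ s, (x i ^ 2 * K i j + x j ^ 2 * K i j) / 2 := by
    refine Finset.sum_le_sum fun i _ => Finset.sum_le_sum fun j _ => ?_
    nlinarith [mul_nonneg (sq_nonneg (x i - x j)) (hK i j)]
  simp only [← Finset.sum_div, Finset.sum_add_distrib, h2] at h3
  linarith

/-- Mean value theorem for exponential sums whose frequencies are `1 / (2 * D)`-separated. -/
theorem integral_norm_sq_sum_le {D U : ℝ} (hD : 1 ≤ D) (hU : 1 ≤ U) (s : Finset ℕ) (a : ℕ → ℂ)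
    (θ : ℕ → ℝ)
    (hθ : ∀ d ∈ s, ∀ m ∈ s, |(d : ℝ) - m| / (2 * D) ≤ |θ d - θ m|) :
    ∫ t in (-U)..U, ‖∑ d ∈ s, a d * cexp (I * t * θ d)‖ ^ 2 ≤
      96 * (D + U) * ∑ d ∈ s, ‖a d‖ ^ 2 := by
  have hU0 : 0 < U := by linarith
  have hD0 : 0 < D := by linarith
  set Z : ℝ → ℂ := fun t => ∑ d ∈ s, a d * cexp (I * t * θ d) with hZ
  have hZc : Continuous Z := by rw [hZ]; fun_prop
  set b : ℂ := -(1 / U ^ 2 : ℝ) with hb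
  have hbre : b.re < 0 := by
    rw [hb, neg_re, ofReal_re]; have : 0 < 1 / U ^ 2 := by positivity
    linarith
  set g : ℕ → ℕ → ℝ → ℂ := fun d m t => a d * (starRingEnd ℂ) (a m) *
    cexp (b * t ^ 2 + (I * (θ d - θ m : ℝ)) * t + 1) with hg
  have hexpand (t : ℝ) : ((Real.exp (1 - t ^ 2 / U ^ 2) * ‖Z t‖ ^ 2 : ℝ) : ℂ) =
      ∑ d ∈ s, ∑ m ∈ s, g d m t := by
    have h1 : ((‖Z t‖ ^ 2 : ℝ) : ℂ) = Z t * (starRingEnd ℂ) (Z t) := by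
      rw [mul_conj, normSq_eq_norm_sq]
    rw [ofReal_mul, h1, hZ, map_sum, Finset.sum_mul_sum, Finset.mul_sum]
    refine Finset.sum_congr rfl fun d _ => ?_
    rw [Finset.mul_sum]
    refine Finset.sum_congr rfl fun m _ => ?_
    rw [hg, map_mul, ← exp_conj]
    have h2 : cexp (b * t ^ 2 + (I * (θ d - θ m : ℝ)) * t + 1) =
        ((Real.exp (1 - t ^ 2 / U ^ 2) : ℝ) : ℂ) * cexp (I * t * θ d) *
          cexp ((starRingEnd ℂ) (I * t * θ m)) := by
      rw [ofReal_exp, ← Complex.exp_add, ← Complex.exp_add]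
      congr 1
      simp only [map_mul, conj_I, conj_ofReal, hb]
      push_cast
      ring
    simp only [h2]
    ring
  have hgi (d m : ℕ) : Integrable (g d m) :=
    (integrable_cexp_quadratic' hbre _ _).const_mul _
  have hgI (d m : ℕ) : ‖∫ t, g d m t‖ ≤
      ‖a d‖ * ‖a m‖ * (6 * U * Real.exp (-(U * (θ d - θ m) / 2) ^ 2)) := by
    rw [hg, integral_const_mul, integral_cexp_quadratic hbre, norm_mul, norm_mul, RCLike.norm_conj]
    refine mul_le_mul_of_nonneg_left ?_ (by positivity)
    have e1 : ((Real.pi : ℂ) / -b) ^ (1 / 2 : ℂ) = ((Real.sqrt Real.pi * U : ℝ) : ℂ) := by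
      have : (Real.pi : ℂ) / -b = ((Real.pi * U ^ 2 : ℝ) : ℂ) := by
        rw [hb]; push_cast; field_simp
      rw [this, show (1 / 2 : ℂ) = ((1 / 2 : ℝ) : ℂ) by norm_num,
        ← ofReal_cpow (by positivity), ← Real.sqrt_eq_rpow,
        Real.sqrt_mul Real.pi_pos.le, Real.sqrt_sq hU0.le]
    have e2 : 1 - (I * (θ d - θ m : ℝ)) ^ 2 / (4 * b) =
        ((1 + -(U * (θ d - θ m) / 2) ^ 2 : ℝ) : ℂ) := by
      rw [mul_pow, I_sq, hb]
      have : (U : ℂ) ≠ 0 := by exact_mod_cast hU0.ne'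
      push_cast
      field_simp
      ring
    rw [e1, e2, norm_mul, ← ofReal_exp, norm_real, norm_real, Real.norm_of_nonneg (by positivity),
      Real.norm_of_nonneg (by positivity), Real.exp_add]
    have h1 : Real.sqrt Real.pi ≤ 2 := by
      rw [Real.sqrt_le_left two_pos.le]; linarith [Real.pi_lt_four]
    have h2 : Real.exp 1 ≤ 3 := by linarith [Real.exp_one_lt_d9]
    calc _ ≤ 2 * U * (3 * Real.exp (-(U * (θ d - θ m) / 2) ^ 2)) := by gcongr
      _ = _ := by ring
  have hint : Integrable fun t : ℝ => ∑ d ∈ s, ∑ m ∈ s, g d m t :=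
    integrable_finsetSum _ fun d _ => integrable_finsetSum _ fun m _ => hgi d m
  have hintR : Integrable fun t : ℝ => Real.exp (1 - t ^ 2 / U ^ 2) * ‖Z t‖ ^ 2 := by
    simp only [← hexpand] at hint
    exact hint.re
  have hmajor : ∫ t in (-U)..U, ‖Z t‖ ^ 2 ≤
      ∫ t : ℝ, Real.exp (1 - t ^ 2 / U ^ 2) * ‖Z t‖ ^ 2 := by
    rw [intervalIntegral.integral_of_le (by linarith)]
    refine le_trans (setIntegral_mono_on ?_ hintR.integrableOn measurableSet_Ioc ?_)
      (setIntegral_le_integral hintR (Filter.Eventually.of_forall fun t => by positivity))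
    · exact (Continuous.integrableOn_Icc (by fun_prop)).mono_set Set.Ioc_subset_Icc_self
    · intro t ht
      refine le_mul_of_one_le_left (by positivity) (Real.one_le_exp ?_)
      rw [sub_nonneg, div_le_one (by positivity), sq_le_sq, abs_of_pos hU0, abs_le]
      exact ⟨ht.1.le, ht.2⟩
  set l := U / (4 * D) with hl
  have hl0 : 0 < l := by positivity
  have hrow : ∀ d ∈ s, ∑ m ∈ s, 6 * U * Real.exp (-(U * (θ d - θ m) / 2) ^ 2) ≤
      96 * (D + U) := by
    intro d hd
    have h1 : ∀ m ∈ s, 6 * U * Real.exp (-(U * (θ d - θ m) / 2) ^ 2) ≤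
        12 * U * Real.exp (-(l * |(d : ℝ) - m|)) := by
      intro m hm
      have h2 : l * |(d : ℝ) - m| ≤ |U * (θ d - θ m) / 2| := by
        rw [abs_div, abs_mul, abs_of_pos hU0, abs_two]
        have := mul_le_mul_of_nonneg_left (hθ d hd m hm) hU0.le
        calc l * |(d : ℝ) - m| = U * (|(d : ℝ) - m| / (2 * D)) / 2 := by
              rw [hl]; field_simp; ring
          _ ≤ _ := by linarith
      have h3 : Real.exp (-(U * (θ d - θ m) / 2) ^ 2) ≤ 2 * Real.exp (-(l * |(d : ℝ) - m|)) := by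
        refine le_trans (Real.exp_le_exp.2 ?_) (exp_neg_sq_le _)
        rw [neg_le_neg_iff, ← sq_abs (U * (θ d - θ m) / 2)]
        gcongr
      nlinarith
    calc _ ≤ ∑ m ∈ s, 12 * U * Real.exp (-(l * |(d : ℝ) - m|)) := Finset.sum_le_sum h1
      _ ≤ 12 * U * (2 * (1 + 1 / l)) := by
        rw [← Finset.mul_sum]
        exact mul_le_mul_of_nonneg_left (sum_exp_neg_mul_abs_sub_le hl0 s d) (by positivity)
      _ = 24 * U + 96 * D := by rw [hl]; field_simp; ring
      _ ≤ _ := by linarith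
  refine hmajor.trans ?_
  calc ∫ t : ℝ, Real.exp (1 - t ^ 2 / U ^ 2) * ‖Z t‖ ^ 2
      ≤ ‖((∫ t : ℝ, Real.exp (1 - t ^ 2 / U ^ 2) * ‖Z t‖ ^ 2 : ℝ) : ℂ)‖ := by
        rw [norm_real]; exact Real.le_norm_self _
    _ = ‖∑ d ∈ s, ∑ m ∈ s, ∫ t, g d m t‖ := by
        rw [← integral_complex_ofReal]
        simp only [hexpand]
        rw [integral_finsetSum _ fun d _ => integrable_finsetSum _ fun m _ => hgi d m]
        congr 1
        exact Finset.sum_congr rfl fun d _ => integral_finsetSum _ fun m _ => hgi d m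
    _ ≤ ∑ d ∈ s, ∑ m ∈ s,
          ‖a d‖ * ‖a m‖ * (6 * U * Real.exp (-(U * (θ d - θ m) / 2) ^ 2)) :=
        (norm_sum_le _ _).trans <| Finset.sum_le_sum fun d _ =>
          (norm_sum_le _ _).trans <| Finset.sum_le_sum fun m _ => hgI d m
    _ ≤ _ := by
        refine sum_sum_mul_le_of_row_sum_le s (fun d => ‖a d‖) _ (fun _ _ => by positivity)
          (fun i j => ?_) hrow
        rw [show (U * (θ i - θ j) / 2) ^ 2 = (U * (θ j - θ i) / 2) ^ 2 by ring]

/-- Parseval's identity for the discrete Fourier transform. -/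
theorem sum_norm_sq_sum_stdAddChar (c : ℕ) [NeZero c] (B : ZMod c → ℂ) :
    ∑ x, ‖∑ y, B y * ZMod.stdAddChar (x * y)‖ ^ 2 = c * ∑ y, ‖B y‖ ^ 2 := by
  have key : ((∑ x, ‖∑ y, B y * ZMod.stdAddChar (x * y)‖ ^ 2 : ℝ) : ℂ) =
      ((c * ∑ y, ‖B y‖ ^ 2 : ℝ) : ℂ) := by
    push_cast
    have h1 (z : ℂ) : (‖z‖ : ℂ) ^ 2 = z * (starRingEnd ℂ) z := by
      rw [mul_conj, normSq_eq_norm_sq]; push_cast; rfl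
    simp only [h1, map_sum, map_mul, Finset.sum_mul_sum, ← AddChar.map_neg_eq_conj]
    rw [Finset.sum_comm, Finset.mul_sum]
    refine Finset.sum_congr rfl fun y _ => ?_
    rw [Finset.sum_comm]
    have h2 (z : ZMod c) : ∑ x : ZMod c, B y * ZMod.stdAddChar (x * y) *
        ((starRingEnd ℂ) (B z) * ZMod.stdAddChar (-(x * z))) =
        B y * (starRingEnd ℂ) (B z) * (if y - z = 0 then c else 0 : ℕ) := by
      have h3 := AddChar.sum_mulShift (y - z) (ZMod.isPrimitive_stdAddChar c)
      rw [ZMod.card] at h3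
      rw [← h3, Finset.mul_sum]
      refine Finset.sum_congr rfl fun x _ => ?_
      rw [mul_sub, sub_eq_add_neg, AddChar.map_add_eq_mul]
      ring
    simp only [h2, sub_eq_zero]
    rw [Finset.sum_eq_single y]
    · simp; ring
    · intro z _ hz; simp [hz.symm]
    · simp
  exact_mod_cast key

theorem norm_sum_sum_stdAddChar_le (c : ℕ) [NeZero c] (A B : ZMod c → ℂ) :
    ‖∑ x, ∑ y, A x * B y * ZMod.stdAddChar (x * y)‖ ≤
      √c * (√(∑ x, ‖A x‖ ^ 2) * √(∑ y, ‖B y‖ ^ 2)) := by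
  calc ‖∑ x, ∑ y, A x * B y * ZMod.stdAddChar (x * y)‖
      ≤ ∑ x, ‖A x‖ * ‖∑ y, B y * ZMod.stdAddChar (x * y)‖ := by
        refine (norm_sum_le _ _).trans (Finset.sum_le_sum fun x _ => le_of_eq ?_)
        rw [← norm_mul, Finset.mul_sum]
        simp only [mul_assoc]
    _ ≤ _ := Real.sum_mul_le_sqrt_mul_sqrt _ _ _
    _ = _ := by
        rw [sum_norm_sq_sum_stdAddChar, Real.sqrt_mul (Nat.cast_nonneg c)]
        ring

/-- Cauchy–Schwarz for interval integrals of continuous nonnegative functions. -/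
theorem intervalIntegral_sqrt_mul_sqrt_le {u v : ℝ} (huv : u ≤ v) {F G : ℝ → ℝ}
    (hF : Continuous F) (hG : Continuous G) (hF0 : ∀ t, 0 ≤ F t) (hG0 : ∀ t, 0 ≤ G t) :
    ∫ t in u..v, √(F t) * √(G t) ≤ √(∫ t in u..v, F t) * √(∫ t in u..v, G t) := by
  simp only [intervalIntegral.integral_of_le huv]
  have hm {H : ℝ → ℝ} (hH : Continuous H) (hH0 : ∀ t, 0 ≤ H t) :
      MemLp (fun t => √(H t)) (ENNReal.ofReal 2) (volume.restrict (Set.Ioc u v)) := by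
    rw [show ENNReal.ofReal 2 = 2 by simp, memLp_two_iff_integrable_sq
      (by fun_prop : Continuous fun t => √(H t)).aestronglyMeasurable]
    simp only [Real.sq_sqrt (hH0 _)]
    exact hH.integrableOn_Icc.mono_set Set.Ioc_subset_Icc_self
  have h := integral_mul_le_Lp_mul_Lq_of_nonneg Real.HolderConjugate.two_two
    (Filter.Eventually.of_forall fun t => Real.sqrt_nonneg (F t))
    (Filter.Eventually.of_forall fun t => Real.sqrt_nonneg (G t)) (hm hF hF0) (hm hG hG0)
  simpa only [Real.rpow_two, Real.sq_sqrt (hF0 _), Real.sq_sqrt (hG0 _),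
    ← Real.sqrt_eq_rpow] using h

theorem abs_sub_div_le_abs_log_sub_log {D x y : ℝ} (hx : 0 < x) (hxD : x ≤ 2 * D)
    (hy : 0 < y) (hyD : y ≤ 2 * D) :
    |x - y| / (2 * D) ≤ |Real.log x - Real.log y| := by
  wlog h : y ≤ x generalizing x y
  · rw [abs_sub_comm, abs_sub_comm (Real.log x)]
    exact this hy hyD hx hxD (le_of_not_ge h)
  rw [abs_of_nonneg (sub_nonneg.2 h), abs_of_nonneg (sub_nonneg.2 (Real.log_le_log hy h)),
    ← Real.log_div hx.ne' hy.ne']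
  refine le_trans ?_ (Real.one_sub_inv_le_log_of_pos (div_pos hx hy))
  rw [inv_div, one_sub_div hx.ne']
  exact div_le_div_of_nonneg_left (sub_nonneg.2 h) hx hxD

/-- The mean value theorem, summed over the fibres of a map to a finite type. -/
theorem integral_sum_fiber_norm_sq_le {κ : Type*} [Fintype κ] [DecidableEq κ] {D U : ℝ}
    (hD : 1 ≤ D) (hU : 1 ≤ U) (s : Finset ℕ) (a : ℕ → ℂ) (θ : ℕ → ℝ)
    (hθ : ∀ d ∈ s, ∀ m ∈ s, |(d : ℝ) - m| / (2 * D) ≤ |θ d - θ m|) (f : ℕ → κ) :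
    ∫ t in (-U)..U, ∑ x, ‖∑ d ∈ s with f d = x, a d * cexp (I * t * θ d)‖ ^ 2 ≤
      96 * (D + U) * ∑ d ∈ s, ‖a d‖ ^ 2 := by
  rw [intervalIntegral.integral_finsetSum fun x _ =>
    Continuous.intervalIntegrable (by fun_prop) _ _, ← Finset.sum_fiberwise s f, Finset.mul_sum]
  refine Finset.sum_le_sum fun x _ => integral_norm_sq_sum_le hD hU _ a θ fun d hd m hm => ?_
  exact hθ d (Finset.mem_filter.1 hd).1 m (Finset.mem_filter.1 hm).1

theorem sum_sum_eq_sum_fiber_stdAddChar {c : ℕ} [NeZero c] (s s' : Finset ℕ) (A B : ℕ → ℂ)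
    (f h : ℕ → ZMod c) :
    ∑ d ∈ s, ∑ n ∈ s', A d * B n * ZMod.stdAddChar (f d * h n) =
      ∑ x, ∑ y, (∑ d ∈ s with f d = x, A d) * (∑ n ∈ s' with h n = y, B n) *
        ZMod.stdAddChar (x * y) := by
  rw [← Finset.sum_fiberwise s f]
  refine Finset.sum_congr rfl fun x _ => ?_
  calc _ = ∑ d ∈ s with f d = x, ∑ y, ∑ n ∈ s' with h n = y,
        A d * B n * ZMod.stdAddChar (x * y) := by
        refine Finset.sum_congr rfl fun d hd => ?_
        rw [← Finset.sum_fiberwise s' h]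
        refine Finset.sum_congr rfl fun y _ => Finset.sum_congr rfl fun n hn => ?_
        rw [(Finset.mem_filter.1 hd).2, (Finset.mem_filter.1 hn).2]
    _ = _ := by
        rw [Finset.sum_comm]
        refine Finset.sum_congr rfl fun y _ => ?_
        rw [Finset.sum_mul_sum, Finset.sum_mul]
        simp only [Finset.sum_mul]

theorem natCast_div_natCast_cpow_I_mul {d n : ℕ} (hd : 0 < d) (hn : 0 < n) (t : ℝ) :
    ((n : ℂ) / (d : ℂ)) ^ (I * t) =
      cexp (I * t * (-Real.log d : ℝ)) * cexp (I * t * (Real.log n : ℝ)) := by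
  have hd' : (0 : ℝ) < d := Nat.cast_pos.2 hd
  have hn' : (0 : ℝ) < n := Nat.cast_pos.2 hn
  have hq : (n : ℂ) / (d : ℂ) = ((n / d : ℝ) : ℂ) := by push_cast; rfl
  rw [hq, cpow_def_of_ne_zero (by exact_mod_cast (div_pos hn' hd').ne'),
    ← ofReal_log (div_pos hn' hd').le, Real.log_div hn'.ne' hd'.ne', ← Complex.exp_add]
  congr 1
  push_cast
  ring

theorem e_intCast_div_natCast (c : ℕ) [NeZero c] (k : ℤ) :
    e ((k : ℝ) / c) = ZMod.stdAddChar (k : ZMod c) := by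
  rw [e, ZMod.stdAddChar_coe]
  congr 1
  push_cast
  ring

theorem sum_filter_toFinset_norm_sq_le_tsum {α : ℕ → ℂ} (hα : (Function.support α).Finite)
    (p : ℕ → Prop) [DecidablePred p] :
    ∑ d ∈ hα.toFinset with p d, ‖α d‖ ^ 2 ≤ ∑' d, ‖α d‖ ^ 2 := by
  refine Summable.sum_le_tsum _ (fun d _ => by positivity)
    (summable_of_hasFiniteSupport (hα.subset fun d hd => ?_))
  simpa using hd

/-- Hybrid large sieve lemma: for `gcd(ab, c) = 1` and finitely supported `α, β`,
`∫_{-U}^{U} |∑∑_{D<d≤2D, N<n≤2N, (dn,c)=1} α(d) β(n) e(\overline{ad} b n / c) (n/d)^{it}| dt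
  ≤ C c^{1/2} (D+U)^{1/2} (N+U)^{1/2} ‖α‖₂ ‖β‖₂`,
where `inv d` is any integer inverse of `a d` mod `c`. -/
theorem hybrid_large_sieve :
    ∃ C : ℝ, 0 < C ∧ ∀ (a b : ℤ) (c : ℕ), 0 < c → Int.gcd (a * b) c = 1 →
      ∀ D N U : ℝ, 1 ≤ D → 1 ≤ N → 1 ≤ U →
      ∀ α β : ℕ → ℂ, (Function.support α).Finite → (Function.support β).Finite →
      ∀ inv : ℕ → ℤ, (∀ d : ℕ, Nat.gcd d c = 1 → ((a * d * inv d : ℤ) : ZMod c) = 1) →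
      (∫ t in (-U)..U,
          ‖∑' d : ℕ, ∑' n : ℕ,
            (if D < (d : ℝ) ∧ (d : ℝ) ≤ 2 * D ∧ N < (n : ℝ) ∧ (n : ℝ) ≤ 2 * N ∧
                Nat.gcd (d * n) c = 1 then
              α d * β n * e (((inv d * b * n : ℤ) : ℝ) / c) *
                ((n : ℂ) / (d : ℂ)) ^ (Complex.I * t)
            else 0)‖)
        ≤ C * Real.sqrt c * Real.sqrt (D + U) * Real.sqrt (N + U) *
            Real.sqrt (∑' d : ℕ, ‖α d‖ ^ 2) * Real.sqrt (∑' n : ℕ, ‖β n‖ ^ 2) := by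
  classical
  refine ⟨96, by norm_num, ?_⟩
  intro a b c hc _ D N U hD hN hU α β hα hβ inv _
  have : NeZero c := ⟨hc.ne'⟩
  set s : Finset ℕ := {d ∈ hα.toFinset | D < (d : ℝ) ∧ (d : ℝ) ≤ 2 * D ∧ Nat.gcd d c = 1} with hs
  set s' : Finset ℕ :=
    {n ∈ hβ.toFinset | N < (n : ℝ) ∧ (n : ℝ) ≤ 2 * N ∧ Nat.gcd n c = 1} with hs'
  have hsmem {d : ℕ} (hd : d ∈ s) : 0 < d ∧ (d : ℝ) ≤ 2 * D := by
    have hd := (Finset.mem_filter.1 hd).2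
    exact ⟨Nat.cast_pos.1 (by linarith [hd.1] : (0 : ℝ) < d), hd.2.1⟩
  have hsmem' {n : ℕ} (hn : n ∈ s') : 0 < n ∧ (n : ℝ) ≤ 2 * N := by
    have hn := (Finset.mem_filter.1 hn).2
    exact ⟨Nat.cast_pos.1 (by linarith [hn.1] : (0 : ℝ) < n), hn.2.1⟩
  set f : ℕ → ZMod c := fun d => ((inv d * b : ℤ) : ZMod c) with hf
  set h : ℕ → ZMod c := fun n => (n : ZMod c) with hh
  set A : ℝ → ZMod c → ℂ := fun t x =>
    ∑ d ∈ s with f d = x, α d * cexp (I * t * (-Real.log d : ℝ)) with hA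
  set B : ℝ → ZMod c → ℂ := fun t y =>
    ∑ n ∈ s' with h n = y, β n * cexp (I * t * (Real.log n : ℝ)) with hB
  have hsum (t : ℝ) : (∑' d : ℕ, ∑' n : ℕ,
      (if D < (d : ℝ) ∧ (d : ℝ) ≤ 2 * D ∧ N < (n : ℝ) ∧ (n : ℝ) ≤ 2 * N ∧
          Nat.gcd (d * n) c = 1 then
        α d * β n * e (((inv d * b * n : ℤ) : ℝ) / c) *
          ((n : ℂ) / (d : ℂ)) ^ (Complex.I * t)
      else 0)) = ∑ x, ∑ y, A t x * B t y * ZMod.stdAddChar (x * y) := by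
    have hcop (d n : ℕ) : Nat.gcd (d * n) c = 1 ↔ Nat.gcd d c = 1 ∧ Nat.gcd n c = 1 :=
      Nat.coprime_mul_iff_left
    rw [tsum_eq_sum (s := s), hA, hB, ← sum_sum_eq_sum_fiber_stdAddChar]
    · refine Finset.sum_congr rfl fun d hd => ?_
      rw [tsum_eq_sum (s := s')]
      · refine Finset.sum_congr rfl fun n hn => ?_
        have hd' := (Finset.mem_filter.1 hd).2
        have hn' := (Finset.mem_filter.1 hn).2
        rw [if_pos ⟨hd'.1, hd'.2.1, hn'.1, hn'.2.1, (hcop d n).2 ⟨hd'.2.2, hn'.2.2⟩⟩,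
          natCast_div_natCast_cpow_I_mul (hsmem hd).1 (hsmem' hn).1, e_intCast_div_natCast,
          show ((inv d * b * n : ℤ) : ZMod c) = f d * h n by simp [hf, hh]]
        ring
      · intro n hn
        split_ifs with hp
        · have hβn : β n = 0 := by
            by_contra hne
            exact hn (Finset.mem_filter.2 ⟨hβ.mem_toFinset.2 hne, hp.2.2.1, hp.2.2.2.1,
              ((hcop d n).1 hp.2.2.2.2).2⟩)
          simp [hβn]
        · rfl
    · intro d hd
      refine (tsum_congr fun n => ?_).trans tsum_zero
      split_ifs with hp
      · have hαd : α d = 0 := by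
          by_contra hne
          exact hd (Finset.mem_filter.2 ⟨hα.mem_toFinset.2 hne, hp.1, hp.2.1,
            ((hcop d n).1 hp.2.2.2.2).1⟩)
        simp [hαd]
      · rfl
  simp only [hsum]
  have hAI : ∫ t in (-U)..U, ∑ x, ‖A t x‖ ^ 2 ≤ 96 * (D + U) * ∑' d, ‖α d‖ ^ 2 := by
    refine (integral_sum_fiber_norm_sq_le hD hU s α (fun d => -Real.log d) ?_ f).trans
      (mul_le_mul_of_nonneg_left (sum_filter_toFinset_norm_sq_le_tsum hα _) (by linarith))
    intro d hd m hm
    rw [neg_sub_neg, abs_sub_comm (Real.log m)]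
    exact abs_sub_div_le_abs_log_sub_log (Nat.cast_pos.2 (hsmem hd).1) (hsmem hd).2
      (Nat.cast_pos.2 (hsmem hm).1) (hsmem hm).2
  have hBI : ∫ t in (-U)..U, ∑ y, ‖B t y‖ ^ 2 ≤ 96 * (N + U) * ∑' n, ‖β n‖ ^ 2 := by
    refine (integral_sum_fiber_norm_sq_le hN hU s' β (fun n => Real.log n) ?_ h).trans
      (mul_le_mul_of_nonneg_left (sum_filter_toFinset_norm_sq_le_tsum hβ _) (by linarith))
    intro d hd m hm
    exact abs_sub_div_le_abs_log_sub_log (Nat.cast_pos.2 (hsmem' hd).1) (hsmem' hd).2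
      (Nat.cast_pos.2 (hsmem' hm).1) (hsmem' hm).2
  have hAc (x : ZMod c) : Continuous fun t => A t x := by rw [hA]; fun_prop
  have hBc (y : ZMod c) : Continuous fun t => B t y := by rw [hB]; fun_prop
  calc ∫ t in (-U)..U, ‖∑ x, ∑ y, A t x * B t y * ZMod.stdAddChar (x * y)‖
      ≤ ∫ t in (-U)..U, √c * (√(∑ x, ‖A t x‖ ^ 2) * √(∑ y, ‖B t y‖ ^ 2)) :=
        intervalIntegral.integral_mono_on (by linarith)
          (Continuous.intervalIntegrable (by fun_prop) _ _)
          (Continuous.intervalIntegrable (by fun_prop) _ _)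
          fun t _ => norm_sum_sum_stdAddChar_le c (A t) (B t)
    _ ≤ √c * (√(∫ t in (-U)..U, ∑ x, ‖A t x‖ ^ 2) * √(∫ t in (-U)..U, ∑ y, ‖B t y‖ ^ 2)) := by
        rw [intervalIntegral.integral_const_mul]
        exact mul_le_mul_of_nonneg_left (intervalIntegral_sqrt_mul_sqrt_le (by linarith)
          (by fun_prop) (by fun_prop) (fun t => by positivity) fun t => by positivity)
          (Real.sqrt_nonneg _)
    _ ≤ √c * (√(96 * (D + U) * ∑' d, ‖α d‖ ^ 2) * √(96 * (N + U) * ∑' n, ‖β n‖ ^ 2)) := by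
        gcongr
    _ = _ := by
        have hD' : 0 ≤ D + U := by linarith
        have hN' : 0 ≤ N + U := by linarith
        rw [Real.sqrt_mul (by positivity), Real.sqrt_mul (by positivity),
          Real.sqrt_mul (by positivity), Real.sqrt_mul (by positivity)]
        linear_combination (√c * √(D + U) * √(N + U) * √(∑' d, ‖α d‖ ^ 2) *
          √(∑' n, ‖β n‖ ^ 2)) * Real.mul_self_sqrt (by norm_num : (0 : ℝ) ≤ 96)
end

section
/- There is an absolute constant C > 0 such that for all reals D, N, U ≥ 1 and all finitely supported sequences α : ℕ → ℂ supported on (D, 2D] and β : ℕ → ℂ supported on (N, 2N], one has ∫_{-U}^{U} | Σ_{D < d ≤ 2D} α(d) d^{-it} | · | Σ_{N < n ≤ 2N} β(n) n^{it} | dt ≤ C (D + U)^{1/2} (N + U)^{1/2} ‖α‖₂ ‖β‖₂. -/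
open Complex MeasureTheory

theorem continuous_dirichlet_sum (s : Finset ℕ) (a : ℕ → ℂ) (l : ℕ → ℝ) :
    Continuous fun t : ℝ ↦ ∑ n ∈ s, a n * cexp (I * l n * t) := by
  fun_prop

theorem norm_sq_dirichlet_sum_mul_gaussian (s : Finset ℕ) (a : ℕ → ℂ) (l : ℕ → ℝ) (b t : ℝ) :
    ((‖∑ n ∈ s, a n * cexp (I * l n * t)‖ ^ 2 * Real.exp (-b * t ^ 2) : ℝ) : ℂ) =
      ∑ m ∈ s, ∑ n ∈ s, a m * (starRingEnd ℂ) (a n) *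
        (cexp (I * ((l m - l n : ℝ) : ℂ) * t) * cexp (-b * t ^ 2)) := by
  push_cast
  rw [← Complex.mul_conj', map_sum, Finset.sum_mul_sum, Finset.sum_mul]
  refine Finset.sum_congr rfl fun m _ ↦ ?_
  rw [Finset.sum_mul]
  refine Finset.sum_congr rfl fun n _ ↦ ?_
  have h : cexp (I * (l m - l n) * t) = cexp (I * l m * t) * cexp (-(I * l n * t)) := by
    rw [← Complex.exp_add]
    ring_nf
  rw [map_mul, ← Complex.exp_conj, h]
  simp only [map_mul, conj_I, conj_ofReal, neg_mul]
  ring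

theorem integrable_exp_mul_gaussian {b : ℝ} (hb : 0 < b) (x : ℝ) :
    Integrable fun t : ℝ ↦ cexp (I * x * t) * cexp (-b * t ^ 2) := by
  refine (integrable_cexp_quadratic (b := (b : ℂ)) (by simpa using hb) (I * x) 0).congr ?_
  refine Filter.Eventually.of_forall fun t ↦ ?_
  simp only [← Complex.exp_add]
  ring_nf

theorem norm_integral_exp_mul_gaussian {b : ℝ} (hb : 0 < b) (x : ℝ) :
    ‖∫ t : ℝ, cexp (I * x * t) * cexp (-b * t ^ 2)‖ =
      √(Real.pi / b) * Real.exp (-x ^ 2 / (4 * b)) := by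
  rw [fourierIntegral_gaussian (b := (b : ℂ)) (by simpa using hb) x, norm_mul]
  congr 1
  · rw [← ofReal_div, norm_cpow_eq_rpow_re_of_pos (by positivity), Real.sqrt_eq_rpow]
    norm_num
  · rw [Complex.norm_exp]
    norm_cast

theorem integrable_norm_sq_dirichlet_sum_mul_gaussian (s : Finset ℕ) (a : ℕ → ℂ) (l : ℕ → ℝ)
    {b : ℝ} (hb : 0 < b) :
    Integrable fun t : ℝ ↦
      ‖∑ n ∈ s, a n * cexp (I * l n * t)‖ ^ 2 * Real.exp (-b * t ^ 2) := by
  have h : Integrable fun t : ℝ ↦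
      ((‖∑ n ∈ s, a n * cexp (I * l n * t)‖ ^ 2 * Real.exp (-b * t ^ 2) : ℝ) : ℂ) := by
    simp_rw [norm_sq_dirichlet_sum_mul_gaussian]
    exact integrable_finsetSum _ fun m _ ↦ integrable_finsetSum _ fun n _ ↦
      (integrable_exp_mul_gaussian hb _).const_mul _
  exact h.re

theorem integral_norm_sq_dirichlet_sum_mul_gaussian_le (s : Finset ℕ) (a : ℕ → ℂ) (l : ℕ → ℝ)
    {b : ℝ} (hb : 0 < b) :
    ∫ t : ℝ, ‖∑ n ∈ s, a n * cexp (I * l n * t)‖ ^ 2 * Real.exp (-b * t ^ 2) ≤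
      √(Real.pi / b) * ∑ m ∈ s, ∑ n ∈ s,
        ‖a m‖ * ‖a n‖ * Real.exp (-(l m - l n) ^ 2 / (4 * b)) := by
  have hint (m n : ℕ) : Integrable fun t : ℝ ↦ a m * (starRingEnd ℂ) (a n) *
      (cexp (I * ((l m - l n : ℝ) : ℂ) * t) * cexp (-b * t ^ 2)) :=
    (integrable_exp_mul_gaussian hb _).const_mul _
  refine (le_abs_self _).trans ?_
  rw [← Real.norm_eq_abs, ← Complex.norm_real, ← integral_complex_ofReal]
  simp_rw [norm_sq_dirichlet_sum_mul_gaussian]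
  rw [integral_finsetSum _ fun m _ ↦ integrable_finsetSum _ fun n _ ↦ hint m n, Finset.mul_sum]
  refine (norm_sum_le _ _).trans (Finset.sum_le_sum fun m _ ↦ ?_)
  rw [integral_finsetSum _ fun n _ ↦ hint m n, Finset.mul_sum]
  refine (norm_sum_le _ _).trans (Finset.sum_le_sum fun n _ ↦ ?_)
  rw [integral_const_mul, norm_mul, norm_integral_exp_mul_gaussian hb, norm_mul, RCLike.norm_conj]
  exact le_of_eq (by ring)

/-- Schur's test for a symmetric nonnegative kernel. -/
theorem sum_sum_mul_kernel_le {ι : Type*} (s : Finset ι) (x : ι → ℝ) (K : ι → ι → ℝ)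
    (hK : ∀ m n, 0 ≤ K m n) (hsymm : ∀ m n, K m n = K n m) {C : ℝ}
    (hC : ∀ m ∈ s, ∑ n ∈ s, K m n ≤ C) :
    ∑ m ∈ s, ∑ n ∈ s, x m * x n * K m n ≤ C * ∑ m ∈ s, x m ^ 2 := by
  have hrow : ∑ m ∈ s, ∑ n ∈ s, x m ^ 2 * K m n ≤ C * ∑ m ∈ s, x m ^ 2 := by
    rw [Finset.mul_sum]
    refine Finset.sum_le_sum fun m hm ↦ ?_
    rw [← Finset.mul_sum, mul_comm]
    exact mul_le_mul_of_nonneg_right (hC m hm) (sq_nonneg _)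
  have hcol : ∑ m ∈ s, ∑ n ∈ s, x n ^ 2 * K m n = ∑ m ∈ s, ∑ n ∈ s, x m ^ 2 * K m n := by
    rw [Finset.sum_comm]
    simp_rw [hsymm]
  have hle : ∑ m ∈ s, ∑ n ∈ s, x m * x n * K m n ≤
      ∑ m ∈ s, ∑ n ∈ s, (x m ^ 2 * K m n + x n ^ 2 * K m n) / 2 :=
    Finset.sum_le_sum fun m _ ↦ Finset.sum_le_sum fun n _ ↦ by
      nlinarith [mul_nonneg (sq_nonneg (x m - x n)) (hK m n)]
  simp_rw [← Finset.sum_div, Finset.sum_add_distrib] at hle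
  linarith

theorem summable_exp_neg_int_sq_div {c : ℝ} (hc : 0 < c) :
    Summable fun k : ℤ ↦ Real.exp (-(k : ℝ) ^ 2 / c) := by
  have h : Summable fun k : ℕ ↦ Real.exp (-(k : ℝ) ^ 2 / c) := by
    refine Summable.of_nonneg_of_le (fun _ ↦ (Real.exp_pos _).le) (fun k ↦ ?_)
      (Real.summable_exp_nat_mul_iff.mpr (show -(1 / c) < 0 by simpa using hc))
    rw [Real.exp_le_exp, neg_div, mul_neg, neg_le_neg_iff, mul_one_div]
    have : (k : ℝ) ≤ (k : ℝ) ^ 2 := mod_cast Nat.le_self_pow two_ne_zero k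
    gcongr
  refine Summable.of_nat_of_neg ?_ ?_ <;> simpa using h

/-- The mean-value large sieve for frequencies `l n` with spacing `1 / (2 V)`. -/
theorem exists_mean_value_bound :
    ∃ C : ℝ, 0 < C ∧ ∀ (s : Finset ℕ) (a : ℕ → ℂ) (l : ℕ → ℝ) (U V : ℝ), 0 ≤ U → 0 < V → U ≤ V →
      (∀ m ∈ s, ∀ n ∈ s, |(m : ℝ) - n| ≤ 2 * V * |l m - l n|) →
      ∫ t in (-U)..U, ‖∑ n ∈ s, a n * cexp (I * l n * t)‖ ^ 2 ≤ C * V * ∑ n ∈ s, ‖a n‖ ^ 2 := by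
  have hsum := summable_exp_neg_int_sq_div (c := 16) (by norm_num)
  set T : ℝ := ∑' k : ℤ, Real.exp (-(k : ℝ) ^ 2 / 16) with hT
  have hTpos : 0 < T := hsum.tsum_pos (fun _ ↦ (Real.exp_pos _).le) 0 (Real.exp_pos _)
  refine ⟨Real.exp 1 * √Real.pi * T, by positivity, fun s a l U V hU hV hUV hl ↦ ?_⟩
  have hb : 0 < 1 / V ^ 2 := by positivity
  have hint := integrable_norm_sq_dirichlet_sum_mul_gaussian s a l hb
  have hrow : ∀ m ∈ s, ∑ n ∈ s, Real.exp (-(l m - l n) ^ 2 / (4 * (1 / V ^ 2))) ≤ T := by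
    intro m hm
    calc ∑ n ∈ s, Real.exp (-(l m - l n) ^ 2 / (4 * (1 / V ^ 2)))
        ≤ ∑ n ∈ s, Real.exp (-(((m : ℤ) - n : ℤ) : ℝ) ^ 2 / 16) := by
          refine Finset.sum_le_sum fun n hn ↦ Real.exp_le_exp.mpr ?_
          have h := pow_le_pow_left₀ (abs_nonneg _) (hl m hm n hn) 2
          rw [mul_pow, sq_abs, sq_abs] at h
          have e : -(l m - l n) ^ 2 / (4 * (1 / V ^ 2)) = -(V ^ 2 * (l m - l n) ^ 2) / 4 := by
            field_simp
          rw [e]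
          push_cast
          linarith
      _ = ∑ k ∈ s.image fun n : ℕ ↦ (m : ℤ) - n, Real.exp (-(k : ℝ) ^ 2 / 16) := by
          rw [Finset.sum_image]
          intro x _ y _ h
          simpa using h
      _ ≤ T := hsum.sum_le_tsum _ fun _ _ ↦ (Real.exp_pos _).le
  have hschur := sum_sum_mul_kernel_le s (fun n ↦ ‖a n‖)
    (fun m n ↦ Real.exp (-(l m - l n) ^ 2 / (4 * (1 / V ^ 2)))) (fun _ _ ↦ (Real.exp_pos _).le)
    (fun m n ↦ by rw [← neg_sub, neg_sq]) hrow
  have hroot : √(Real.pi / (1 / V ^ 2)) = √Real.pi * V := by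
    rw [div_div_eq_mul_div, div_one, Real.sqrt_mul Real.pi_pos.le, Real.sqrt_sq hV.le]
  rw [intervalIntegral.integral_of_le (by linarith)]
  calc ∫ t in Set.Ioc (-U) U, ‖∑ n ∈ s, a n * cexp (I * l n * t)‖ ^ 2
      ≤ ∫ t in Set.Ioc (-U) U, Real.exp 1 *
          (‖∑ n ∈ s, a n * cexp (I * l n * t)‖ ^ 2 * Real.exp (-(1 / V ^ 2) * t ^ 2)) := by
        refine setIntegral_mono_on ?_ (hint.const_mul _).integrableOn measurableSet_Ioc ?_
        · exact ((continuous_dirichlet_sum s a l).norm.pow 2).integrableOn_Ioc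
        · intro t ht
          have h : t ^ 2 ≤ V ^ 2 := sq_le_sq' (by linarith [ht.1]) (by linarith [ht.2])
          have h1 : 1 ≤ Real.exp 1 * Real.exp (-(1 / V ^ 2) * t ^ 2) := by
            rw [← Real.exp_add, Real.one_le_exp_iff]
            have : t ^ 2 / V ^ 2 ≤ 1 := (div_le_one (by positivity)).mpr h
            linarith [show -(1 / V ^ 2) * t ^ 2 = -(t ^ 2 / V ^ 2) by ring]
          rw [mul_left_comm]
          exact le_mul_of_one_le_right (sq_nonneg _) h1
    _ ≤ ∫ t : ℝ, Real.exp 1 *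
          (‖∑ n ∈ s, a n * cexp (I * l n * t)‖ ^ 2 * Real.exp (-(1 / V ^ 2) * t ^ 2)) :=
        setIntegral_le_integral (hint.const_mul _) (Filter.Eventually.of_forall fun _ ↦ by positivity)
    _ ≤ Real.exp 1 * (√Real.pi * V * (T * ∑ n ∈ s, ‖a n‖ ^ 2)) := by
        rw [integral_const_mul]
        gcongr
        refine (integral_norm_sq_dirichlet_sum_mul_gaussian_le s a l hb).trans ?_
        rw [hroot]
        gcongr
    _ = _ := by ring

theorem abs_sub_le_mul_abs_log_sub {B x y : ℝ} (hx : 0 < x) (hy : 0 < y) (hxB : x ≤ B)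
    (hyB : y ≤ B) : |x - y| ≤ B * |Real.log x - Real.log y| := by
  wlog h : y ≤ x generalizing x y
  · rw [abs_sub_comm, abs_sub_comm (Real.log x)]
    exact this hy hx hyB hxB (le_of_not_ge h)
  have hlog := Real.log_le_log hy h
  rw [abs_of_nonneg (by linarith), abs_of_nonneg (by linarith)]
  have h1 := Real.one_sub_inv_le_log_of_pos (div_pos hx hy)
  rw [Real.log_div hx.ne' hy.ne', inv_div] at h1
  calc x - y = x * (1 - y / x) := by field_simp
    _ ≤ x * (Real.log x - Real.log y) := by gcongr
    _ ≤ B * (Real.log x - Real.log y) := by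
        have : 0 ≤ Real.log x - Real.log y := by linarith
        gcongr

/-- The Cauchy–Schwarz inequality for continuous functions on an interval. -/
theorem intervalIntegral_norm_mul_norm_le {f g : ℝ → ℂ} (hf : Continuous f) (hg : Continuous g)
    {a b : ℝ} (hab : a ≤ b) :
    ∫ t in a..b, ‖f t‖ * ‖g t‖ ≤ √(∫ t in a..b, ‖f t‖ ^ 2) * √(∫ t in a..b, ‖g t‖ ^ 2) := by
  have hmem {h : ℝ → ℂ} (hh : Continuous h) :
      MemLp (fun t ↦ ‖h t‖) (ENNReal.ofReal 2) (volume.restrict (Set.Ioc a b)) := by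
    rw [ENNReal.ofReal_ofNat, memLp_two_iff_integrable_sq hh.norm.aestronglyMeasurable]
    exact (hh.norm.pow 2).integrableOn_Ioc
  simp_rw [intervalIntegral.integral_of_le hab, Real.sqrt_eq_rpow]
  simpa using integral_mul_le_Lp_mul_Lq_of_nonneg Real.HolderConjugate.two_two
    (Filter.Eventually.of_forall fun _ ↦ norm_nonneg _)
    (Filter.Eventually.of_forall fun _ ↦ norm_nonneg _) (hmem hf) (hmem hg)

theorem tsum_norm_sq_eq_sum {γ : ℕ → ℂ} (hγ : (Function.support γ).Finite) :
    ∑' n, ‖γ n‖ ^ 2 = ∑ n ∈ hγ.toFinset, ‖γ n‖ ^ 2 :=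
  tsum_eq_sum fun n hn ↦ by simpa using hn

theorem tsum_mul_cpow_eq_sum {γ : ℕ → ℂ} (hγ : (Function.support γ).Finite) (h0 : γ 0 = 0)
    (ε t : ℝ) :
    ∑' n : ℕ, γ n * (n : ℂ) ^ (ε * (I * t)) =
      ∑ n ∈ hγ.toFinset, γ n * cexp (I * (ε * Real.log n : ℝ) * t) := by
  rw [tsum_eq_sum (s := hγ.toFinset) fun n hn ↦ by
    rw [Set.Finite.mem_toFinset, Function.notMem_support] at hn
    rw [hn, zero_mul]]
  refine Finset.sum_congr rfl fun n hn ↦ ?_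
  have hn0 : (n : ℂ) ≠ 0 := by
    rw [Nat.cast_ne_zero]
    rintro rfl
    exact hγ.mem_toFinset.mp hn h0
  rw [cpow_def_of_ne_zero hn0, ofReal_mul, ← natCast_log]
  ring_nf

theorem eq_zero_of_support_subset {γ : ℕ → ℂ} {M : ℝ} (hM : 1 ≤ M)
    (hs : Function.support γ ⊆ {n : ℕ | M < n ∧ (n : ℝ) ≤ 2 * M}) : γ 0 = 0 := by
  by_contra h
  have := (hs h).1
  norm_num at this
  linarith

/-- The mean-value large sieve for Dirichlet polynomials supported on a dyadic interval. -/
theorem exists_dyadic_mean_value_bound :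
    ∃ C : ℝ, 0 < C ∧ ∀ (γ : ℕ → ℂ) (M U ε : ℝ), 1 ≤ M → 1 ≤ U → |ε| = 1 →
      ∀ hγ : (Function.support γ).Finite,
        (Function.support γ ⊆ {n : ℕ | M < n ∧ (n : ℝ) ≤ 2 * M}) →
        ∫ t in (-U)..U, ‖∑ n ∈ hγ.toFinset, γ n * cexp (I * (ε * Real.log n : ℝ) * t)‖ ^ 2 ≤
          C * (M + U) * ∑ n ∈ hγ.toFinset, ‖γ n‖ ^ 2 := by
  obtain ⟨C, hC, hmv⟩ := exists_mean_value_bound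
  refine ⟨C, hC, fun γ M U ε hM hU hε hγ hs ↦ ?_⟩
  refine hmv _ γ (fun n ↦ ε * Real.log n) U (M + U) (by linarith) (by linarith) (by linarith)
    fun m hm n hn ↦ ?_
  have hm := hs (hγ.mem_toFinset.mp hm)
  have hn := hs (hγ.mem_toFinset.mp hn)
  rw [← mul_sub, abs_mul, hε, one_mul]
  exact abs_sub_le_mul_abs_log_sub (by linarith [hm.1]) (by linarith [hn.1])
    (by linarith [hm.2]) (by linarith [hn.2])

/-- Bilinear mean-value large sieve estimate: for sequences `α` supported on `(D, 2D]` and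
`β` supported on `(N, 2N]`,
`∫_{-U}^{U} |∑_d α(d) d^{-it}| |∑_n β(n) n^{it}| dt
  ≤ C (D+U)^{1/2} (N+U)^{1/2} ‖α‖₂ ‖β‖₂`. -/
theorem bilinear_large_sieve :
    ∃ C : ℝ, 0 < C ∧ ∀ D N U : ℝ, 1 ≤ D → 1 ≤ N → 1 ≤ U →
      ∀ α β : ℕ → ℂ, (Function.support α).Finite → (Function.support β).Finite →
        (Function.support α ⊆ {d : ℕ | D < d ∧ (d : ℝ) ≤ 2 * D}) →
        (Function.support β ⊆ {n : ℕ | N < n ∧ (n : ℝ) ≤ 2 * N}) →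
        (∫ t in (-U)..U,
            ‖∑' d : ℕ, α d * (d : ℂ) ^ (-(Complex.I * t))‖ *
              ‖∑' n : ℕ, β n * (n : ℂ) ^ (Complex.I * t)‖)
          ≤ C * Real.sqrt (D + U) * Real.sqrt (N + U) *
              Real.sqrt (∑' d : ℕ, ‖α d‖ ^ 2) * Real.sqrt (∑' n : ℕ, ‖β n‖ ^ 2) := by
  obtain ⟨C, hC, hmv⟩ := exists_dyadic_mean_value_bound
  refine ⟨C, hC, fun D N U hD hN hU α β hα hβ hαs hβs ↦ ?_⟩
  have hαe (t : ℝ) := tsum_mul_cpow_eq_sum hα (eq_zero_of_support_subset hD hαs) (-1) t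
  have hβe (t : ℝ) := tsum_mul_cpow_eq_sum hβ (eq_zero_of_support_subset hN hβs) 1 t
  rw [ofReal_neg, ofReal_one] at hαe
  rw [ofReal_one] at hβe
  simp_rw [neg_one_mul (I * _)] at hαe
  simp_rw [one_mul (I * _)] at hβe
  simp_rw [hαe, hβe, tsum_norm_sq_eq_sum hα, tsum_norm_sq_eq_sum hβ]
  have hαb := hmv α D U (-1) hD hU (by norm_num) hα hαs
  have hβb := hmv β N U 1 hN hU (by norm_num) hβ hβs
  refine (intervalIntegral_norm_mul_norm_le
    (continuous_dirichlet_sum _ α fun n ↦ -1 * Real.log n)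
    (continuous_dirichlet_sum _ β fun n ↦ 1 * Real.log n) (by linarith)).trans ?_
  refine (mul_le_mul (Real.sqrt_le_sqrt hαb) (Real.sqrt_le_sqrt hβb) (Real.sqrt_nonneg _)
    (Real.sqrt_nonneg _)).trans (le_of_eq ?_)
  rw [Real.sqrt_mul (by positivity), Real.sqrt_mul hC.le, Real.sqrt_mul (by positivity),
    Real.sqrt_mul hC.le]
  linear_combination (√(D + U) * √(N + U) * √(∑ n ∈ hα.toFinset, ‖α n‖ ^ 2) *
    √(∑ n ∈ hβ.toFinset, ‖β n‖ ^ 2)) * Real.mul_self_sqrt hC.le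
end

section
/- For every positive integer c and every Dirichlet character χ modulo c, the Gauss sum satisfies |τ(χ)| ≤ √c, where τ(χ) := Σ_{x mod c} χ(x) e(x/c). -/
open Complex

/-- Parseval's identity for the Fourier transform attached to a primitive additive character of a
finite commutative ring. -/
lemma AddChar.IsPrimitive.sum_norm_sq_sum_mulShift {R : Type*} [CommRing R] [Fintype R]
    {ψ : AddChar R ℂ} (hψ : ψ.IsPrimitive) (f : R → ℂ) :
    ∑ k, ‖∑ x, f x * ψ.mulShift k x‖ ^ 2 = Fintype.card R * ∑ x, ‖f x‖ ^ 2 := by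
  classical
  have expand (k : R) : ((‖∑ x, f x * ψ.mulShift k x‖ ^ 2 : ℝ) : ℂ) =
      ∑ x, ∑ y, f x * starRingEnd ℂ (f y) * ψ (k * (x - y)) := by
    rw [ofReal_pow, ← mul_conj', map_sum, Finset.sum_mul_sum]
    refine Finset.sum_congr rfl fun x _ ↦ Finset.sum_congr rfl fun y _ ↦ ?_
    rw [map_mul, AddChar.mulShift_apply, AddChar.mulShift_apply, ← AddChar.map_neg_eq_conj,
      mul_sub, sub_eq_add_neg, AddChar.map_add_eq_mul]
    ring
  apply ofReal_injective
  rw [ofReal_sum, Finset.sum_congr rfl fun k _ ↦ expand k, Finset.sum_comm]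
  push_cast
  rw [Finset.mul_sum]
  refine Finset.sum_congr rfl fun x _ ↦ ?_
  rw [Finset.sum_comm]
  simp_rw [← Finset.mul_sum, AddChar.sum_mulShift _ hψ, sub_eq_zero]
  simp [mul_conj', mul_comm]

/-- The Gauss sum of a multiplicative character of a finite commutative ring `R` with respect to a
primitive additive character has absolute value at most `√|R|`. -/
lemma AddChar.IsPrimitive.norm_gaussSum_le {R : Type*} [CommRing R] [Fintype R]
    {ψ : AddChar R ℂ} (hψ : ψ.IsPrimitive) (χ : MulChar R ℂ) :
    ‖gaussSum χ ψ‖ ≤ √(Fintype.card R) := by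
  have weight (k : R) : ‖χ k‖ ^ 2 * ‖gaussSum χ ψ‖ ^ 2 ≤ ‖gaussSum χ (ψ.mulShift k)‖ ^ 2 := by
    by_cases hk : IsUnit k
    · obtain ⟨u, rfl⟩ := hk
      rw [gaussSum_mulShift_eq, norm_mul, mul_pow, ← MulChar.star_apply', norm_star]
    · simp [χ.map_nonunit hk]
  have pos : 0 < ∑ k, ‖χ k‖ ^ 2 :=
    Finset.sum_pos' (fun _ _ ↦ sq_nonneg _) ⟨1, Finset.mem_univ _, by simp⟩
  refine Real.le_sqrt_of_sq_le (le_of_mul_le_mul_left ?_ pos)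
  calc (∑ k, ‖χ k‖ ^ 2) * ‖gaussSum χ ψ‖ ^ 2
      ≤ ∑ k, ‖gaussSum χ (ψ.mulShift k)‖ ^ 2 := by
        rw [Finset.sum_mul]
        exact Finset.sum_le_sum fun k _ ↦ weight k
    _ = (∑ k, ‖χ k‖ ^ 2) * Fintype.card R := by
        rw [mul_comm]
        exact hψ.sum_norm_sq_sum_mulShift χ

lemma stdAddChar_eq_e {c : ℕ} [NeZero c] (x : ZMod c) :
    ZMod.stdAddChar x = e ((x.val : ℝ) / c) := by
  have h := ZMod.stdAddChar_coe (N := c) (x.val : ℤ)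
  rw [Int.cast_natCast, ZMod.natCast_rightInverse x] at h
  rw [h, e]
  push_cast
  rw [mul_div_assoc]

/-- The Gauss sum `τ(χ) = ∑_{x mod c} χ(x) e(x/c)` of any Dirichlet character mod `c`
satisfies `|τ(χ)| ≤ √c`. -/
theorem gaussSum_le_sqrt (c : ℕ) [NeZero c] (χ : DirichletCharacter ℂ c) :
    ‖∑ x : ZMod c, χ x * e ((x.val : ℝ) / c)‖ ≤ Real.sqrt c := by
  simp_rw [← stdAddChar_eq_e]
  simpa [gaussSum, ZMod.card] using (ZMod.isPrimitive_stdAddChar c).norm_gaussSum_le χ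
end

section
/- Let δ₀, δ', n₁, n₂, d₂', f₁, f₂ be positive integers with f₂ ∣ n₁, and set n₁' := n₁/f₂ and c' := d₂' f₁ f₂. Assume gcd(δ', c') = 1 and gcd(d₂', δ' f₁) = 1. Let x be an integer inverse of δ' modulo c', let y be an integer inverse of δ'·d₂' modulo f₁, and let z be an integer inverse of d₂' modulo δ' f₁. Then for each sign s ∈ {+1, −1}: e( −s · x δ₀ n₁² n₂ / c' ) · e( s · y δ₀ f₂ (n₁')² n₂ / f₁ ) = e( −s · δ₀ n₁² n₂ / (δ' c') ) · e( s · z δ₀ f₂ (n₁')² n₂ / (δ' f₁) ). -/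
open Complex

lemma e_add (a b : ℝ) : e (a + b) = e a * e b := by
  simp only [e, ← Complex.exp_add]
  push_cast
  ring_nf

lemma e_add_intCast (a : ℝ) (m : ℤ) : e (a + m) = e a := by
  simp only [e]
  rw [Complex.exp_eq_exp_iff_exists_int]
  exact ⟨m, by push_cast; ring⟩

lemma ZMod.natCast_dvd_sub_one_of_intCast_eq_one {m : ℕ} {a : ℤ} (h : (a : ZMod m) = 1) :
    (m : ℤ) ∣ a - 1 := by
  rw [← ZMod.intCast_zmod_eq_zero_iff_dvd]
  simp [h]

/-- The combined numerator of the double reciprocity is divisible by the common denominator. -/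
lemma mul_mul_dvd_of_inverses {a d f : ℕ} (had : a.Coprime d) (haf : a.Coprime f)
    (hdf : d.Coprime f) {x y z : ℤ} (hx : (d * f : ℤ) ∣ a * x - 1)
    (hy : (f : ℤ) ∣ a * d * y - 1) (hz : (a * f : ℤ) ∣ d * z - 1) :
    (a * d * f : ℤ) ∣ 1 - x * a + y * a * d - z * d := by
  have hcad : IsCoprime (a : ℤ) d := Nat.isCoprime_iff_coprime.2 had
  have hcaf : IsCoprime (a : ℤ) f := Nat.isCoprime_iff_coprime.2 haf
  have hcdf : IsCoprime (d : ℤ) f := Nat.isCoprime_iff_coprime.2 hdf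
  obtain ⟨u, hu⟩ := hx
  obtain ⟨v, hv⟩ := hy
  obtain ⟨w, hw⟩ := hz
  refine IsCoprime.mul_dvd (hcaf.mul_left hcdf) (hcad.mul_dvd ?_ ?_) ?_
  · exact ⟨-x + y * d - f * w, by linear_combination -hw⟩
  · exact ⟨-(f * u) + y * a - z, by linear_combination -hu⟩
  · exact ⟨-(d * u) + v - a * w, by linear_combination -hu + hv - hw⟩

/-- Double-reciprocity identity for the exponential factors arising from the Voronoi
summation formula: with `n₁' = n₁/f₂`, `c' = d₂' f₁ f₂`, inverses `x` of `δ'` mod `c'`,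
`y` of `δ' d₂'` mod `f₁`, and `z` of `d₂'` mod `δ' f₁`, for each sign `s = ±1`:
`e(-s x δ₀ n₁² n₂ / c') e(s y δ₀ f₂ n₁'² n₂ / f₁)
  = e(-s δ₀ n₁² n₂ / (δ' c')) e(s z δ₀ f₂ n₁'² n₂ / (δ' f₁))`. -/
theorem voronoi_exponential_identity
    (δ₀ δ' n₁ n₂ d₂' f₁ f₂ : ℕ)
    (hδ₀ : 0 < δ₀) (hδ' : 0 < δ') (hn₁ : 0 < n₁) (hn₂ : 0 < n₂)
    (hd₂' : 0 < d₂') (hf₁ : 0 < f₁) (hf₂ : 0 < f₂)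
    (hdvd : f₂ ∣ n₁)
    (n₁' c' : ℕ) (hn₁' : n₁' = n₁ / f₂) (hc' : c' = d₂' * f₁ * f₂)
    (hcop₁ : Nat.gcd δ' c' = 1) (hcop₂ : Nat.gcd d₂' (δ' * f₁) = 1)
    (x y z : ℤ)
    (hx : ((δ' * x : ℤ) : ZMod c') = 1)
    (hy : ((δ' * d₂' * y : ℤ) : ZMod f₁) = 1)
    (hz : ((d₂' * z : ℤ) : ZMod (δ' * f₁)) = 1)
    (s : ℤ) (hs : s = 1 ∨ s = -1) :
    e (((-s * x * δ₀ * n₁ ^ 2 * n₂ : ℤ) : ℝ) / c') *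
        e (((s * y * δ₀ * f₂ * n₁' ^ 2 * n₂ : ℤ) : ℝ) / f₁) =
      e (((-s * δ₀ * n₁ ^ 2 * n₂ : ℤ) : ℝ) / (δ' * c' : ℕ)) *
        e (((s * z * δ₀ * f₂ * n₁' ^ 2 * n₂ : ℤ) : ℝ) / (δ' * f₁ : ℕ)) := by
  obtain ⟨m, rfl⟩ := hdvd
  rw [Nat.mul_div_cancel_left _ hf₂] at hn₁'
  subst hn₁' hc'
  have hδd : δ'.Coprime d₂' :=
    (Nat.Coprime.coprime_mul_right_right hcop₂).symm
  have hδf : δ'.Coprime f₁ :=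
    Nat.Coprime.coprime_mul_left_right (Nat.Coprime.coprime_mul_right_right hcop₁)
  have hdf : d₂'.Coprime f₁ := Nat.Coprime.coprime_mul_left_right hcop₂
  have hx' := ZMod.natCast_dvd_sub_one_of_intCast_eq_one hx
  have hy' := ZMod.natCast_dvd_sub_one_of_intCast_eq_one hy
  have hz' := ZMod.natCast_dvd_sub_one_of_intCast_eq_one hz
  push_cast at hx' hz'
  obtain ⟨k, hk⟩ :=
    mul_mul_dvd_of_inverses hδd hδf hdf (dvd_of_mul_right_dvd hx') hy' hz'
  have hkR : (1 - x * δ' + y * δ' * d₂' - z * d₂' : ℝ) = δ' * d₂' * f₁ * k := by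
    exact_mod_cast hk
  rw [← e_add, ← e_add,
    ← e_add_intCast (_ + _ / ((δ' * f₁ : ℕ) : ℝ)) (s * δ₀ * f₂ * n₁' ^ 2 * n₂ * k)]
  congr 1
  have h1 : (δ' : ℝ) ≠ 0 := by positivity
  have h2 : (d₂' : ℝ) ≠ 0 := by positivity
  have h3 : (f₁ : ℝ) ≠ 0 := by positivity
  have h4 : (f₂ : ℝ) ≠ 0 := by positivity
  push_cast
  field_simp
  linear_combination (s * n₁' ^ 2 : ℝ) * hkR
end

section
/- Let σ, ε ∈ {+1, −1}, let δ and c be positive integers, set δ₀ := gcd(δ, c), δ' := δ/δ₀, c' := c/δ₀, and let n₁, n₂ be positive integers with n₁ ∣ c'. Define T := Σ_{d mod c, gcd(d,c)=1} e(σ d / c) · S( δ̄' d, ε n₂ ; c'/n₁ ), where δ̄' is an integer inverse of δ' modulo c'/n₁ (note gcd(δ', c') = 1 holds automatically). Then: (1) if gcd(δ₀, c') > 1, then T = 0; (2) if gcd(δ₀, c') = 1, then T = e( −εσ · \overline{δ'} δ₀ n₁² n₂ / c' ) · (φ(c'/n₁)/φ(c')) · (μ(δ₀)/δ₀) · c ·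 Σ_{d₂' f₁ f₂ = c', gcd(d₂', f₁ n₁ n₂) = 1, gcd(f₁, f₂) = 1, f₂ ∣ n₁} (μ(f₁)² μ(f₂) / f₁) · e( εσ · \overline{δ' d₂'} δ₀ f₂ (n₁')² n₂ / f₁ ), where n₁' := n₁/f₂, \overline{δ'} in the front factor is an integer inverse of δ' modulo c', and \overline{δ' d₂'} is an integer inverse of δ'·d₂' modulo f₁. -/
open Complex

/-- The Kloosterman sum `S(m, n; q) = ∑_{x mod q, (x,q)=1} e((m x + n x̄)/q)`. -/
noncomputable def kloosterman (m n : ℤ) (q : ℕ) : ℂ :=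
  ∑ x ∈ Finset.range q, if Nat.gcd x q = 1 then
    e (((m * (x : ℤ) + n * ((((x : ZMod q))⁻¹.val : ℤ)) : ℤ) : ℝ) / q) else 0

/-- `eDiv a q = e(a / q)` for an integer numerator `a` and a natural denominator `q`. -/
noncomputable def eDiv (a : ℤ) (q : ℕ) : ℂ := e ((a : ℝ) / q)

lemma eDiv_def (a : ℤ) (q : ℕ) : eDiv a q = e ((a : ℝ) / q) := rfl

lemma eDiv_add (a b : ℤ) (q : ℕ) : eDiv (a + b) q = eDiv a q * eDiv b q := by
  simp only [eDiv, e, ← Complex.exp_add]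
  congr 1
  push_cast
  ring

lemma eDiv_eq_one_iff {a : ℤ} {q : ℕ} (hq : 0 < q) : eDiv a q = 1 ↔ (q : ℤ) ∣ a := by
  have hq' : (q : ℂ) ≠ 0 := by exact_mod_cast hq.ne'
  rw [eDiv, e, Complex.exp_eq_one_iff]
  constructor
  · rintro ⟨n, hn⟩
    refine ⟨n, ?_⟩
    have h1 : (a : ℂ) / q = n := by
      have := Complex.two_pi_I_ne_zero
      apply mul_left_cancel₀ this
      rw [mul_comm _ (n : ℂ), ← hn]
      push_cast
      ring
    rw [div_eq_iff hq'] at h1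
    rw [mul_comm]
    exact_mod_cast h1
  · rintro ⟨n, rfl⟩
    refine ⟨n, ?_⟩
    push_cast
    field_simp

lemma eDiv_congr {a b : ℤ} {q : ℕ} (hq : 0 < q) (h : (q : ℤ) ∣ a - b) :
    eDiv a q = eDiv b q := by
  have h1 := eDiv_add (a - b) b q
  rwa [sub_add_cancel, (eDiv_eq_one_iff hq).2 h, one_mul] at h1

lemma eDiv_mul_mul {k : ℕ} (hk : 0 < k) (a : ℤ) (q : ℕ) :
    eDiv (k * a) (k * q) = eDiv a q := by
  have hk' : (k : ℝ) ≠ 0 := by exact_mod_cast hk.ne'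
  rw [eDiv, eDiv]
  push_cast
  rw [mul_div_mul_left _ _ hk']

lemma eDiv_mul_natCast (a : ℤ) (k q : ℕ) : eDiv (a * k) q = eDiv a q ^ k := by
  induction k with
  | zero => simp [eDiv, e]
  | succ k ih => rw [pow_succ, ← ih, ← eDiv_add]; push_cast; ring_nf

/-- Orthogonality of additive characters modulo `h`. -/
lemma sum_range_eDiv {h : ℕ} (hh : 0 < h) (a : ℤ) :
    ∑ k ∈ Finset.range h, eDiv (a * k) h = if (h : ℤ) ∣ a then (h : ℂ) else 0 := by
  simp only [eDiv_mul_natCast]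
  split_ifs with hd
  · simp [(eDiv_eq_one_iff hh).2 hd]
  · have hne : eDiv a h ≠ 1 := fun H => hd ((eDiv_eq_one_iff hh).1 H)
    rw [geom_sum_eq hne, ← eDiv_mul_natCast, (eDiv_eq_one_iff hh).2 (dvd_mul_left _ _)]
    simp

/-- Reciprocity: `e(a / (t m))` splits into its components modulo `m` and `t`. -/
lemma eDiv_reciprocity {t m : ℕ} (ht : 0 < t) (hm : 0 < m) (hcop : Nat.Coprime t m) {t' m' : ℤ}
    (ht' : (m : ℤ) ∣ t * t' - 1) (hm' : (t : ℤ) ∣ m * m' - 1) (a : ℤ) :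
    eDiv (a * t') m * eDiv (a * m') t = eDiv a (t * m) := by
  rw [← eDiv_mul_mul ht, ← eDiv_mul_mul hm (a * m') t, mul_comm m t, ← eDiv_add]
  apply eDiv_congr (Nat.mul_pos ht hm)
  push_cast
  apply IsCoprime.mul_dvd (Nat.isCoprime_iff_coprime.2 hcop)
  · obtain ⟨u, hu⟩ := hm'
    exact ⟨a * t' + a * u, by linear_combination a * hu⟩
  · obtain ⟨u, hu⟩ := ht'
    exact ⟨a * m' + a * u, by linear_combination a * hu⟩

lemma sum_range_filter_dvd {t s : ℕ} (ht : 0 < t) (F : ℕ → ℂ) :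
    ∑ y ∈ Finset.range (t * s) with t ∣ y, F y = ∑ k ∈ Finset.range s, F (t * k) := by
  symm
  apply Finset.sum_nbij' (fun k => t * k) (fun y => y / t)
  · intro k hk
    simp only [Finset.mem_filter, Finset.mem_range] at hk ⊢
    exact ⟨Nat.mul_lt_mul_of_pos_left hk ht, dvd_mul_right _ _⟩
  · intro y hy
    simp only [Finset.mem_filter, Finset.mem_range] at hy ⊢
    exact Nat.div_lt_of_lt_mul hy.1
  · intro k _
    exact Nat.mul_div_cancel_left _ ht
  · intro y hy
    exact Nat.mul_div_cancel' (Finset.mem_filter.1 hy).2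
  · intros; rfl

lemma sum_moebius_divisors (n : ℕ) :
    ∑ t ∈ n.divisors, (ArithmeticFunction.moebius t : ℤ) = if n = 1 then 1 else 0 := by
  rw [← ArithmeticFunction.coe_mul_zeta_apply, ArithmeticFunction.moebius_mul_coe_zeta,
    ArithmeticFunction.one_apply]

/-- Möbius detection of the coprimality condition. -/
lemma sum_range_coprime {c : ℕ} (hc : 0 < c) (F : ℕ → ℂ) :
    ∑ y ∈ Finset.range c with Nat.gcd y c = 1, F y =
      ∑ t ∈ c.divisors, ((ArithmeticFunction.moebius t : ℤ) : ℂ) *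
        ∑ k ∈ Finset.range (c / t), F (t * k) := by
  have h1 : ∀ t ∈ c.divisors, ((ArithmeticFunction.moebius t : ℤ) : ℂ) *
        ∑ k ∈ Finset.range (c / t), F (t * k) =
      ∑ y ∈ Finset.range c, if t ∣ y then ((ArithmeticFunction.moebius t : ℤ) : ℂ) * F y else 0 := by
    intro t ht
    have htc := Nat.dvd_of_mem_divisors ht
    rw [← sum_range_filter_dvd (Nat.pos_of_mem_divisors ht), Nat.mul_div_cancel' htc,
      Finset.mul_sum, Finset.sum_filter]
  rw [Finset.sum_congr rfl h1, Finset.sum_comm, Finset.sum_filter]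
  refine Finset.sum_congr rfl fun y _ => ?_
  have h2 : (Nat.gcd y c).divisors = c.divisors.filter (fun t => t ∣ y) := by
    ext t
    simp [Nat.dvd_gcd_iff, hc.ne', and_comm]
  rw [← Finset.sum_filter, ← h2, ← Finset.sum_mul, ← Int.cast_sum, sum_moebius_divisors]
  split_ifs <;> simp

/-- Evaluation of Ramanujan sums. -/
lemma ramanujan_sum {c : ℕ} (hc : 0 < c) (m : ℤ) :
    ∑ d ∈ Finset.range c with Nat.gcd d c = 1, eDiv (m * d) c =
      ∑ g ∈ c.divisors with ((g : ℕ) : ℤ) ∣ m,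
        (g : ℂ) * ((ArithmeticFunction.moebius (c / g) : ℤ) : ℂ) := by
  rw [sum_range_coprime hc, Finset.sum_filter, ← Nat.sum_div_divisors c (fun g => ite _ _ _)]
  refine Finset.sum_congr rfl fun t ht => ?_
  have htc := Nat.dvd_of_mem_divisors ht
  have ht0 := Nat.pos_of_mem_divisors ht
  rw [Nat.div_div_self htc hc.ne']
  have hct : 0 < c / t := Nat.div_pos (Nat.le_of_dvd hc htc) ht0
  have h1 : ∀ k ∈ Finset.range (c / t), eDiv (m * ((t * k : ℕ) : ℤ)) c = eDiv (m * k) (c / t) := by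
    intro k _
    rw [← eDiv_mul_mul ht0 (m * k), Nat.mul_div_cancel' htc]
    push_cast
    ring_nf
  rw [Finset.sum_congr rfl h1, sum_range_eDiv hct]
  split_ifs <;> ring

lemma sum_range_filter_modEq {m s : ℕ} (hm : 0 < m) (k₀ : ℤ) (F : ℤ → ℂ)
    (hF : ∀ a b : ℤ, ((m * s : ℕ) : ℤ) ∣ a - b → F a = F b) :
    ∑ k ∈ Finset.range (m * s) with (m : ℤ) ∣ ((k : ℕ) : ℤ) - k₀, F k =
      ∑ j ∈ Finset.range s, F (k₀ + m * j) := by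
  have hm' : (0 : ℤ) < m := by exact_mod_cast hm
  have hr0 := Int.emod_nonneg k₀ hm'.ne'
  have hr1 := Int.emod_lt_of_pos k₀ hm'
  have hdiv := Int.emod_add_mul_ediv k₀ m
  obtain ⟨r, hr⟩ := Int.eq_ofNat_of_zero_le hr0
  rw [hr] at hr1 hdiv
  have hrm : r < m := by exact_mod_cast hr1
  have h1 : ∑ k ∈ Finset.range (m * s) with (m : ℤ) ∣ ((k : ℕ) : ℤ) - k₀, F k =
      ∑ j ∈ Finset.range s, F (r + m * j) := by
    symm
    apply Finset.sum_nbij' (fun j => r + m * j) (fun k => k / m)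
    · intro j hj
      simp only [Finset.mem_filter, Finset.mem_range] at hj ⊢
      refine ⟨?_, ⟨j - k₀ / m, ?_⟩⟩
      · nlinarith
      · push_cast
        linear_combination hdiv
    · intro y hy
      simp only [Finset.mem_filter, Finset.mem_range] at hy ⊢
      exact Nat.div_lt_of_lt_mul hy.1
    · intro j _
      simp [Nat.add_mul_div_left _ _ hm, Nat.div_eq_of_lt hrm]
    · intro y hy
      simp only [Finset.mem_filter] at hy
      have h2 : (m : ℤ) ∣ (y : ℤ) - r := by
        have : (m : ℤ) ∣ (y : ℤ) - k₀ + m * (k₀ / m) := dvd_add hy.2 (dvd_mul_right _ _)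
        convert this using 1
        linear_combination -hdiv
      have h3 : y % m = r := by
        have := (Nat.modEq_iff_dvd.2 h2 : r ≡ y [MOD m])
        rw [← this, Nat.mod_eq_of_lt hrm]
      have := Nat.mod_add_div y m
      omega
    · intros; push_cast; rfl
  rw [h1]
  have hshift : ∀ n : ℕ, ∑ j ∈ Finset.range s, F (r + m * j) =
      ∑ j ∈ Finset.range s, F (r + m * n + m * j) := by
    intro n
    induction n with
    | zero => simp
    | succ n ih =>
      rw [ih]
      have key := (Finset.sum_range_succ (fun j : ℕ => F (r + m * n + m * j)) s).symm.trans
        (Finset.sum_range_succ' (fun j : ℕ => F (r + m * n + m * j)) s)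
      have e1 : F (r + m * n + m * (s : ℕ)) = F (r + m * n + m * (0 : ℕ)) :=
        hF _ _ ⟨1, by push_cast; ring⟩
      rw [e1] at key
      rw [add_right_cancel key]
      refine Finset.sum_congr rfl fun j _ => ?_
      congr 1
      push_cast
      ring
  rcases Nat.eq_zero_or_pos s with rfl | hs
  · simp
  have hs' : (0 : ℤ) < s := by exact_mod_cast hs
  obtain ⟨n, hn⟩ := Int.eq_ofNat_of_zero_le (Int.emod_nonneg (k₀ / m) hs'.ne')
  rw [hshift n]
  refine Finset.sum_congr rfl fun j _ => hF _ _ ⟨-(k₀ / m / s), ?_⟩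
  have h5 := Int.emod_add_mul_ediv (k₀ / m) s
  rw [hn] at h5
  push_cast
  linear_combination hdiv + (m:ℤ) * h5

/-- A Ramanujan-type sum restricted to a residue class. -/
lemma sum_coprime_residue {m t : ℕ} (hm : 0 < m) (ht : 0 < t) {A b : ℤ}
    (hb : IsCoprime b ((m * t : ℕ) : ℤ)) {t' : ℤ}
    (ht' : Nat.Coprime t m → (m : ℤ) ∣ t * t' - 1) :
    (∑ d ∈ Finset.range (m * t) with Nat.gcd d (m * t) = 1,
        if (m : ℤ) ∣ A + d then eDiv (-b * d) (m * t) else 0) =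
      if Nat.Coprime t m ∧ IsCoprime (m : ℤ) A then
        ((ArithmeticFunction.moebius t : ℤ) : ℂ) * eDiv (A * b * t') m else 0 := by
  have hmt : 0 < m * t := Nat.mul_pos hm ht
  by_cases hmA : IsCoprime (m : ℤ) A
  swap
  · rw [if_neg (fun h => hmA h.2)]
    refine Finset.sum_eq_zero fun d hd => if_neg fun hdvd => hmA ?_
    have hd1 : Nat.Coprime d m := Nat.Coprime.coprime_mul_right_right (Finset.mem_filter.1 hd).2
    have hd2 := (Nat.isCoprime_iff_coprime.2 hd1)
    obtain ⟨u, hu⟩ := hdvd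
    have : A = -d + m * u := by linear_combination hu
    rw [this]
    exact (IsCoprime.add_mul_left_left hd2.neg_left u).symm
  rw [sum_range_coprime hmt]
  have key : ∀ r ∈ (m * t).divisors,
      ((ArithmeticFunction.moebius r : ℤ) : ℂ) * ∑ k ∈ Finset.range (m * t / r),
        (if (m : ℤ) ∣ A + ((r * k : ℕ) : ℤ) then eDiv (-b * ((r * k : ℕ) : ℤ)) (m * t) else 0) =
      if r = t then (if Nat.Coprime t m then
        ((ArithmeticFunction.moebius t : ℤ) : ℂ) * eDiv (A * b * t') m else 0) else 0 := by
    intro r hr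
    have hr0 := Nat.pos_of_mem_divisors hr
    have hrd := Nat.dvd_of_mem_divisors hr
    by_cases hrm : Nat.Coprime r m
    swap
    · have hrhs : (if r = t then (if Nat.Coprime t m then
        ((ArithmeticFunction.moebius t : ℤ) : ℂ) * eDiv (A * b * t') m else 0) else 0) = 0 := by
        split_ifs with h1 h2
        · exact absurd (h1 ▸ h2) hrm
        · rfl
        · rfl
      rw [hrhs, Finset.sum_eq_zero, mul_zero]
      intro k _
      refine if_neg fun hdvd => hrm ?_
      obtain ⟨u, hu⟩ := hdvd
      obtain ⟨v, w, hvw⟩ := hmA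
      refine Nat.isCoprime_iff_coprime.1 ⟨-(w * k), v + w * u, ?_⟩
      push_cast at hu
      linear_combination hvw - w * hu
    obtain ⟨s, rfl⟩ := hrm.dvd_of_dvd_mul_left hrd
    have hs : 0 < s := Nat.pos_of_mul_pos_left ht
    have hdiv : m * (r * s) / r = m * s := by
      rw [mul_left_comm, Nat.mul_div_cancel_left _ hr0]
    obtain ⟨v, w, hvw⟩ := Nat.isCoprime_iff_coprime.2 hrm
    have h1 : ∀ k ∈ Finset.range (m * s),
        (if (m : ℤ) ∣ A + ((r * k : ℕ) : ℤ) then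
          eDiv (-b * ((r * k : ℕ) : ℤ)) (m * (r * s)) else 0) =
        if (m : ℤ) ∣ (k : ℤ) - (-A * v) then eDiv (-b * k) (m * s) else 0 := by
      intro k _
      have e1 : eDiv (-b * ((r * k : ℕ) : ℤ)) (m * (r * s)) = eDiv (-b * k) (m * s) := by
        rw [← eDiv_mul_mul hr0 (-b * k)]
        push_cast
        ring_nf
      have e2 : (m : ℤ) ∣ A + ((r * k : ℕ) : ℤ) ↔ (m : ℤ) ∣ (k : ℤ) - (-A * v) := by
        constructor
        · rintro ⟨u, hu⟩
          push_cast at hu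
          exact ⟨v * u + w * k, by linear_combination v * hu - k * hvw⟩
        · rintro ⟨u, hu⟩
          push_cast
          exact ⟨r * u + w * A, by linear_combination r * hu - A * hvw⟩
      rw [e1]
      simp only [e2]
    rw [hdiv, Finset.sum_congr rfl h1, ← Finset.sum_filter,
      sum_range_filter_modEq hm (-A * v) (fun k : ℤ => eDiv (-b * k) (m * s))]
    swap
    · intro x y hxy
      refine eDiv_congr (Nat.mul_pos hm hs) ?_
      rw [← mul_sub]
      exact dvd_mul_of_dvd_right hxy _
    have h2 : ∀ j ∈ Finset.range s, eDiv (-b * (-A * v + m * (j : ℤ))) (m * s) =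
        eDiv (A * b * v) (m * s) * eDiv (-b * j) s := by
      intro j _
      rw [← eDiv_mul_mul hm (-b * j), ← eDiv_add]
      ring_nf
    rw [Finset.sum_congr rfl h2, ← Finset.mul_sum, sum_range_eDiv hs]
    by_cases hs1 : s = 1
    · subst hs1
      simp only [mul_one, Nat.cast_one, one_dvd, if_true] at ht' ⊢
      rw [if_pos hrm]
      congr 1
      refine eDiv_congr hm ?_
      obtain ⟨u, hu⟩ := ht' hrm
      exact ⟨A * b * (-(w * t') - v * u),
        by linear_combination A * b * t' * hvw - A * b * v * hu⟩
    · have hne : r ≠ r * s := fun h => hs1 (Nat.eq_of_mul_eq_mul_left hr0 (by omega))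
      rw [if_neg hne, if_neg, mul_zero, mul_zero]
      intro hsb
      have hu : IsUnit (s : ℤ) := hb.isUnit_of_dvd' (by simpa using hsb)
        ⟨m * r, by push_cast; ring⟩
      exact hs1 (by simpa using Int.isUnit_iff_natAbs_eq.1 hu)
  rw [Finset.sum_congr rfl key, Finset.sum_ite_eq' , if_pos (by simp [hm.ne', ht.ne'])]
  simp [hmA]

/-- Summing a Ramanujan sum against an additive character. -/
lemma sum_ramanujan_eDiv {q : ℕ} (hq : 0 < q) {A b : ℤ} (hb : IsCoprime b (q : ℤ))
    (t' : ℕ → ℤ)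
    (ht' : ∀ m ∈ q.divisors, Nat.Coprime (q / m) m → (m : ℤ) ∣ (q / m : ℕ) * t' m - 1) :
    ∑ y ∈ Finset.range q with Nat.gcd y q = 1, eDiv (A * y) q *
        ∑ g ∈ q.divisors with ((g : ℕ) : ℤ) ∣ (y : ℤ) - b,
          (g : ℂ) * ((ArithmeticFunction.moebius (q / g) : ℤ) : ℂ) =
      ∑ m ∈ q.divisors with Nat.Coprime (q / m) m ∧ IsCoprime ((m : ℕ) : ℤ) A,
        (m : ℂ) * ((ArithmeticFunction.moebius (q / m) : ℤ) : ℂ) ^ 2 *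
          eDiv (A * b * t' m) m := by
  have h1 : ∀ y : ℕ, eDiv (A * y) q *
        ∑ g ∈ q.divisors with ((g : ℕ) : ℤ) ∣ (y : ℤ) - b,
          (g : ℂ) * ((ArithmeticFunction.moebius (q / g) : ℤ) : ℂ) =
      ∑ d ∈ Finset.range q with Nat.gcd d q = 1,
        eDiv (-b * d) q * eDiv ((A + d) * y) q := by
    intro y
    rw [← ramanujan_sum hq, Finset.mul_sum]
    refine Finset.sum_congr rfl fun d _ => ?_
    rw [← eDiv_add, ← eDiv_add]
    ring_nf
  simp only [h1]
  rw [Finset.sum_comm]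
  simp only [← Finset.mul_sum, ramanujan_sum hq]
  have h2 : ∀ d : ℕ, eDiv (-b * d) q * ∑ g ∈ q.divisors with ((g : ℕ) : ℤ) ∣ A + (d : ℤ),
          (g : ℂ) * ((ArithmeticFunction.moebius (q / g) : ℤ) : ℂ) =
      ∑ m ∈ q.divisors, (m : ℂ) * ((ArithmeticFunction.moebius (q / m) : ℤ) : ℂ) *
        if ((m : ℕ) : ℤ) ∣ A + (d : ℤ) then eDiv (-b * d) q else 0 := by
    intro d
    rw [Finset.sum_filter, Finset.mul_sum]
    refine Finset.sum_congr rfl fun m _ => ?_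
    split_ifs <;> ring
  simp only [h2]
  rw [Finset.sum_comm, Finset.sum_filter]
  refine Finset.sum_congr rfl fun m hm => ?_
  have hmq := Nat.dvd_of_mem_divisors hm
  have hm0 := Nat.pos_of_mem_divisors hm
  have hq' : m * (q / m) = q := Nat.mul_div_cancel' hmq
  have ht0 : 0 < q / m := Nat.div_pos (Nat.le_of_dvd hq hmq) hm0
  have := sum_coprime_residue hm0 ht0 (A := A) (b := b) (by rwa [hq']) (ht' m hm)
  rw [hq'] at this
  rw [← Finset.mul_sum, this]
  split_ifs <;> ring

/-- Reduction of a Ramanujan sum whose argument is coprime to part of the modulus. -/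
lemma sum_divisors_mul_of_coprime {N q : ℕ} (hN : 0 < N) (hq : 0 < q) {M : ℤ}
    (hM : IsCoprime M (N : ℤ)) :
    ∑ g ∈ (N * q).divisors with ((g : ℕ) : ℤ) ∣ M,
        (g : ℂ) * ((ArithmeticFunction.moebius (N * q / g) : ℤ) : ℂ) =
      if Nat.Coprime N q then ((ArithmeticFunction.moebius N : ℤ) : ℂ) *
        ∑ g ∈ q.divisors with ((g : ℕ) : ℤ) ∣ M,
          (g : ℂ) * ((ArithmeticFunction.moebius (q / g) : ℤ) : ℂ) else 0 := by
  have hcop : ∀ g : ℕ, (g : ℤ) ∣ M → Nat.Coprime g N := fun g hg =>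
    Nat.isCoprime_iff_coprime.1 (hM.of_isCoprime_of_dvd_left hg)
  have hset : (N * q).divisors.filter (fun g : ℕ => (g : ℤ) ∣ M) =
      q.divisors.filter (fun g : ℕ => (g : ℤ) ∣ M) := by
    ext g
    simp only [Finset.mem_filter, Nat.mem_divisors]
    constructor
    · rintro ⟨⟨h1, _⟩, h2⟩
      exact ⟨⟨(hcop g h2).dvd_of_dvd_mul_left h1, hq.ne'⟩, h2⟩
    · rintro ⟨⟨h1, _⟩, h2⟩
      exact ⟨⟨h1.mul_left _, (Nat.mul_pos hN hq).ne'⟩, h2⟩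
  rw [hset]
  split_ifs with hNq
  · rw [Finset.mul_sum]
    refine Finset.sum_congr rfl fun g hg => ?_
    have hgq := Nat.dvd_of_mem_divisors (Finset.mem_filter.1 hg).1
    rw [Nat.mul_div_assoc _ hgq, ArithmeticFunction.isMultiplicative_moebius.map_mul_of_coprime
      (hNq.coprime_dvd_right (Nat.div_dvd_of_dvd hgq))]
    push_cast
    ring
  · refine Finset.sum_eq_zero fun g hg => ?_
    obtain ⟨hg1, hg2⟩ := Finset.mem_filter.1 hg
    have hgq := Nat.dvd_of_mem_divisors hg1
    have : ¬ Squarefree (N * q / g) := by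
      rw [Nat.mul_div_assoc _ hgq]
      intro hsq
      apply hNq
      have h1 : Nat.Coprime N (q / g) := (Nat.squarefree_mul_iff.1 hsq).1
      have := h1.mul_right (hcop g hg2).symm
      rwa [Nat.div_mul_cancel hgq] at this
    rw [ArithmeticFunction.moebius_eq_zero_of_not_squarefree this]
    simp

lemma gcd_val_inv {x q : ℕ} (hq : 0 < q) (hx : Nat.gcd x q = 1) :
    ((x : ZMod q))⁻¹.val < q ∧ Nat.gcd ((x : ZMod q))⁻¹.val q = 1 ∧
      (q : ℤ) ∣ x * (((x : ZMod q))⁻¹.val : ℤ) - 1 := by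
  have : NeZero q := ⟨hq.ne'⟩
  have h1 : (q : ℤ) ∣ x * (((x : ZMod q))⁻¹.val : ℤ) - 1 := by
    rw [← ZMod.intCast_zmod_eq_zero_iff_dvd]
    push_cast
    rw [ZMod.natCast_zmod_val, ZMod.coe_mul_inv_eq_one x hx, sub_self]
  refine ⟨ZMod.val_lt _, ?_, h1⟩
  obtain ⟨u, hu⟩ := h1
  exact Nat.isCoprime_iff_coprime.1 ⟨x, -u, by linear_combination hu⟩

lemma sum_range_coprime_inv {q : ℕ} (hq : 0 < q) (F : ℕ → ℂ) :
    ∑ x ∈ Finset.range q with Nat.gcd x q = 1, F ((x : ZMod q))⁻¹.val =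
      ∑ y ∈ Finset.range q with Nat.gcd y q = 1, F y := by
  have : NeZero q := ⟨hq.ne'⟩
  have hmem : ∀ x ∈ (Finset.range q).filter (fun x => Nat.gcd x q = 1),
      ((x : ZMod q))⁻¹.val ∈ (Finset.range q).filter (fun x => Nat.gcd x q = 1) := by
    intro x hx
    obtain ⟨h1, h2, _⟩ := gcd_val_inv hq (Finset.mem_filter.1 hx).2
    exact Finset.mem_filter.2 ⟨Finset.mem_range.2 h1, h2⟩
  have hinv : ∀ x ∈ (Finset.range q).filter (fun x => Nat.gcd x q = 1),
      (((((x : ZMod q))⁻¹.val : ℕ) : ZMod q))⁻¹.val = x := by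
    intro x hx
    obtain ⟨h1, h2⟩ := Finset.mem_filter.1 hx
    obtain ⟨_, h4, _⟩ := gcd_val_inv hq h2
    have h5 := ZMod.coe_mul_inv_eq_one _ h4
    have h6 := ZMod.coe_mul_inv_eq_one _ h2
    rw [ZMod.natCast_zmod_val] at h5 ⊢
    have h7 : ((x : ZMod q)⁻¹)⁻¹ = x := by
      calc ((x : ZMod q)⁻¹)⁻¹ = (x * (x : ZMod q)⁻¹) * ((x : ZMod q)⁻¹)⁻¹ := by rw [h6, one_mul]
        _ = x := by rw [mul_assoc, h5, mul_one]
    rw [h7, ZMod.val_natCast, Nat.mod_eq_of_lt (Finset.mem_range.1 h1)]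
  exact Finset.sum_nbij' (fun x => ((x : ZMod q))⁻¹.val) (fun x => ((x : ZMod q))⁻¹.val)
    hmem hmem hinv hinv (fun _ _ => rfl)

/-- The twisted average of Kloosterman sums in terms of Ramanujan sums modulo `q`. -/
lemma sum_eDiv_mul_kloosterman {N q : ℕ} (hN : 0 < N) (hq : 0 < q) {σ : ℤ} (hσ : σ * σ = 1)
    (A i : ℤ) :
    ∑ d ∈ Finset.range (N * q) with Nat.gcd d (N * q) = 1,
        eDiv (σ * d) (N * q) * kloosterman (i * d) A q =
      if Nat.Coprime N q then ((ArithmeticFunction.moebius N : ℤ) : ℂ) *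
        ∑ y ∈ Finset.range q with Nat.gcd y q = 1, eDiv (A * y) q *
          ∑ g ∈ q.divisors with ((g : ℕ) : ℤ) ∣ (y : ℤ) - (-σ * i * N),
            (g : ℂ) * ((ArithmeticFunction.moebius (q / g) : ℤ) : ℂ) else 0 := by
  have h1 : ∀ d : ℕ, eDiv (σ * d) (N * q) * kloosterman (i * d) A q =
      ∑ x ∈ Finset.range q with Nat.gcd x q = 1,
        eDiv (A * (((x : ZMod q))⁻¹.val : ℤ)) q * eDiv ((σ + i * x * N) * d) (N * q) := by
    intro d
    rw [kloosterman, ← Finset.sum_filter, Finset.mul_sum]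
    refine Finset.sum_congr rfl fun x _ => ?_
    rw [← eDiv_def, ← eDiv_mul_mul hN (i * d * x + _) q, ← eDiv_mul_mul hN (A * _), ← eDiv_add, ← eDiv_add]
    ring_nf
  simp only [h1]
  rw [Finset.sum_comm]
  simp only [← Finset.mul_sum, ramanujan_sum (Nat.mul_pos hN hq)]
  have h2 : ∀ x ∈ (Finset.range q).filter (fun x => Nat.gcd x q = 1),
      eDiv (A * (((x : ZMod q))⁻¹.val : ℤ)) q *
        ∑ g ∈ (N * q).divisors with ((g : ℕ) : ℤ) ∣ σ + i * x * N,
          (g : ℂ) * ((ArithmeticFunction.moebius (N * q / g) : ℤ) : ℂ) =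
      if Nat.Coprime N q then ((ArithmeticFunction.moebius N : ℤ) : ℂ) *
        (eDiv (A * (((x : ZMod q))⁻¹.val : ℤ)) q *
        ∑ g ∈ q.divisors with ((g : ℕ) : ℤ) ∣ (((x : ZMod q))⁻¹.val : ℤ) - (-σ * i * N),
          (g : ℂ) * ((ArithmeticFunction.moebius (q / g) : ℤ) : ℂ)) else 0 := by
    intro x hx
    rw [sum_divisors_mul_of_coprime hN hq ⟨σ, -(σ * i * x), by linear_combination hσ⟩]
    obtain ⟨_, _, u, hu⟩ := gcd_val_inv hq (Finset.mem_filter.1 hx).2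
    have h3 : q.divisors.filter (fun g : ℕ => (g : ℤ) ∣ σ + i * x * N) =
        q.divisors.filter
          (fun g : ℕ => (g : ℤ) ∣ (((x : ZMod q))⁻¹.val : ℤ) - (-σ * i * N)) := by
      refine Finset.filter_congr fun g hg => ?_
      obtain ⟨v, hv⟩ : (g : ℤ) ∣ q := by exact_mod_cast Nat.dvd_of_mem_divisors hg
      generalize (((x : ZMod q))⁻¹.val : ℤ) = y at hu
      rw [hv] at hu
      constructor
      · rintro ⟨w, hw⟩
        exact ⟨σ * y * w - σ * i * N * v * u, by
          linear_combination σ * y * hw - y * hσ - σ * i * N * hu⟩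
      · rintro ⟨w, hw⟩
        exact ⟨σ * x * w - σ * v * u, by
          linear_combination σ * x * hw - i * x * N * hσ - σ * hu⟩
    rw [h3]
    split_ifs <;> ring
  rw [Finset.sum_congr rfl h2, sum_range_coprime_inv hq (fun y => if Nat.Coprime N q then
    ((ArithmeticFunction.moebius N : ℤ) : ℂ) * (eDiv (A * y) q *
      ∑ g ∈ q.divisors with ((g : ℕ) : ℤ) ∣ (y : ℤ) - (-σ * i * N),
        (g : ℂ) * ((ArithmeticFunction.moebius (q / g) : ℤ) : ℂ)) else 0)]
  split_ifs
  · rw [Finset.mul_sum]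
  · simp

/-- `∑_{f ∣ n} μ(f) f / n = μ(n) φ(n) / n` for squarefree `n`. -/
lemma sum_moebius_div_of_squarefree {n : ℕ} (hn : Squarefree n) :
    ∑ f ∈ n.divisors, ((ArithmeticFunction.moebius f : ℤ) : ℂ) / ((n / f : ℕ) : ℂ) =
      ((ArithmeticFunction.moebius n : ℤ) : ℂ) * (n.totient : ℂ) / (n : ℂ) := by
  have hn0 : n ≠ 0 := hn.ne_zero
  have hnC : (n : ℂ) ≠ 0 := by exact_mod_cast hn0
  have h1 : (n.totient : ℤ) =
      ∑ f ∈ n.divisors, (ArithmeticFunction.moebius (n / f) : ℤ) * (f : ℤ) := by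
    have h2 := (ArithmeticFunction.sum_eq_iff_sum_mul_moebius_eq (R := ℤ)
      (f := fun n => (n.totient : ℤ)) (g := fun n => (n : ℤ))).1
      (fun m _ => by exact_mod_cast Nat.sum_totient m) n (Nat.pos_of_ne_zero hn0)
    simp only [Int.cast_id] at h2
    rw [← h2, Nat.sum_divisorsAntidiagonal' (fun x y =>
      (ArithmeticFunction.moebius x : ℤ) * (y : ℤ))]
  have h3 : ((n.totient : ℤ) : ℂ) = _ := congrArg (Int.cast : ℤ → ℂ) h1
  rw [Int.cast_natCast] at h3
  rw [h3]
  push_cast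
  rw [Finset.mul_sum, Finset.sum_div]
  refine Finset.sum_congr rfl fun f hf => ?_
  have hfn := Nat.dvd_of_mem_divisors hf
  have hf0 := Nat.pos_of_mem_divisors hf
  have hfC : (f : ℂ) ≠ 0 := by exact_mod_cast hf0.ne'
  obtain ⟨k, rfl⟩ := hfn
  rw [Nat.mul_div_cancel_left _ hf0]
  have hcop := (Nat.squarefree_mul_iff.1 hn)
  have hk : (ArithmeticFunction.moebius k : ℤ) ^ 2 = 1 :=
    ArithmeticFunction.moebius_sq_eq_one_of_squarefree hcop.2.2
  have hkC : ((ArithmeticFunction.moebius k : ℤ) : ℂ) ^ 2 = 1 := by exact_mod_cast hk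
  rw [ArithmeticFunction.isMultiplicative_moebius.map_mul_of_coprime hcop.1]
  push_cast at hnC ⊢
  have hk0 : (k : ℂ) ≠ 0 := right_ne_zero_of_mul hnC
  field_simp
  linear_combination -((ArithmeticFunction.moebius f : ℤ) : ℂ) * hkC

/-- Collapsing the sum over factorizations `d f₁ f₂ = n₁ q` to a sum over divisors of `q`. -/
lemma sum_factorizations {n₁ q n₂ : ℕ} (hn₁ : 0 < n₁) (hq : 0 < q) (E : ℕ → ℕ → ℕ → ℂ)
    (Φ : ℕ → ℂ)
    (hE : ∀ d ∈ q.divisors, ∀ f₂ ∈ n₁.divisors, Nat.Coprime d (q / d * (n₁ / f₂)) →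
      E d (q / d * (n₁ / f₂)) f₂ = Φ d) :
    (∑ d ∈ Finset.range (n₁ * q + 1), ∑ f₁ ∈ Finset.range (n₁ * q + 1),
      ∑ f₂ ∈ Finset.range (n₁ * q + 1),
        if d * f₁ * f₂ = n₁ * q ∧ Nat.gcd d (f₁ * n₁ * n₂) = 1 ∧
            Nat.gcd f₁ f₂ = 1 ∧ f₂ ∣ n₁ then
          ((((ArithmeticFunction.moebius f₁ : ℤ) ^ 2 *
            (ArithmeticFunction.moebius f₂ : ℤ) : ℤ) : ℂ) / (f₁ : ℂ)) * E d f₁ f₂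
        else 0) =
      if Nat.Coprime n₁ q then
        ((ArithmeticFunction.moebius n₁ : ℤ) : ℂ) * (n₁.totient : ℂ) / (n₁ : ℂ) *
          ∑ m ∈ q.divisors with Nat.Coprime m (q / m * n₂),
            ((ArithmeticFunction.moebius (q / m) : ℤ) : ℂ) ^ 2 / ((q / m : ℕ) : ℂ) * Φ m
      else 0 := by
  by_cases hP : Nat.Coprime n₁ q ∧ Squarefree n₁
  swap
  · have hrhs : (if Nat.Coprime n₁ q then
        ((ArithmeticFunction.moebius n₁ : ℤ) : ℂ) * (n₁.totient : ℂ) / (n₁ : ℂ) *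
          ∑ m ∈ q.divisors with Nat.Coprime m (q / m * n₂),
            ((ArithmeticFunction.moebius (q / m) : ℤ) : ℂ) ^ 2 / ((q / m : ℕ) : ℂ) * Φ m
      else 0) = 0 := by
      split_ifs with h
      · rw [ArithmeticFunction.moebius_eq_zero_of_not_squarefree fun h' => hP ⟨h, h'⟩]
        simp
      · rfl
    rw [hrhs]
    refine Finset.sum_eq_zero fun d _ => Finset.sum_eq_zero fun f₁ _ =>
      Finset.sum_eq_zero fun f₂ _ => ?_
    split_ifs with h
    swap
    · rfl
    obtain ⟨h1, h2, h3, h4⟩ := h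
    suffices hz : (ArithmeticFunction.moebius f₁ : ℤ) ^ 2 *
        (ArithmeticFunction.moebius f₂ : ℤ) = 0 by rw [hz]; simp
    by_contra hne
    have hs1 : Squarefree f₁ := ArithmeticFunction.moebius_ne_zero_iff_squarefree.1
      fun h => hne (by rw [h]; ring)
    have hs2 : Squarefree f₂ := ArithmeticFunction.moebius_ne_zero_iff_squarefree.1
      fun h => hne (by rw [h]; ring)
    have hs : Squarefree (f₁ * f₂) := Nat.squarefree_mul_iff.2 ⟨h3, hs1, hs2⟩
    have hd : Nat.Coprime n₁ d :=
      (Nat.Coprime.coprime_dvd_right ⟨f₁ * n₂, by ring⟩ h2 : Nat.Coprime d n₁).symm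
    obtain ⟨t, ht⟩ : n₁ ∣ f₁ * f₂ := hd.dvd_of_dvd_mul_left ⟨q, by rw [← h1, mul_assoc]⟩
    rw [ht] at hs
    have hqd : q = d * t := by
      apply Nat.eq_of_mul_eq_mul_left hn₁
      rw [← h1, mul_assoc, ht]
      ring
    have hs3 := Nat.squarefree_mul_iff.1 hs
    exact hP ⟨hqd ▸ hd.mul_right hs3.1, hs3.2.1⟩
  obtain ⟨hcop, hsq⟩ := hP
  have hnq : 0 < n₁ * q := Nat.mul_pos hn₁ hq
  rw [if_pos hcop, ← sum_moebius_div_of_squarefree hsq, Finset.sum_mul_sum]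
  simp only [← Finset.sum_product']
  rw [← Finset.sum_filter]
  have hfac : ∀ d f₁ f₂ : ℕ, d * f₁ * f₂ = n₁ * q → Nat.gcd d (f₁ * n₁ * n₂) = 1 →
      f₂ ∣ n₁ → d ∣ q ∧ f₁ = q / d * (n₁ / f₂) := by
    intro d f₁ f₂ h1 h2 h4
    have hd : Nat.Coprime d n₁ := Nat.Coprime.coprime_dvd_right ⟨f₁ * n₂, by ring⟩ h2
    have hdq : d ∣ q := hd.dvd_of_dvd_mul_left ⟨f₁ * f₂, by rw [← h1, mul_assoc]⟩
    refine ⟨hdq, ?_⟩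
    obtain ⟨t, rfl⟩ := hdq
    obtain ⟨k, rfl⟩ := h4
    have hd0 : 0 < d := Nat.pos_of_mul_pos_right hq
    have hf0 : 0 < f₂ := Nat.pos_of_mul_pos_right hn₁
    rw [Nat.mul_div_cancel_left _ hd0, Nat.mul_div_cancel_left _ hf0]
    apply Nat.eq_of_mul_eq_mul_left (Nat.mul_pos hd0 hf0)
    linear_combination h1
  apply Finset.sum_nbij' (fun x => (x.2.2, x.1))
    (fun y => (y.2, q / y.2 * (n₁ / y.1), y.1))
  · rintro ⟨d, f₁, f₂⟩ hx
    simp only [Finset.mem_filter, Finset.mem_product, Finset.mem_range] at hx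
    obtain ⟨-, h1, h2, h3, h4⟩ := hx
    obtain ⟨h5, h6⟩ := hfac d f₁ f₂ h1 h2 h4
    simp only [Finset.mem_product, Finset.mem_filter, Nat.mem_divisors]
    refine ⟨⟨h4, hn₁.ne'⟩, ⟨h5, hq.ne'⟩, ?_⟩
    rw [h6] at h2
    exact Nat.Coprime.coprime_dvd_right ⟨n₁ / f₂ * n₁, by ring⟩ h2
  · rintro ⟨f₂, d⟩ hx
    simp only [Finset.mem_product, Finset.mem_filter, Nat.mem_divisors] at hx
    obtain ⟨⟨⟨k, rfl⟩, -⟩, ⟨⟨t, rfl⟩, -⟩, h2⟩ := hx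
    have hd0 : 0 < d := Nat.pos_of_mul_pos_right hq
    have hf0 : 0 < f₂ := Nat.pos_of_mul_pos_right hn₁
    simp only [Finset.mem_filter, Finset.mem_product, Finset.mem_range,
      Nat.mul_div_cancel_left _ hd0, Nat.mul_div_cancel_left _ hf0, Nat.lt_succ_iff] at h2 ⊢
    have hk := Nat.squarefree_mul_iff.1 hsq
    have hcd : Nat.Coprime d (f₂ * k) := (hcop.coprime_dvd_right (dvd_mul_right d t)).symm
    have hct : Nat.Coprime t f₂ :=
      ((hcop.coprime_dvd_right (dvd_mul_left t d)).coprime_dvd_left (dvd_mul_right _ _)).symm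
    refine ⟨⟨Nat.le_of_dvd hnq ⟨f₂ * k * t, by ring⟩, Nat.le_of_dvd hnq ⟨f₂ * d, by ring⟩,
      Nat.le_of_dvd hnq ⟨k * (d * t), by ring⟩⟩, by ring, ?_, ?_, dvd_mul_right _ _⟩
    · have h5 : Nat.Coprime d k := hcd.coprime_dvd_right (dvd_mul_left _ _)
      have : t * k * (f₂ * k) * n₂ = (t * n₂) * (k * (f₂ * k)) := by ring
      rw [this]
      exact h2.mul_right (h5.mul_right hcd)
    · exact hct.mul_left hk.1.symm
  · rintro ⟨d, f₁, f₂⟩ hx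
    simp only [Finset.mem_filter] at hx
    obtain ⟨-, h1, h2, h3, h4⟩ := hx
    obtain ⟨h5, h6⟩ := hfac d f₁ f₂ h1 h2 h4
    simp only [← h6]
  · rintro ⟨f₂, d⟩ _
    rfl
  · rintro ⟨d, f₁, f₂⟩ hx
    simp only [Finset.mem_filter] at hx
    obtain ⟨-, h1, h2, h3, h4⟩ := hx
    obtain ⟨h5, h6⟩ := hfac d f₁ f₂ h1 h2 h4
    have hE' := hE d (Nat.mem_divisors.2 ⟨h5, hq.ne'⟩) f₂ (Nat.mem_divisors.2 ⟨h4, hn₁.ne'⟩)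
      (by rw [← h6]; exact Nat.Coprime.coprime_dvd_right ⟨n₁ * n₂, by ring⟩ h2)
    simp only
    rw [h6, hE']
    have hsk : Squarefree (n₁ / f₂) := hsq.squarefree_of_dvd (Nat.div_dvd_of_dvd h4)
    have hkC : ((ArithmeticFunction.moebius (n₁ / f₂) : ℤ) : ℂ) ^ 2 = 1 := by
      exact_mod_cast ArithmeticFunction.moebius_sq_eq_one_of_squarefree hsk
    have hc1 : Nat.Coprime (q / d) (n₁ / f₂) :=
      ((hcop.coprime_dvd_right (Nat.div_dvd_of_dvd h5)).coprime_dvd_left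
        (Nat.div_dvd_of_dvd h4)).symm
    rw [ArithmeticFunction.isMultiplicative_moebius.map_mul_of_coprime hc1]
    push_cast
    rw [mul_pow, hkC]
    simp only [div_eq_mul_inv, mul_inv]
    ring

/-- Evaluation of the exponential sum
`T = ∑_{d mod c, (d,c)=1} e(σ d / c) S(δ̄' d, ε n₂; c'/n₁)`:
it vanishes unless `(δ₀, c') = 1`, in which case it factors explicitly into a main
exponential, totient and Möbius factors, and a sum over factorizations `d₂' f₁ f₂ = c'`. -/
theorem blomer_exponential_sum_evaluation
    (σ ε : ℤ) (hσ : σ = 1 ∨ σ = -1) (hε : ε = 1 ∨ ε = -1)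
    (δ c : ℕ) (hδ : 0 < δ) (hc : 0 < c)
    (δ₀ δ' c' : ℕ) (hδ₀ : δ₀ = Nat.gcd δ c) (hδ' : δ' = δ / δ₀) (hc' : c' = c / δ₀)
    (n₁ n₂ : ℕ) (hn₁ : 0 < n₁) (hn₂ : 0 < n₂) (hdvd : n₁ ∣ c')
    (inv : ℕ → ℕ → ℤ)
    (hinv : ∀ u q : ℕ, Nat.gcd u q = 1 → ((u * inv u q : ℤ) : ZMod q) = 1)
    (T : ℂ)
    (hT : T = ∑ d ∈ Finset.range c, if Nat.gcd d c = 1 then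
        e (((σ * d : ℤ) : ℝ) / c) *
          kloosterman (inv δ' (c' / n₁) * d) (ε * n₂) (c' / n₁)
      else 0) :
    (1 < Nat.gcd δ₀ c' → T = 0) ∧
    (Nat.gcd δ₀ c' = 1 → T =
      e (((-ε * σ * inv δ' c' * δ₀ * n₁ ^ 2 * n₂ : ℤ) : ℝ) / c') *
        (((c' / n₁).totient : ℂ) / (c'.totient : ℂ)) *
        (((ArithmeticFunction.moebius δ₀ : ℤ) : ℂ) / (δ₀ : ℂ)) * (c : ℂ) *
        ∑ d₂' ∈ Finset.range (c' + 1), ∑ f₁ ∈ Finset.range (c' + 1),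
          ∑ f₂ ∈ Finset.range (c' + 1),
            if d₂' * f₁ * f₂ = c' ∧ Nat.gcd d₂' (f₁ * n₁ * n₂) = 1 ∧
                Nat.gcd f₁ f₂ = 1 ∧ f₂ ∣ n₁ then
              ((((ArithmeticFunction.moebius f₁ : ℤ) ^ 2 * (ArithmeticFunction.moebius f₂ : ℤ) : ℤ) : ℂ) / (f₁ : ℂ)) *
                e (((ε * σ * inv (δ' * d₂') f₁ * δ₀ * f₂ * (n₁ / f₂) ^ 2 * n₂ : ℤ) : ℝ)
                  / f₁)
            else 0) := by
  have hδ₀pos : 0 < δ₀ := hδ₀ ▸ Nat.gcd_pos_of_pos_left _ hδ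
  have hcδ : c = δ₀ * c' := by rw [hc', Nat.mul_div_cancel' (hδ₀ ▸ Nat.gcd_dvd_right δ c)]
  have hδc : Nat.Coprime δ' c' := by
    rw [hδ', hc', hδ₀]
    exact Nat.coprime_div_gcd_div_gcd (hδ₀ ▸ hδ₀pos)
  clear hδ₀ hδ' hc' hδ
  obtain ⟨q, rfl⟩ := hdvd
  subst hcδ
  have hc'pos : 0 < n₁ * q := Nat.pos_of_mul_pos_left hc
  have hq : 0 < q := Nat.pos_of_mul_pos_left hc'pos
  have hN : 0 < δ₀ * n₁ := Nat.mul_pos hδ₀pos hn₁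
  have hσσ : σ * σ = 1 := by rcases hσ with rfl | rfl <;> norm_num
  have hεε : ε * ε = 1 := by rcases hε with rfl | rfl <;> norm_num
  have hinv' : ∀ u m : ℕ, Nat.Coprime u m → (m : ℤ) ∣ u * inv u m - 1 := by
    intro u m h
    rw [← ZMod.intCast_zmod_eq_zero_iff_dvd, Int.cast_sub, hinv u m h, Int.cast_one, sub_self]
  rw [Nat.mul_div_cancel_left q hn₁] at hT ⊢
  set i := inv δ' q with hi
  have hiq : (q : ℤ) ∣ δ' * i - 1 := hinv' _ _ (hδc.coprime_dvd_right (dvd_mul_left _ _))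
  have hT1 : T = if Nat.Coprime (δ₀ * n₁) q then
      ((ArithmeticFunction.moebius (δ₀ * n₁) : ℤ) : ℂ) *
        ∑ y ∈ Finset.range q with Nat.gcd y q = 1, eDiv (ε * n₂ * y) q *
          ∑ g ∈ q.divisors with ((g : ℕ) : ℤ) ∣ (y : ℤ) - (-σ * i * (δ₀ * n₁ : ℕ)),
            (g : ℂ) * ((ArithmeticFunction.moebius (q / g) : ℤ) : ℂ) else 0 := by
    rw [hT, ← sum_eDiv_mul_kloosterman hN hq hσσ (ε * n₂) i, Finset.sum_filter, mul_assoc δ₀]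
    rfl
  clear hT
  constructor
  · intro hgcd
    rw [hT1]
    split_ifs with hcop
    · have hns : ¬ Squarefree (δ₀ * n₁) := fun hsq =>
        hgcd.ne' ((Nat.squarefree_mul_iff.1 hsq).1.mul_right
          (hcop.coprime_dvd_left (dvd_mul_right _ _)))
      rw [ArithmeticFunction.moebius_eq_zero_of_not_squarefree hns]
      simp
    · rfl
  intro hgcd
  have hδn : Nat.Coprime δ₀ n₁ := Nat.Coprime.coprime_dvd_right (dvd_mul_right _ _) hgcd
  have hδq : Nat.Coprime δ₀ q := Nat.Coprime.coprime_dvd_right (dvd_mul_left _ _) hgcd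
  have hfact := sum_factorizations (n₂ := n₂) hn₁ hq
    (fun d f₁ f₂ => eDiv (ε * σ * inv (δ' * d) f₁ * δ₀ * f₂ * (n₁ / f₂) ^ 2 * n₂) f₁)
    (fun m => eDiv (ε * σ * inv (δ' * m) (q / m) * δ₀ * n₁ * n₂) (q / m)) (by
      intro d hd f₂ hf₂ hcop
      obtain ⟨t, rfl⟩ := Nat.dvd_of_mem_divisors hd
      obtain ⟨k, rfl⟩ := Nat.dvd_of_mem_divisors hf₂
      have hd0 : 0 < d := Nat.pos_of_mul_pos_right hq
      have ht0 : 0 < t := Nat.pos_of_mul_pos_left hq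
      have hf0 : 0 < f₂ := Nat.pos_of_mul_pos_right hn₁
      have hk0 : 0 < k := Nat.pos_of_mul_pos_left hn₁
      rw [Nat.mul_div_cancel_left _ hd0, Nat.mul_div_cancel_left _ hf0] at *
      have hδtk : Nat.Coprime δ' (t * k) :=
        hδc.coprime_dvd_right ⟨f₂ * d, by ring⟩
      obtain ⟨u, hu⟩ := hinv' (δ' * d) (t * k) (hδtk.mul_left hcop)
      obtain ⟨v, hv⟩ := hinv' (δ' * d) t
        ((hδtk.mul_left hcop).coprime_dvd_right (dvd_mul_right _ _))
      have hfz : (f₂ : ℤ) ≠ 0 := by exact_mod_cast hf0.ne'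
      have hdivz : ((f₂ * k : ℕ) : ℤ) / f₂ = k := by
        push_cast
        exact Int.mul_ediv_cancel_left _ hfz
      simp only [hdivz]
      rw [mul_comm t k] at *
      rw [← eDiv_mul_mul hk0 _ t]
      refine eDiv_congr (Nat.mul_pos hk0 ht0) ?_
      generalize inv (δ' * d) (k * t) = I at *
      generalize inv (δ' * d) t = J at *
      push_cast at hu hv ⊢
      refine ⟨ε * σ * δ₀ * f₂ * k * n₂ * (J * k * u - I * v), ?_⟩
      linear_combination ε * σ * δ₀ * f₂ * k * n₂ * k * (J * hu - I * hv))
  simp only [eDiv_def] at hfact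
  rw [hfact]
  clear hfact
  simp only [← eDiv_def]
  have hcopiff : Nat.Coprime (δ₀ * n₁) q ↔ Nat.Coprime n₁ q :=
    ⟨fun h => h.coprime_dvd_left (dvd_mul_left _ _), fun h => hδq.mul_left h⟩
  rw [hT1]
  simp only [hcopiff]
  split_ifs with hnq
  swap
  · simp
  have hδi : IsCoprime i (q : ℤ) := by
    obtain ⟨u, hu⟩ := hiq
    exact ⟨δ', -u, by linear_combination hu⟩
  have hb : IsCoprime (-σ * i * (δ₀ * n₁ : ℕ)) (q : ℤ) := by
    have h1 : IsCoprime (-σ) (q : ℤ) := ⟨-σ, 0, by linear_combination hσσ⟩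
    exact (h1.mul_left hδi).mul_left (Nat.isCoprime_iff_coprime.2 (hcopiff.2 hnq))
  rw [sum_ramanujan_eDiv hq hb (fun m => inv (q / m) m) (fun m _ h => hinv' _ _ h),
    ArithmeticFunction.isMultiplicative_moebius.map_mul_of_coprime hδn,
    Nat.totient_mul hnq]
  have hfilter : q.divisors.filter (fun m : ℕ => Nat.Coprime (q / m) m ∧
      IsCoprime (m : ℤ) (ε * n₂)) =
      q.divisors.filter (fun m : ℕ => Nat.Coprime m (q / m * n₂)) := by
    refine Finset.filter_congr fun m _ => ?_
    rw [Nat.coprime_mul_iff_right, Nat.coprime_comm, ← Nat.isCoprime_iff_coprime (n := n₂),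
      IsCoprime.mul_right_iff]
    have : IsCoprime (m : ℤ) ε := ⟨0, ε, by linear_combination hεε⟩
    simp [this]
  rw [hfilter]
  have hδC : (δ₀ : ℂ) ≠ 0 := by exact_mod_cast hδ₀pos.ne'
  have hnC : (n₁ : ℂ) ≠ 0 := by exact_mod_cast hn₁.ne'
  have hφn : (n₁.totient : ℂ) ≠ 0 := by exact_mod_cast (Nat.totient_pos.2 hn₁).ne'
  have hφq : (q.totient : ℂ) ≠ 0 := by exact_mod_cast (Nat.totient_pos.2 hq).ne'
  have hlead : eDiv (-ε * σ * inv δ' (n₁ * q) * δ₀ * n₁ ^ 2 * n₂) (n₁ * q) =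
      eDiv (ε * n₂ * (-σ * i * (δ₀ * n₁ : ℕ))) q := by
    rw [← eDiv_mul_mul hn₁ _ q]
    refine eDiv_congr hc'pos ?_
    obtain ⟨u, hu⟩ := hinv' δ' (n₁ * q) hδc
    obtain ⟨v, hv⟩ := hiq
    generalize inv δ' (n₁ * q) = I at *
    push_cast at hu ⊢
    refine ⟨-ε * σ * δ₀ * n₁ * n₂ * (n₁ * i * u - I * v), ?_⟩
    linear_combination -ε * σ * δ₀ * n₁ * n₂ * n₁ * (i * hu - I * hv)
  rw [hlead]
  have hterm : ∀ m ∈ q.divisors.filter (fun m : ℕ => Nat.Coprime m (q / m * n₂)),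
      (m : ℂ) * ((ArithmeticFunction.moebius (q / m) : ℤ) : ℂ) ^ 2 *
          eDiv (ε * n₂ * (-σ * i * (δ₀ * n₁ : ℕ)) * inv (q / m) m) m =
      eDiv (ε * n₂ * (-σ * i * (δ₀ * n₁ : ℕ))) q * q *
        (((ArithmeticFunction.moebius (q / m) : ℤ) : ℂ) ^ 2 / ((q / m : ℕ) : ℂ) *
          eDiv (ε * σ * inv (δ' * m) (q / m) * δ₀ * n₁ * n₂) (q / m)) := by
    intro m hm
    obtain ⟨hm1, hm2⟩ := Finset.mem_filter.1 hm
    obtain ⟨t, rfl⟩ := Nat.dvd_of_mem_divisors hm1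
    have hm0 : 0 < m := Nat.pos_of_mul_pos_right hq
    have ht0 : 0 < t := Nat.pos_of_mul_pos_left hq
    rw [Nat.mul_div_cancel_left _ hm0] at *
    have hmt : Nat.Coprime m t := hm2.coprime_dvd_right (dvd_mul_right _ _)
    have hδt : Nat.Coprime δ' t := hδc.coprime_dvd_right ⟨n₁ * m, by ring⟩
    have hI := hinv' (δ' * m) t (hδt.mul_left hmt)
    generalize inv (δ' * m) t = I at *
    have hrec := eDiv_reciprocity ht0 hm0 hmt.symm (t' := inv t m) (m' := δ' * I)
      (hinv' t m hmt.symm) (by convert hI using 1; push_cast; ring)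
      (ε * n₂ * (-σ * i * (δ₀ * n₁ : ℕ)))
    rw [mul_comm t m] at hrec
    have hcancel : eDiv (ε * n₂ * (-σ * i * (δ₀ * n₁ : ℕ)) * (δ' * I)) t *
        eDiv (ε * σ * I * δ₀ * n₁ * n₂) t = 1 := by
      rw [← eDiv_add, eDiv_eq_one_iff ht0]
      obtain ⟨v, hv⟩ := hiq
      push_cast at hv ⊢
      exact ⟨-(ε * σ * n₂ * δ₀ * n₁ * I * m * v), by
        linear_combination -(ε * σ * n₂ * δ₀ * n₁ * I) * hv⟩
    have htC : (t : ℂ) ≠ 0 := by exact_mod_cast ht0.ne'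
    rw [← hrec]
    push_cast
    push_cast at hcancel
    field_simp
    linear_combination -(m * ((ArithmeticFunction.moebius t : ℤ) : ℂ) ^ 2 *
      eDiv (ε * n₂ * (-σ * i * (δ₀ * n₁)) * inv t m) m) * hcancel
  rw [Finset.sum_congr rfl hterm, ← Finset.mul_sum]
  push_cast
  field_simp
end

section
/- Let α₁, α₂, α₃ ∈ ℂ with |Re(αᵢ)| < 1/2 for i = 1, 2, 3. For t ∈ ℝ and y > 0 define V_t(y) := (1/2π) ∫_ℝ (π² y)^{-(3+iv)} Π_{±} Π_{i=1}^{3} [ Γ( (1/2 ± it + (3+iv) − αᵢ)/2 ) / Γ( (1/2 ± it − αᵢ)/2 ) ] · e^{(3+iv)²} / (3+iv) dv. Then for every integer k ≥ 0 and every real A > 0 there exists a constant C > 0 (depending only on α₁, α₂, α₃, k, A) such that for all t ∈ ℝ and all y > 0: | y^k · (d/dy)^k V_t(y) | ≤ C ( 1 + y/(1+|t|)³ )^{-A}. -/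
open Complex MeasureTheory

/-- The weight function of the approximate functional equation:
`V_t(y) = (1/2πi) ∫_{(3)} (π² y)^{-u} ∏_± ∏_{i=1}^3
  Γ((1/2 ± it + u - αᵢ)/2)/Γ((1/2 ± it - αᵢ)/2) · e^{u²} du/u`,
parametrized by `u = 3 + iv`, `v ∈ ℝ`. -/
noncomputable def Vweight (α₁ α₂ α₃ : ℂ) (t : ℝ) (y : ℝ) : ℂ :=
  (1 / (2 * Real.pi)) * ∫ v : ℝ,
    ((Real.pi ^ 2 * y : ℝ) : ℂ) ^ (-(3 + Complex.I * v)) *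
      (Complex.Gamma ((1 / 2 + Complex.I * t + (3 + Complex.I * v) - α₁) / 2) /
        Complex.Gamma ((1 / 2 + Complex.I * t - α₁) / 2)) *
      (Complex.Gamma ((1 / 2 + Complex.I * t + (3 + Complex.I * v) - α₂) / 2) /
        Complex.Gamma ((1 / 2 + Complex.I * t - α₂) / 2)) *
      (Complex.Gamma ((1 / 2 + Complex.I * t + (3 + Complex.I * v) - α₃) / 2) /
        Complex.Gamma ((1 / 2 + Complex.I * t - α₃) / 2)) *
      (Complex.Gamma ((1 / 2 - Complex.I * t + (3 + Complex.I * v) - α₁) / 2) /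
        Complex.Gamma ((1 / 2 - Complex.I * t - α₁) / 2)) *
      (Complex.Gamma ((1 / 2 - Complex.I * t + (3 + Complex.I * v) - α₂) / 2) /
        Complex.Gamma ((1 / 2 - Complex.I * t - α₂) / 2)) *
      (Complex.Gamma ((1 / 2 - Complex.I * t + (3 + Complex.I * v) - α₃) / 2) /
        Complex.Gamma ((1 / 2 - Complex.I * t - α₃) / 2)) *
      Complex.exp ((3 + Complex.I * v) ^ 2) / (3 + Complex.I * v)

theorem norm_Gamma_le_Gamma_re {s : ℂ} (hs : 0 < s.re) :
    ‖Complex.Gamma s‖ ≤ Real.Gamma s.re := by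
  rw [Complex.Gamma_eq_integral hs, Real.Gamma_eq_integral hs, Complex.GammaIntegral]
  refine (norm_integral_le_integral_norm _).trans_eq ?_
  refine setIntegral_congr_fun measurableSet_Ioi fun x hx => ?_
  have hx : 0 < x := hx
  simp only [norm_mul, Complex.norm_real, Real.norm_eq_abs, Real.abs_exp]
  rw [Complex.norm_cpow_eq_rpow_re_of_pos hx]
  simp

theorem exists_norm_Gamma_le_of_re_mem_Icc {a b : ℝ} (ha : 0 < a) :
    ∃ M : ℝ, 0 ≤ M ∧ ∀ s : ℂ, s.re ∈ Set.Icc a b → ‖Complex.Gamma s‖ ≤ M := by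
  have hc : ContinuousOn Real.Gamma (Set.Icc a b) :=
    Real.differentiableOn_Gamma_Ioi.continuousOn.mono fun x hx => lt_of_lt_of_le ha hx.1
  obtain ⟨M, hM⟩ := isCompact_Icc.exists_bound_of_continuousOn hc
  refine ⟨|M|, abs_nonneg _, fun s hs => ?_⟩
  exact (norm_Gamma_le_Gamma_re (ha.trans_le hs.1)).trans
    ((le_abs_self _).trans ((hM _ hs).trans (le_abs_self _)))

theorem norm_Gamma_le_of_re_eq_half {s : ℂ} (hs : s.re = 1 / 2) :
    ‖Complex.Gamma s‖ ≤ √(2 * Real.pi) * Real.exp (-(Real.pi / 2) * |s.im|) := by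
  have h1 : 1 - s = (starRingEnd ℂ) s := by
    apply Complex.ext
    · simp [hs]; norm_num
    · simp
  have h2 := Complex.Gamma_mul_Gamma_one_sub s
  rw [h1, Complex.Gamma_conj, Complex.mul_conj'] at h2
  have hsin : Complex.sin (Real.pi * s) = (Real.cosh (Real.pi * s.im) : ℝ) := by
    have : (Real.pi : ℂ) * s = (Real.pi * s.im : ℝ) * Complex.I + Real.pi / 2 := by
      apply Complex.ext <;> simp [hs]; ring
    rw [this, Complex.sin_add_pi_div_two, Complex.cos_mul_I]
    push_cast; rfl
  rw [hsin] at h2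
  have h3 : ‖Complex.Gamma s‖ ^ 2 = Real.pi / Real.cosh (Real.pi * s.im) := by exact_mod_cast h2
  have h4 : Real.exp (Real.pi * |s.im|) / 2 ≤ Real.cosh (Real.pi * s.im) := by
    rw [← Real.cosh_abs, abs_mul, abs_of_pos Real.pi_pos, Real.cosh_eq]
    have := Real.exp_pos (-(Real.pi * |s.im|))
    linarith
  refine le_of_pow_le_pow_left₀ two_ne_zero (by positivity) ?_
  rw [h3, mul_pow, Real.sq_sqrt (by positivity), ← Real.exp_nat_mul, div_le_iff₀ (Real.cosh_pos _)]
  have h5 : Real.exp ((2 : ℕ) * (-(Real.pi / 2) * |s.im|)) = (Real.exp (Real.pi * |s.im|))⁻¹ := by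
    rw [← Real.exp_neg]; congr 1; push_cast; ring
  rw [h5]
  have h6 := Real.exp_pos (Real.pi * |s.im|)
  calc Real.pi = 2 * Real.pi * (Real.exp (Real.pi * |s.im|))⁻¹ *
        (Real.exp (Real.pi * |s.im|) / 2) := by field_simp
    _ ≤ _ := by gcongr

/-- The upper half of Stirling's formula on the vertical line `re s = x`. -/
def GammaLineBound (x : ℝ) : Prop :=
  ∃ C : ℝ, 0 < C ∧ ∀ s : ℂ, s.re = x →
    ‖Complex.Gamma s‖ ≤ C * (1 + |s.im|) ^ (x - 1 / 2) * Real.exp (-(Real.pi / 2) * |s.im|)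

theorem gammaLineBound_half : GammaLineBound (1 / 2) := by
  refine ⟨√(2 * Real.pi), by positivity, fun s hs => ?_⟩
  simpa using norm_Gamma_le_of_re_eq_half hs

theorem GammaLineBound.add_one {x : ℝ} (hx : 0 < x) (h : GammaLineBound x) :
    GammaLineBound (x + 1) := by
  obtain ⟨C, hC, h⟩ := h
  refine ⟨C * (x + 1), by positivity, fun s hs => ?_⟩
  have hre : (s - 1).re = x := by simp [hs]
  have hne : s - 1 ≠ 0 := fun h0 => by rw [h0] at hre; simp at hre; linarith
  have him : (s - 1).im = s.im := by simp
  have h1 := h (s - 1) hre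
  have h2 : Complex.Gamma s = (s - 1) * Complex.Gamma (s - 1) := by
    rw [← Complex.Gamma_add_one _ hne, sub_add_cancel]
  have h3 : ‖s - 1‖ ≤ (x + 1) * (1 + |s.im|) := by
    refine (Complex.norm_le_abs_re_add_abs_im _).trans ?_
    rw [hre, him, abs_of_pos hx]
    nlinarith [abs_nonneg s.im]
  have h4 : (1 + |s.im|) ^ (x + 1 - 1 / 2) = (1 + |s.im|) * (1 + |s.im|) ^ (x - 1 / 2) := by
    rw [show x + 1 - 1 / 2 = 1 + (x - 1 / 2) by ring, Real.rpow_add (by positivity), Real.rpow_one]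
  rw [h2, norm_mul, h4]
  rw [him] at h1
  calc _ ≤ ((x + 1) * (1 + |s.im|)) *
        (C * (1 + |s.im|) ^ (x - 1 / 2) * Real.exp (-(Real.pi / 2) * |s.im|)) := by gcongr
    _ = _ := by ring

theorem GammaLineBound.of_add_one {x : ℝ} (hx : 0 < x) (h : GammaLineBound (x + 1)) :
    GammaLineBound x := by
  obtain ⟨C, hC, h⟩ := h
  refine ⟨C * (1 / x + 1), by positivity, fun s hs => ?_⟩
  have hne : s ≠ 0 := fun h0 => by rw [h0] at hs; simp at hs; linarith
  have h1 := h (s + 1) (by simp [hs])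
  have him : (s + 1).im = s.im := by simp
  rw [him, Complex.Gamma_add_one _ hne, norm_mul] at h1
  have h3 : 1 + |s.im| ≤ (1 / x + 1) * ‖s‖ := by
    have ha := Complex.abs_re_le_norm s
    have hb := Complex.abs_im_le_norm s
    rw [hs, abs_of_pos hx] at ha
    have : 1 ≤ 1 / x * ‖s‖ := by rw [one_div, inv_mul_eq_div, one_le_div hx]; exact ha
    linarith
  have h4 : (1 + |s.im|) ^ (x + 1 - 1 / 2) = (1 + |s.im|) * (1 + |s.im|) ^ (x - 1 / 2) := by
    rw [show x + 1 - 1 / 2 = 1 + (x - 1 / 2) by ring, Real.rpow_add (by positivity), Real.rpow_one]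
  rw [h4] at h1
  have hn : 0 < ‖s‖ := norm_pos_iff.mpr hne
  refine le_of_mul_le_mul_left (h1.trans ?_) hn
  calc _ = C * (1 + |s.im|) * (1 + |s.im|) ^ (x - 1 / 2) *
        Real.exp (-(Real.pi / 2) * |s.im|) := by ring
    _ ≤ C * ((1 / x + 1) * ‖s‖) * (1 + |s.im|) ^ (x - 1 / 2) *
        Real.exp (-(Real.pi / 2) * |s.im|) := by gcongr
    _ = _ := by ring

theorem gammaLineBound_of_mem_Icc {x : ℝ} (hx : x ∈ Set.Icc (1 / 2 : ℝ) (3 / 2)) :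
    GammaLineBound x := by
  obtain ⟨C₀, hC₀, h₀⟩ := gammaLineBound_half
  obtain ⟨C₁, hC₁, h₁⟩ := gammaLineBound_half.add_one (by norm_num)
  obtain ⟨M, hM, hΓ⟩ := exists_norm_Gamma_le_of_re_mem_Icc (a := 1 / 2) (b := 3 / 2) (by norm_num)
  refine ⟨(C₀ * Real.exp 10) ^ (1 - (x - 1 / 2)) * (C₁ * Real.exp 10) ^ (x - 1 / 2),
    by positivity, fun s hs => ?_⟩
  set τ := s.im with hτ
  have hexp : ∀ z : ℂ, ‖Complex.exp (z ^ 2)‖ = Real.exp (z.re ^ 2 - z.im ^ 2) := fun z => by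
    rw [Complex.norm_exp]; congr 1; simp [sq]
  let f : ℂ → ℂ := fun z => Complex.Gamma (1 / 2 + z + τ * Complex.I) * Complex.exp (z ^ 2)
  have hre : ∀ z : ℂ, (1 / 2 + z + τ * Complex.I).re = 1 / 2 + z.re := fun z => by simp
  have him : ∀ z : ℂ, (1 / 2 + z + τ * Complex.I).im = z.im + τ := fun z => by simp
  have hdiff : DifferentiableOn ℂ f (Complex.re ⁻¹' Set.Ioi (-1 / 2)) := by
    intro z hz
    have hz : -1 / 2 < z.re := hz
    have hG : DifferentiableAt ℂ Complex.Gamma (1 / 2 + z + τ * Complex.I) := by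
      refine Complex.differentiableAt_Gamma _ fun m h => ?_
      have := congrArg Complex.re h
      rw [hre] at this
      simp at this
      have hm : (0 : ℝ) ≤ m := m.cast_nonneg
      linarith
    refine DifferentiableAt.differentiableWithinAt ?_
    refine DifferentiableAt.mul (DifferentiableAt.comp z (g := Complex.Gamma)
      (f := fun z => 1 / 2 + z + τ * Complex.I) hG (by fun_prop)) (by fun_prop)
  have hd : DiffContOnCl ℂ f (Complex.HadamardThreeLines.verticalStrip 0 1) := by
    refine DifferentiableOn.diffContOnCl (hdiff.mono ?_)
    rw [Complex.HadamardThreeLines.verticalStrip, Complex.closure_preimage_re,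
      closure_Ioo zero_ne_one]
    intro z hz
    exact lt_of_lt_of_le (by norm_num) hz.1
  have hB : BddAbove ((norm ∘ f) '' Complex.HadamardThreeLines.verticalClosedStrip 0 1) := by
    refine ⟨M * Real.exp 1, ?_⟩
    rintro _ ⟨z, hz, rfl⟩
    have hz : z.re ∈ Set.Icc (0 : ℝ) 1 := hz
    simp only [Function.comp_apply, f, norm_mul, hexp]
    gcongr
    · exact hΓ _ (by rw [hre]; constructor <;> linarith [hz.1, hz.2])
    · nlinarith [hz.1, hz.2, sq_nonneg z.im]
  have hpi := Real.pi_lt_four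
  have hpi0 := Real.pi_pos
  have habs : ∀ z : ℂ, |τ| - |z.im| ≤ |z.im + τ| := fun z => by
    have := abs_sub_abs_le_abs_sub τ (-z.im)
    rw [abs_neg] at this
    rwa [add_comm z.im, ← sub_neg_eq_add]
  have key : ∀ v w : ℝ, |τ| - |v| ≤ w → -(Real.pi / 2) * w + |v| + (1 - v ^ 2) ≤
      10 + (-(Real.pi / 2) * |τ|) := by
    intro v w hw
    have := mul_le_mul_of_nonneg_left hw (by positivity : 0 ≤ Real.pi / 2)
    have h3 : Real.pi / 2 * |v| ≤ 2 * |v| := by gcongr; linarith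
    rw [← sq_abs v]
    nlinarith [sq_nonneg (|v| - 3 / 2)]
  have hl : ∀ z ∈ Complex.re ⁻¹' {(0 : ℝ)}, ‖f z‖ ≤
      C₀ * Real.exp 10 * Real.exp (-(Real.pi / 2) * |τ|) := by
    intro z hz
    have hz : z.re = 0 := hz
    have h := h₀ (1 / 2 + z + τ * Complex.I) (by rw [hre, hz, add_zero])
    rw [him, sub_self, Real.rpow_zero, mul_one] at h
    simp only [f, norm_mul, hexp]
    calc _ ≤ C₀ * Real.exp (-(Real.pi / 2) * |z.im + τ|) * Real.exp (z.re ^ 2 - z.im ^ 2) := by gcongr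
      _ = C₀ * Real.exp (-(Real.pi / 2) * |z.im + τ| + (z.re ^ 2 - z.im ^ 2)) := by
        rw [Real.exp_add]; ring
      _ ≤ C₀ * Real.exp (10 + (-(Real.pi / 2) * |τ|)) := by
        refine mul_le_mul_of_nonneg_left (Real.exp_le_exp.mpr ?_) hC₀.le
        rw [hz]
        linarith [key z.im _ (habs z), abs_nonneg z.im]
      _ = _ := by rw [Real.exp_add]; ring
  have hr : ∀ z ∈ Complex.re ⁻¹' {(1 : ℝ)}, ‖f z‖ ≤
      C₁ * Real.exp 10 * ((1 + |τ|) * Real.exp (-(Real.pi / 2) * |τ|)) := by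
    intro z hz
    have hz : z.re = 1 := hz
    have h := h₁ (1 / 2 + z + τ * Complex.I) (by rw [hre, hz])
    rw [him, show (1 / 2 + 1 - 1 / 2 : ℝ) = 1 by norm_num, Real.rpow_one] at h
    have hp : 1 + |z.im + τ| ≤ (1 + |τ|) * Real.exp |z.im| := by
      have := abs_add_le z.im τ
      have := Real.add_one_le_exp |z.im|
      nlinarith [abs_nonneg z.im, abs_nonneg τ]
    simp only [f, norm_mul, hexp]
    calc _ ≤ C₁ * ((1 + |τ|) * Real.exp |z.im|) * Real.exp (-(Real.pi / 2) * |z.im + τ|) *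
          Real.exp (z.re ^ 2 - z.im ^ 2) := by
            refine mul_le_mul_of_nonneg_right (h.trans ?_) (by positivity)
            gcongr
      _ = C₁ * (1 + |τ|) * Real.exp (-(Real.pi / 2) * |z.im + τ| + |z.im| +
          (z.re ^ 2 - z.im ^ 2)) := by
        rw [Real.exp_add, Real.exp_add]; ring
      _ ≤ C₁ * (1 + |τ|) * Real.exp (10 + (-(Real.pi / 2) * |τ|)) := by
        refine mul_le_mul_of_nonneg_left (Real.exp_le_exp.mpr ?_) (by positivity)
        rw [hz, one_pow]
        exact key z.im _ (habs z)
      _ = _ := by rw [Real.exp_add]; ring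
  have hmem : ((x - 1 / 2 : ℝ) : ℂ) ∈ Complex.HadamardThreeLines.verticalClosedStrip 0 1 := by
    change _ ∈ Set.Icc (0 : ℝ) 1
    rw [Complex.ofReal_re]
    constructor <;> linarith [hx.1, hx.2]
  have h3 := Complex.HadamardThreeLines.norm_le_interp_of_mem_verticalClosedStrip' zero_lt_one
    hmem hd hB hl hr
  have hfs : ‖Complex.Gamma s‖ ≤ ‖f ((x - 1 / 2 : ℝ) : ℂ)‖ := by
    have : 1 / 2 + ((x - 1 / 2 : ℝ) : ℂ) + τ * Complex.I = s := by
      apply Complex.ext <;> simp [hs, hτ]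
    simp only [f, norm_mul, hexp]
    rw [this]
    refine le_mul_of_one_le_right (norm_nonneg _) (Real.one_le_exp ?_)
    simp; positivity
  refine hfs.trans (h3.trans_eq ?_)
  simp only [Complex.ofReal_re, sub_zero, div_one]
  rw [Real.mul_rpow (x := C₀ * Real.exp 10) (by positivity) (by positivity),
    Real.mul_rpow (x := C₁ * Real.exp 10) (by positivity) (by positivity),
    Real.mul_rpow (x := 1 + |τ|) (by positivity) (by positivity)]
  have he : Real.exp (-(Real.pi / 2) * |τ|) ^ (1 - (x - 1 / 2)) *
      Real.exp (-(Real.pi / 2) * |τ|) ^ (x - 1 / 2) = Real.exp (-(Real.pi / 2) * |τ|) := by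
    rw [← Real.rpow_add (Real.exp_pos _), sub_add_cancel, Real.rpow_one]
  linear_combination ((C₀ * Real.exp 10) ^ (1 - (x - 1 / 2)) * (C₁ * Real.exp 10) ^ (x - 1 / 2) *
    (1 + |τ|) ^ (x - 1 / 2)) * he

theorem gammaLineBound_of_pos {x : ℝ} (hx : 0 < x) : GammaLineBound x := by
  have key : ∀ n : ℕ, ∀ y : ℝ, 1 / 2 ≤ y → y ≤ n + 3 / 2 → GammaLineBound y := by
    intro n
    induction n with
    | zero => exact fun y h1 h2 => gammaLineBound_of_mem_Icc ⟨h1, by simpa using h2⟩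
    | succ n ih =>
      intro y h1 h2
      push_cast at h2
      by_cases hy : y ≤ 3 / 2
      · exact gammaLineBound_of_mem_Icc ⟨h1, hy⟩
      · have := (ih (y - 1) (by linarith) (by linarith)).add_one (by linarith)
        rwa [sub_add_cancel] at this
  obtain ⟨n, hn⟩ := exists_nat_ge (x + 1)
  exact (key n (x + 1) (by linarith) (by linarith)).of_add_one hx

theorem norm_sin_le_exp_abs_im (z : ℂ) : ‖Complex.sin z‖ ≤ Real.exp |z.im| := by
  rw [Complex.sin, norm_div, norm_mul, Complex.norm_I, Complex.norm_two, mul_one,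
    div_le_iff₀ two_pos]
  refine (norm_sub_le _ _).trans ?_
  rw [Complex.norm_exp, Complex.norm_exp]
  have h1 : Real.exp (-z * Complex.I).re ≤ Real.exp |z.im| := by
    gcongr; simpa using le_abs_self _
  have h2 : Real.exp (z * Complex.I).re ≤ Real.exp |z.im| := by
    gcongr; simpa using neg_le_abs _
  linarith

theorem exists_norm_inv_Gamma_le {x : ℝ} (hx : x < 1) :
    ∃ C : ℝ, 0 < C ∧ ∀ s : ℂ, s.re = x →
      ‖(Complex.Gamma s)⁻¹‖ ≤ C * (1 + |s.im|) ^ (1 / 2 - x) * Real.exp (Real.pi / 2 * |s.im|) := by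
  obtain ⟨C, hC, h⟩ := gammaLineBound_of_pos (sub_pos.mpr hx)
  refine ⟨C / Real.pi, by positivity, fun s hs => ?_⟩
  have h1 := h (1 - s) (by simp [hs])
  have him : |(1 - s).im| = |s.im| := by simp
  rw [him, show 1 - x - 1 / 2 = 1 / 2 - x by ring] at h1
  by_cases h0 : Complex.Gamma s = 0
  · rw [h0, inv_zero, norm_zero]; positivity
  have hpi : (Real.pi : ℂ) ≠ 0 := by exact_mod_cast Real.pi_ne_zero
  have h2 : (Complex.Gamma s)⁻¹ = Complex.Gamma (1 - s) * Complex.sin (Real.pi * s) / Real.pi := by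
    have h3 := Complex.Gamma_mul_Gamma_one_sub s
    have h4 : Complex.Gamma (1 - s) ≠ 0 := by
      refine Complex.Gamma_ne_zero_of_re_pos ?_
      simp [hs, hx]
    have h5 : Complex.sin (Real.pi * s) ≠ 0 := fun h5 => by
      rw [h5, div_zero] at h3
      exact mul_ne_zero h0 h4 h3
    rw [eq_div_iff h5] at h3
    rw [eq_div_iff hpi, inv_mul_eq_iff_eq_mul₀ h0, ← mul_assoc, h3]
  have h6 := norm_sin_le_exp_abs_im (Real.pi * s)
  have h7 : |((Real.pi : ℂ) * s).im| = Real.pi * |s.im| := by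
    simp [abs_mul, abs_of_pos Real.pi_pos]
  rw [h7] at h6
  rw [h2, norm_div, norm_mul, Complex.norm_real, Real.norm_of_nonneg Real.pi_pos.le]
  calc _ ≤ (C * (1 + |s.im|) ^ (1 / 2 - x) * Real.exp (-(Real.pi / 2) * |s.im|)) *
        Real.exp (Real.pi * |s.im|) / Real.pi := by gcongr
    _ = C / Real.pi * (1 + |s.im|) ^ (1 / 2 - x) *
        (Real.exp (-(Real.pi / 2) * |s.im|) * Real.exp (Real.pi * |s.im|)) := by ring
    _ = _ := by rw [← Real.exp_add]; congr 2; ring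

theorem rpow_le_rpow_abs_mul_rpow {a b K : ℝ} (ha : 0 < a) (hb : 0 < b) (hK : 0 < K)
    (hab : a ≤ K * b) (hba : b ≤ K * a) (s : ℝ) : a ^ s ≤ K ^ |s| * b ^ s := by
  rcases le_or_gt 0 s with hs | hs
  · rw [abs_of_nonneg hs, ← Real.mul_rpow hK.le hb.le]
    exact Real.rpow_le_rpow ha.le hab hs
  · have h1 : b / K ≤ a := by rwa [div_le_iff₀' hK]
    refine (Real.rpow_le_rpow_of_nonpos (by positivity) h1 hs.le).trans_eq ?_
    rw [Real.div_rpow hb.le hK.le, abs_of_neg hs, Real.rpow_neg hK.le]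
    field_simp

theorem exists_norm_Gamma_ratio_le {α : ℂ} (hα : |α.re| < 1 / 2) {σ : ℝ} (hσ : α.re - 1 / 2 < σ) :
    ∃ C c : ℝ, 0 < C ∧ 0 ≤ c ∧ ∀ t v : ℝ,
      ‖Complex.Gamma ((1 / 2 + Complex.I * t + (σ + Complex.I * v) - α) / 2) /
        Complex.Gamma ((1 / 2 + Complex.I * t - α) / 2)‖ ≤
          C * (1 + |t|) ^ (σ / 2) * Real.exp (c * |v|) := by
  have hα' := abs_lt.mp hα
  set x : ℝ := (1 / 2 - α.re) / 2 with hx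
  set x' : ℝ := x + σ / 2 with hx'
  obtain ⟨C₁, hC₁, h₁⟩ := gammaLineBound_of_pos (x := x') (by rw [hx', hx]; linarith)
  obtain ⟨C₂, hC₂, h₂⟩ := exists_norm_inv_Gamma_le (x := x) (by rw [hx]; linarith)
  refine ⟨C₁ * C₂ * (2 * (1 + |α.im|)) ^ |σ / 2|, |x' - 1 / 2| + Real.pi / 2, by positivity,
    by positivity, fun t v => ?_⟩
  set s := (1 / 2 + Complex.I * t + (σ + Complex.I * v) - α) / 2 with hs
  set s₀ := (1 / 2 + Complex.I * t - α) / 2 with hs₀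
  have hsre : s.re = x' := by rw [hs]; simp [hx', hx]; ring
  have hsre₀ : s₀.re = x := by rw [hs₀]; simp [hx]
  have hsim : s.im = (t - α.im) / 2 + v / 2 := by rw [hs]; simp; ring
  have hsim₀ : s₀.im = (t - α.im) / 2 := by rw [hs₀]; simp
  have h1 := h₁ s hsre
  have h2 := h₂ s₀ hsre₀
  have hv := abs_nonneg v
  have hv2 : |v / 2| = |v| / 2 := by rw [abs_div, abs_two]
  have hle : |s.im| ≤ |s₀.im| + |v| / 2 := by
    rw [hsim, hsim₀, ← hv2]; exact abs_add_le _ _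
  have hge : |s₀.im| ≤ |s.im| + |v| / 2 := by
    have := abs_sub (s.im) (v / 2)
    rwa [hv2, hsim, add_sub_cancel_right, ← hsim, ← hsim₀] at this
  have hexp := Real.add_one_le_exp |v|
  have h3 : (1 + |s.im|) ^ (x' - 1 / 2) ≤
      Real.exp |v| ^ |x' - 1 / 2| * (1 + |s₀.im|) ^ (x' - 1 / 2) := by
    refine rpow_le_rpow_abs_mul_rpow (by positivity) (by positivity) (by positivity) ?_ ?_ _ <;>
    nlinarith [abs_nonneg s.im, abs_nonneg s₀.im]
  have h4 : (1 + |s₀.im|) ^ (σ / 2) ≤ (2 * (1 + |α.im|)) ^ |σ / 2| * (1 + |t|) ^ (σ / 2) := by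
    have e1 : |s₀.im| = |t - α.im| / 2 := by rw [hsim₀, abs_div, abs_two]
    have e2 : |t - α.im| ≤ |t| + |α.im| := abs_sub _ _
    have e3 : |t| ≤ |t - α.im| + |α.im| := by
      simpa using abs_add_le (t - α.im) α.im
    have e4 : 0 ≤ |t| * |α.im| := by positivity
    have e5 : 0 ≤ |s₀.im| * |α.im| := by positivity
    have e6 := abs_nonneg t
    have e7 := abs_nonneg α.im
    refine rpow_le_rpow_abs_mul_rpow (by positivity) (by positivity) (by positivity) ?_ ?_ _ <;>
    nlinarith
  have h5 : (1 + |s₀.im|) ^ (x' - 1 / 2) * (1 + |s₀.im|) ^ (1 / 2 - x) =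
      (1 + |s₀.im|) ^ (σ / 2) := by
    rw [← Real.rpow_add (by positivity)]; congr 1; rw [hx']; ring
  rw [div_eq_mul_inv, norm_mul]
  calc _ ≤ (C₁ * (Real.exp |v| ^ |x' - 1 / 2| * (1 + |s₀.im|) ^ (x' - 1 / 2)) *
          Real.exp (-(Real.pi / 2) * |s.im|)) *
        (C₂ * (1 + |s₀.im|) ^ (1 / 2 - x) * Real.exp (Real.pi / 2 * |s₀.im|)) := by
          refine mul_le_mul (h1.trans ?_) h2 (norm_nonneg _) (by positivity)
          gcongr
    _ = C₁ * C₂ * Real.exp |v| ^ |x' - 1 / 2| * (1 + |s₀.im|) ^ (σ / 2) *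
        Real.exp (-(Real.pi / 2) * |s.im| + Real.pi / 2 * |s₀.im|) := by
          rw [Real.exp_add, ← h5]; ring
    _ ≤ C₁ * C₂ * Real.exp |v| ^ |x' - 1 / 2| *
        ((2 * (1 + |α.im|)) ^ |σ / 2| * (1 + |t|) ^ (σ / 2)) * Real.exp (Real.pi / 2 * |v|) := by
          gcongr
          nlinarith [Real.pi_pos]
    _ = _ := by rw [← Real.exp_mul, add_mul, Real.exp_add, mul_comm |v|]; ring

/-- Holomorphic functions on the vertical strip `a ≤ re u ≤ b` of at most exponential growth. -/
structure ExpGrowthOn (a b : ℝ) (g : ℂ → ℂ) : Prop where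
  diff : DifferentiableOn ℂ g (Complex.re ⁻¹' Set.Icc a b)
  bound : ∃ K c : ℝ, 0 ≤ K ∧ 0 ≤ c ∧ ∀ u : ℂ, u.re ∈ Set.Icc a b →
    ‖g u‖ ≤ K * Real.exp (c * |u.im|)

namespace ExpGrowthOn

variable {a b : ℝ} {f g : ℂ → ℂ}

theorem mono {a' b' : ℝ} (hg : ExpGrowthOn a b g) (ha : a ≤ a') (hb : b' ≤ b) :
    ExpGrowthOn a' b' g := by
  obtain ⟨hd, K, c, hK, hc, h⟩ := hg
  exact ⟨hd.mono (Set.preimage_mono (Set.Icc_subset_Icc ha hb)), K, c, hK, hc,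
    fun u hu => h u (Set.Icc_subset_Icc ha hb hu)⟩

theorem mul (hf : ExpGrowthOn a b f) (hg : ExpGrowthOn a b g) :
    ExpGrowthOn a b fun u => f u * g u := by
  obtain ⟨hd, K, c, hK, hc, h⟩ := hf
  obtain ⟨hd', K', c', hK', hc', h'⟩ := hg
  refine ⟨hd.mul hd', K * K', c + c', by positivity, by positivity, fun u hu => ?_⟩
  rw [norm_mul, add_mul, Real.exp_add]
  calc _ ≤ (K * Real.exp (c * |u.im|)) * (K' * Real.exp (c' * |u.im|)) :=
        mul_le_mul (h u hu) (h' u hu) (norm_nonneg _) (by positivity)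
    _ = _ := by ring

theorem sub (hf : ExpGrowthOn a b f) (hg : ExpGrowthOn a b g) :
    ExpGrowthOn a b fun u => f u - g u := by
  obtain ⟨hd, K, c, hK, hc, h⟩ := hf
  obtain ⟨hd', K', c', hK', hc', h'⟩ := hg
  refine ⟨hd.sub hd', K + K', c + c', by positivity, by positivity, fun u hu => ?_⟩
  refine (norm_sub_le _ _).trans ((add_le_add (h u hu) (h' u hu)).trans ?_)
  rw [add_mul K]
  have := abs_nonneg u.im
  gcongr <;> linarith

theorem of_norm_le {M : ℝ} (hd : DifferentiableOn ℂ g (Complex.re ⁻¹' Set.Icc a b))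
    (h : ∀ u : ℂ, u.re ∈ Set.Icc a b → ‖g u‖ ≤ M) : ExpGrowthOn a b g :=
  ⟨hd, |M|, 0, abs_nonneg _, le_rfl, fun u hu => by simpa using (h u hu).trans (le_abs_self M)⟩

theorem const (z : ℂ) : ExpGrowthOn a b fun _ => z :=
  of_norm_le (differentiableOn_const _) fun _ _ => le_rfl

theorem neg_sub (z : ℂ) : ExpGrowthOn a b fun u => -u - z := by
  refine ⟨by fun_prop, |a| + |b| + 1 + ‖z‖, 1, by positivity, zero_le_one, fun u hu => ?_⟩
  have h1 : |u.re| ≤ |a| + |b| := by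
    have := abs_le_max_abs_abs hu.1 hu.2
    exact this.trans (max_le_add_of_nonneg (abs_nonneg _) (abs_nonneg _))
  have h2 := Real.add_one_le_exp |u.im|
  have h3 := Complex.norm_le_abs_re_add_abs_im u
  have h4 : ‖-u - z‖ ≤ ‖u‖ + ‖z‖ := by simpa using norm_sub_le (-u) z
  rw [one_mul]
  nlinarith [abs_nonneg u.im, abs_nonneg a, abs_nonneg b, norm_nonneg z]

theorem cpow_neg {y : ℝ} (hy : 0 < y) : ExpGrowthOn a b fun u => (y : ℂ) ^ (-u) := by
  have hc : ContinuousOn (fun x : ℝ => y ^ (-x)) (Set.Icc a b) :=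
    (continuous_const.rpow continuous_neg fun _ => Or.inl hy.ne').continuousOn
  obtain ⟨M, hM⟩ := isCompact_Icc.exists_bound_of_continuousOn hc
  have hy0 : (y : ℂ) ≠ 0 := by exact_mod_cast hy.ne'
  refine of_norm_le (M := M) (fun u _ => ?_) fun u hu => ?_
  · exact ((differentiable_neg u).const_cpow (Or.inl hy0)).differentiableWithinAt
  · rw [Complex.norm_cpow_eq_rpow_re_of_pos hy]
    exact (le_abs_self _).trans (hM _ hu)

theorem gamma (z : ℂ) (h : 0 < z.re + a) :
    ExpGrowthOn a b fun u => Complex.Gamma ((z + u) / 2) := by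
  obtain ⟨M, -, hM⟩ := exists_norm_Gamma_le_of_re_mem_Icc (a := (z.re + a) / 2)
    (b := (z.re + b) / 2) (by linarith)
  have hre : ∀ u : ℂ, ((z + u) / 2).re = (z.re + u.re) / 2 := fun u => by simp
  refine of_norm_le (M := M) (fun u hu => ?_) fun u hu => hM _ ?_
  · have hu : u.re ∈ Set.Icc a b := hu
    refine DifferentiableAt.differentiableWithinAt (DifferentiableAt.comp u (g := Complex.Gamma)
      (f := fun u => (z + u) / 2) (Complex.differentiableAt_Gamma _ fun m hm => ?_) (by fun_prop))
    have h1 := congrArg Complex.re hm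
    rw [hre] at h1
    simp at h1
    have h2 : (0 : ℝ) ≤ m := m.cast_nonneg
    linarith [hu.1]
  · rw [hre]
    constructor <;> linarith [hu.1, hu.2]

theorem prod_neg_sub (k : ℕ) : ExpGrowthOn a b fun u => ∏ j ∈ Finset.range k, (-u - j) := by
  induction k with
  | zero => simpa using const 1
  | succ k ih => simpa only [Finset.prod_range_succ] using ih.mul (neg_sub (k : ℂ))

end ExpGrowthOn

/-- The integral of `g(u) e^{u²} / u` along the line `re u = σ`, parametrized by `u = σ + iv`. -/
noncomputable def gaussLineIntegral (σ : ℝ) (g : ℂ → ℂ) : ℂ :=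
  ∫ v : ℝ, g (σ + Complex.I * v) * Complex.exp ((σ + Complex.I * v) ^ 2) / (σ + Complex.I * v)

theorem integrable_exp_abs_sub_sq (c : ℝ) :
    Integrable fun v : ℝ => Real.exp (c * |v| - v ^ 2) := by
  refine ((integrable_exp_neg_mul_sq (b := 1 / 2) (by norm_num)).const_mul
    (Real.exp (c ^ 2 / 2))).mono' (by fun_prop) (Filter.Eventually.of_forall fun v => ?_)
  rw [Real.norm_of_nonneg (Real.exp_pos _).le, ← Real.exp_add]
  gcongr
  rw [← sq_abs v]
  nlinarith [sq_nonneg (|v| - c)]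

theorem norm_exp_sq (u : ℂ) : ‖Complex.exp (u ^ 2)‖ = Real.exp (u.re ^ 2 - u.im ^ 2) := by
  rw [Complex.norm_exp]; congr 1; simp [sq]

theorem norm_gauss_integrand_le {σ : ℝ} (hσ : σ ≠ 0) {g : ℂ → ℂ} {K c v : ℝ}
    (h : ‖g (σ + Complex.I * v)‖ ≤ K * Real.exp (c * |v|)) :
    ‖g (σ + Complex.I * v) * Complex.exp ((σ + Complex.I * v) ^ 2) / (σ + Complex.I * v)‖ ≤
      K * (Real.exp (σ ^ 2) / |σ| * Real.exp (c * |v| - v ^ 2)) := by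
  have h1 : |σ| ≤ ‖(σ : ℂ) + Complex.I * v‖ := by
    simpa using Complex.abs_re_le_norm ((σ : ℂ) + Complex.I * v)
  have h2 : 0 < |σ| := abs_pos.mpr hσ
  rw [norm_div, norm_mul, norm_exp_sq]
  have hre : ((σ : ℂ) + Complex.I * v).re = σ := by simp
  have him : ((σ : ℂ) + Complex.I * v).im = v := by simp
  rw [hre, him]
  calc _ ≤ (K * Real.exp (c * |v|)) * Real.exp (σ ^ 2 - v ^ 2) / |σ| := by
        have h0 := (norm_nonneg _).trans h
        gcongr
    _ = _ := by rw [Real.exp_sub, Real.exp_sub]; ring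

theorem norm_gaussLineIntegral_le {σ : ℝ} (hσ : σ ≠ 0) {g : ℂ → ℂ} {K c : ℝ}
    (h : ∀ v : ℝ, ‖g (σ + Complex.I * v)‖ ≤ K * Real.exp (c * |v|)) :
    ‖gaussLineIntegral σ g‖ ≤
      K * (Real.exp (σ ^ 2) / |σ| * ∫ v : ℝ, Real.exp (c * |v| - v ^ 2)) := by
  rw [← integral_const_mul, ← integral_const_mul]
  exact norm_integral_le_of_norm_le (((integrable_exp_abs_sub_sq c).const_mul _).const_mul _)
    (Filter.Eventually.of_forall fun v => norm_gauss_integrand_le hσ (h v))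

namespace ExpGrowthOn

variable {a b : ℝ} {f g : ℂ → ℂ}

theorem bound_line (hg : ExpGrowthOn a b g) :
    ∃ K c : ℝ, 0 ≤ K ∧ 0 ≤ c ∧ ∀ σ ∈ Set.Icc a b, ∀ v : ℝ,
      ‖g (σ + Complex.I * v)‖ ≤ K * Real.exp (c * |v|) := by
  obtain ⟨-, K, c, hK, hc, h⟩ := hg
  exact ⟨K, c, hK, hc, fun σ hσ v => by
    simpa using h (σ + Complex.I * v) (by simpa using hσ)⟩

theorem continuous_line (hg : ExpGrowthOn a b g) {σ : ℝ} (hσ : σ ∈ Set.Icc a b) :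
    Continuous fun v : ℝ => g (σ + Complex.I * v) :=
  hg.diff.continuousOn.comp_continuous (by fun_prop) fun v => by simpa using hσ

theorem line_ne_zero {σ : ℝ} (hσ : σ ≠ 0) (v : ℝ) : (σ : ℂ) + Complex.I * v ≠ 0 := fun h =>
  hσ (by simpa using congrArg Complex.re h)

theorem continuous_integrand (hg : ExpGrowthOn a b g) {σ : ℝ} (hσ : σ ∈ Set.Icc a b)
    (h0 : σ ≠ 0) : Continuous fun v : ℝ =>
      g (σ + Complex.I * v) * Complex.exp ((σ + Complex.I * v) ^ 2) / (σ + Complex.I * v) :=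
  ((hg.continuous_line hσ).mul (by fun_prop)).div (by fun_prop) (line_ne_zero h0)

theorem integrable (hg : ExpGrowthOn a b g) {σ : ℝ} (hσ : σ ∈ Set.Icc a b) (h0 : σ ≠ 0) :
    Integrable fun v : ℝ =>
      g (σ + Complex.I * v) * Complex.exp ((σ + Complex.I * v) ^ 2) / (σ + Complex.I * v) := by
  obtain ⟨K, c, hK, hc, h⟩ := hg.bound_line
  exact (((integrable_exp_abs_sub_sq c).const_mul _).const_mul K).mono'
    (hg.continuous_integrand hσ h0).aestronglyMeasurable
    (Filter.Eventually.of_forall fun v => norm_gauss_integrand_le h0 (h σ hσ v))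

theorem gaussLineIntegral_sub (hf : ExpGrowthOn a b f) (hg : ExpGrowthOn a b g) {σ : ℝ}
    (hσ : σ ∈ Set.Icc a b) (h0 : σ ≠ 0) :
    gaussLineIntegral σ (fun u => f u - g u) = gaussLineIntegral σ f - gaussLineIntegral σ g := by
  rw [gaussLineIntegral, gaussLineIntegral, gaussLineIntegral,
    ← integral_sub (hf.integrable hσ h0) (hg.integrable hσ h0)]
  congr 1 with v
  ring

end ExpGrowthOn

theorem gaussLineIntegral_const_mul (σ : ℝ) (z : ℂ) (g : ℂ → ℂ) :
    gaussLineIntegral σ (fun u => z * g u) = z * gaussLineIntegral σ g := by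
  rw [gaussLineIntegral, gaussLineIntegral, ← integral_const_mul]
  congr 1 with v
  ring

/-- Moving a vertical line of integration for a function with Gaussian decay. -/
theorem integral_line_eq_of_gauss_decay {a b : ℝ} (hab : a ≤ b) {f : ℂ → ℂ}
    (hd : DifferentiableOn ℂ f (Complex.re ⁻¹' Set.Icc a b))
    (ha : Integrable fun v : ℝ => f (a + Complex.I * v))
    (hb : Integrable fun v : ℝ => f (b + Complex.I * v)) {K c : ℝ}
    (h : ∀ u : ℂ, u.re ∈ Set.Icc a b → 1 ≤ |u.im| → ‖f u‖ ≤ K * Real.exp (c * |u.im| - u.im ^ 2)) :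
    ∫ v : ℝ, f (a + Complex.I * v) = ∫ v : ℝ, f (b + Complex.I * v) := by
  have hlim : Filter.Tendsto (fun T : ℝ => K * Real.exp (c * T - T ^ 2) * |b - a|) Filter.atTop
      (nhds 0) := by
    have h1 : Filter.Tendsto (fun T : ℝ => c * T - T ^ 2) Filter.atTop Filter.atBot := by
      have h2 : Filter.Tendsto (fun T : ℝ => T * (c - T)) Filter.atTop Filter.atBot :=
        Filter.tendsto_id.atTop_mul_atBot₀ (tendsto_const_nhds.add_atBot
          Filter.tendsto_neg_atTop_atBot)
      exact h2.congr fun T => by ring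
    simpa using ((Real.tendsto_exp_atBot.comp h1).const_mul K).mul_const |b - a|
  have hor : ∀ T₀ : ℝ, ∀ T : ℝ, 1 ≤ T → |T₀| = T →
      ‖∫ x : ℝ in a..b, f (x + T₀ * Complex.I)‖ ≤ K * Real.exp (c * T - T ^ 2) * |b - a| := by
    intro T₀ T hT hT₀
    refine intervalIntegral.norm_integral_le_of_norm_le_const fun x hx => ?_
    rw [Set.uIoc_of_le hab] at hx
    have := h (x + T₀ * Complex.I) (by simpa using ⟨hx.1.le, hx.2⟩) (by simpa [hT₀] using hT)
    simpa [hT₀, ← sq_abs T₀] using this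
  have hvert : ∀ σ : ℝ, Integrable (fun v : ℝ => f (σ + Complex.I * v)) →
      Filter.Tendsto (fun T : ℝ => ∫ v : ℝ in (-T)..T, f (σ + v * Complex.I)) Filter.atTop
        (nhds (∫ v : ℝ, f (σ + Complex.I * v))) := fun σ hσ => by
    simp_rw [mul_comm _ Complex.I]
    exact intervalIntegral_tendsto_integral hσ Filter.tendsto_neg_atTop_atBot Filter.tendsto_id
  have hbot : Filter.Tendsto (fun T : ℝ => ∫ x : ℝ in a..b, f (x + (-T : ℝ) * Complex.I))
      Filter.atTop (nhds 0) := by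
    refine squeeze_zero_norm' ?_ hlim
    filter_upwards [Filter.eventually_ge_atTop 1] with T hT
    exact hor _ T hT (by rw [abs_neg, abs_of_nonneg (by linarith)])
  have htop : Filter.Tendsto (fun T : ℝ => ∫ x : ℝ in a..b, f (x + T * Complex.I))
      Filter.atTop (nhds 0) := by
    refine squeeze_zero_norm' ?_ hlim
    filter_upwards [Filter.eventually_ge_atTop 1] with T hT
    exact hor _ T hT (abs_of_nonneg (by linarith))
  have hrect : ∀ T : ℝ, (∫ x : ℝ in a..b, f (x + (-T : ℝ) * Complex.I)) -
      (∫ x : ℝ in a..b, f (x + T * Complex.I)) +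
      Complex.I * (∫ v : ℝ in (-T)..T, f (b + v * Complex.I)) -
      Complex.I * (∫ v : ℝ in (-T)..T, f (a + v * Complex.I)) = 0 := by
    intro T
    have := Complex.integral_boundary_rect_eq_zero_of_differentiableOn f
      (a + (-T : ℝ) * Complex.I) (b + T * Complex.I) (hd.mono fun u hu => by
        have := hu.1
        simpa [Set.uIcc_of_le hab] using this)
    simpa using this
  have hlimit := ((hbot.sub htop).add ((hvert b hb).const_mul Complex.I)).sub
    ((hvert a ha).const_mul Complex.I)
  simp_rw [hrect] at hlimit
  have h0 := tendsto_nhds_unique hlimit tendsto_const_nhds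
  rw [sub_zero, zero_add, ← mul_sub] at h0
  exact (sub_eq_zero.mp ((mul_eq_zero.mp h0).resolve_left Complex.I_ne_zero)).symm

namespace ExpGrowthOn

variable {a b : ℝ} {g : ℂ → ℂ}

theorem exists_norm_mul_exp_sq_div_le (hg : ExpGrowthOn a b g) :
    ∃ K c : ℝ, ∀ u : ℂ, u.re ∈ Set.Icc a b → 1 ≤ |u.im| →
      ‖g u * Complex.exp (u ^ 2) / u‖ ≤ K * Real.exp (c * |u.im| - u.im ^ 2) := by
  obtain ⟨-, K, c, hK, hc, h⟩ := hg
  refine ⟨K * Real.exp (a ^ 2 + b ^ 2), c, fun u hu h1 => ?_⟩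
  have h2 : 1 ≤ ‖u‖ := h1.trans (Complex.abs_im_le_norm u)
  have h3 : u.re ^ 2 ≤ a ^ 2 + b ^ 2 := by
    rcases le_total 0 u.re with h0 | h0 <;> nlinarith [hu.1, hu.2, sq_nonneg a, sq_nonneg b]
  rw [norm_div, norm_mul, norm_exp_sq]
  calc _ ≤ (K * Real.exp (c * |u.im|)) * Real.exp (a ^ 2 + b ^ 2 - u.im ^ 2) / 1 := by
        have := h u hu
        gcongr
    _ = _ := by rw [Real.exp_sub, Real.exp_sub]; ring

theorem gaussLineIntegral_eq (hg : ExpGrowthOn a b g) (ha : 0 < a) (hab : a ≤ b) :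
    gaussLineIntegral a g = gaussLineIntegral b g := by
  obtain ⟨K, c, h⟩ := hg.exists_norm_mul_exp_sq_div_le
  have h0 : ∀ u ∈ Complex.re ⁻¹' Set.Icc a b, u ≠ 0 := by
    rintro u hu rfl
    exact ha.not_ge hu.1
  exact integral_line_eq_of_gauss_decay (f := fun u => g u * Complex.exp (u ^ 2) / u) hab
    ((hg.diff.mul (by fun_prop)).div differentiableOn_id h0)
    (hg.integrable (Set.left_mem_Icc.mpr hab) ha.ne')
    (hg.integrable (Set.right_mem_Icc.mpr hab) (ha.trans_le hab).ne') h

/-- Moving the line of integration across the simple pole at `0`. -/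
theorem gaussLineIntegral_sub_eq (hg : ExpGrowthOn a b g) (ha : a < 0) (hb : 0 < b) :
    gaussLineIntegral a g - g 0 * gaussLineIntegral a (fun _ => 1) =
      gaussLineIntegral b g - g 0 * gaussLineIntegral b (fun _ => 1) := by
  have hab := (ha.trans hb).le
  have hg' : ExpGrowthOn a b fun u => g u - g 0 := hg.sub (const _)
  have hI : ∀ σ ∈ Set.Icc a b, σ ≠ 0 → gaussLineIntegral σ (fun u => g u - g 0) =
      gaussLineIntegral σ g - g 0 * gaussLineIntegral σ (fun _ => 1) := by
    intro σ hσ h0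
    rw [hg.gaussLineIntegral_sub (const _) hσ h0, ← gaussLineIntegral_const_mul]
    simp only [mul_one]
  rw [← hI a (Set.left_mem_Icc.mpr hab) ha.ne, ← hI b (Set.right_mem_Icc.mpr hab) hb.ne']
  obtain ⟨K, c, h⟩ := hg'.exists_norm_mul_exp_sq_div_le
  set F : ℂ → ℂ := dslope (fun u => (g u - g 0) * Complex.exp (u ^ 2)) 0 with hF
  have hFu : ∀ u : ℂ, u ≠ 0 → F u = (g u - g 0) * Complex.exp (u ^ 2) / u := fun u hu => by
    rw [hF, dslope_of_ne _ hu, slope_def_field]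
    simp
  have hline : ∀ σ : ℝ, σ ≠ 0 → (fun v : ℝ => F (σ + Complex.I * v)) = fun v : ℝ =>
      (g (σ + Complex.I * v) - g 0) * Complex.exp ((σ + Complex.I * v) ^ 2) /
        (σ + Complex.I * v) := fun σ hσ => funext fun v => hFu _ (line_ne_zero hσ v)
  have hnhds : Complex.re ⁻¹' Set.Icc a b ∈ nhds (0 : ℂ) :=
    Complex.continuous_re.continuousAt.preimage_mem_nhds (Icc_mem_nhds ha hb)
  have hmain := integral_line_eq_of_gauss_decay (f := F) hab
    ((Complex.differentiableOn_dslope hnhds).mpr (hg'.diff.mul (by fun_prop)))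
    (by rw [hline a ha.ne]; exact hg'.integrable (Set.left_mem_Icc.mpr hab) ha.ne)
    (by rw [hline b hb.ne']; exact hg'.integrable (Set.right_mem_Icc.mpr hab) hb.ne')
    (fun u hu h1 => by
      rw [hFu u (by rintro rfl; simp at h1; linarith)]
      exact h u hu h1)
  rwa [hline a ha.ne, hline b hb.ne'] at hmain

end ExpGrowthOn

open ExpGrowthOn in
theorem hasDerivAt_gaussLineIntegral_cpow {a b σ : ℝ} {g : ℂ → ℂ} (hg : ExpGrowthOn a b g)
    (hσ : σ ∈ Set.Icc a b) (h0 : 0 < σ) {y : ℝ} (hy : 0 < y) :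
    HasDerivAt (fun x : ℝ => gaussLineIntegral σ fun u => (x : ℂ) ^ (-u) * g u)
      ((y : ℂ)⁻¹ * gaussLineIntegral σ fun u => (y : ℂ) ^ (-u) * (-u * g u)) y := by
  have hg1 : ExpGrowthOn a b fun u => -u * g u := by
    simpa using (ExpGrowthOn.neg_sub (a := a) (b := b) 0).mul hg
  set Φ : ℝ → ℂ := fun v =>
    (-(σ + Complex.I * v) * g (σ + Complex.I * v)) * Complex.exp ((σ + Complex.I * v) ^ 2) /
      (σ + Complex.I * v) with hΦ
  have hΦi : Integrable Φ := hg1.integrable hσ h0.ne'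
  have hint : ∀ x : ℝ, 0 < x → Integrable fun v : ℝ =>
      (x : ℂ) ^ (-(σ + Complex.I * v)) * g (σ + Complex.I * v) *
        Complex.exp ((σ + Complex.I * v) ^ 2) / (σ + Complex.I * v) := fun x hx =>
    ((ExpGrowthOn.cpow_neg hx).mul hg).integrable hσ h0.ne'
  have hint1 : Integrable fun v : ℝ =>
      (y : ℂ) ^ (-(σ + Complex.I * v)) * (-(σ + Complex.I * v) * g (σ + Complex.I * v)) *
        Complex.exp ((σ + Complex.I * v) ^ 2) / (σ + Complex.I * v) :=
    ((ExpGrowthOn.cpow_neg hy).mul hg1).integrable hσ h0.ne'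
  have key := hasDerivAt_integral_of_dominated_loc_of_deriv_le (μ := volume) (𝕜 := ℝ) (x₀ := y)
    (s := Set.Ioi (y / 2))
    (F := fun x v => (x : ℂ) ^ (-(σ + Complex.I * v)) * g (σ + Complex.I * v) *
        Complex.exp ((σ + Complex.I * v) ^ 2) / (σ + Complex.I * v))
    (F' := fun x v => (x : ℂ)⁻¹ * ((x : ℂ) ^ (-(σ + Complex.I * v)) *
        (-(σ + Complex.I * v) * g (σ + Complex.I * v)) *
        Complex.exp ((σ + Complex.I * v) ^ 2) / (σ + Complex.I * v)))
    (bound := fun v => (y / 2) ^ (-σ - 1) * ‖Φ v‖)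
    (Ioi_mem_nhds (by linarith))
    ((eventually_gt_nhds hy).mono fun x hx => (hint x hx).aestronglyMeasurable)
    (hint y hy) (hint1.const_mul _).aestronglyMeasurable
    (Filter.Eventually.of_forall fun v x hx => ?_)
    (hΦi.norm.const_mul _)
    (Filter.Eventually.of_forall fun v x hx => ?_)
  · simpa only [gaussLineIntegral, integral_const_mul] using key.2
  · have hx : y / 2 < x := hx
    have hx0 : 0 < x := by linarith
    have e : (x : ℂ)⁻¹ * ((x : ℂ) ^ (-(σ + Complex.I * v)) *
        (-(σ + Complex.I * v) * g (σ + Complex.I * v)) *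
        Complex.exp ((σ + Complex.I * v) ^ 2) / (σ + Complex.I * v)) =
        (x : ℂ)⁻¹ * (x : ℂ) ^ (-(σ + Complex.I * v)) * Φ v := by rw [hΦ]; ring
    rw [e, norm_mul, norm_mul, Complex.norm_cpow_eq_rpow_re_of_pos hx0, norm_inv,
      Complex.norm_real, Real.norm_of_nonneg hx0.le]
    refine mul_le_mul_of_nonneg_right ?_ (norm_nonneg _)
    have e2 : x⁻¹ * x ^ (-((σ : ℂ) + Complex.I * v)).re = x ^ (-σ - 1) := by
      rw [Real.rpow_sub hx0, Real.rpow_one]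
      simp
      ring
    rw [e2]
    exact Real.rpow_le_rpow_of_nonpos (by positivity) hx.le (by linarith)
  · have hx : y / 2 < x := hx
    have hx0 : 0 < x := by linarith
    have hxc : (x : ℂ) ≠ 0 := by exact_mod_cast hx0.ne'
    have hcp : HasDerivAt (fun z : ℂ => z ^ (-(σ + Complex.I * v)))
        (-(σ + Complex.I * v) * (x : ℂ) ^ (-(σ + Complex.I * v) - 1) * 1) (x : ℂ) :=
      (hasDerivAt_id (x : ℂ)).cpow_const (Complex.ofReal_mem_slitPlane.mpr hx0)
    have h1 := (((hcp.comp_ofReal).mul_const (g (σ + Complex.I * v))).mul_const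
      (Complex.exp ((σ + Complex.I * v) ^ 2))).div_const (σ + Complex.I * v)
    refine h1.congr_deriv ?_
    rw [Complex.cpow_sub _ _ hxc, Complex.cpow_one]
    ring

theorem iteratedDeriv_gaussLineIntegral_cpow {a b σ : ℝ} {g : ℂ → ℂ} (hg : ExpGrowthOn a b g)
    (hσ : σ ∈ Set.Icc a b) (h0 : 0 < σ) (k : ℕ) {y : ℝ} (hy : 0 < y) :
    iteratedDeriv k (fun x : ℝ => gaussLineIntegral σ fun u => (x : ℂ) ^ (-u) * g u) y =
      ((y : ℂ) ^ k)⁻¹ * gaussLineIntegral σ fun u =>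
        (y : ℂ) ^ (-u) * ((∏ j ∈ Finset.range k, (-u - j)) * g u) := by
  induction k generalizing y with
  | zero => simp
  | succ k ih =>
    set gk : ℂ → ℂ := fun u => (∏ j ∈ Finset.range k, (-u - j)) * g u with hgk
    have hgk' : ExpGrowthOn a b gk := (ExpGrowthOn.prod_neg_sub k).mul hg
    have hyc : (y : ℂ) ≠ 0 := by exact_mod_cast hy.ne'
    have h1 := hasDerivAt_gaussLineIntegral_cpow hgk' hσ h0 hy
    have h2 : HasDerivAt (fun x : ℝ => ((x : ℂ) ^ k)⁻¹)
        (-(k * (y : ℂ) ^ (k - 1)) / ((y : ℂ) ^ k) ^ 2) y :=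
      ((hasDerivAt_pow k (y : ℂ)).inv (pow_ne_zero k hyc)).comp_ofReal
    have h3 := h2.mul h1
    rw [iteratedDeriv_succ, Filter.EventuallyEq.deriv_eq
      ((eventually_gt_nhds hy).mono fun x hx => ih hx)]
    refine h3.deriv.trans ?_
    have h4 : ExpGrowthOn a b fun u => (y : ℂ) ^ (-u) * gk u := (ExpGrowthOn.cpow_neg hy).mul hgk'
    have h5 : ExpGrowthOn a b fun u => (y : ℂ) ^ (-u) * (-u * gk u) := by
      refine (ExpGrowthOn.cpow_neg hy).mul ?_
      simpa using (ExpGrowthOn.neg_sub (a := a) (b := b) 0).mul hgk'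
    have h6 : (fun u : ℂ => (y : ℂ) ^ (-u) *
        ((∏ j ∈ Finset.range (k + 1), (-u - j)) * g u)) =
        fun u => (y : ℂ) ^ (-u) * (-u * gk u) - (k : ℂ) * ((y : ℂ) ^ (-u) * gk u) := by
      funext u
      rw [Finset.prod_range_succ, hgk]
      ring
    rw [h6, h5.gaussLineIntegral_sub ((ExpGrowthOn.const _).mul h4) hσ h0.ne',
      gaussLineIntegral_const_mul]
    have h7 : -(k * (y : ℂ) ^ (k - 1)) / ((y : ℂ) ^ k) ^ 2 = -(k * ((y : ℂ) ^ (k + 1))⁻¹) := by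
      rcases k with _ | k
      · simp
      · field_simp
        simp
        ring
    rw [h7]
    field_simp
    ring

/-- The quotient `Γ((1/2 + it + u - α)/2) / Γ((1/2 + it - α)/2)`. -/
noncomputable def gammaRatio (α : ℂ) (t : ℝ) (u : ℂ) : ℂ :=
  Complex.Gamma ((1 / 2 + Complex.I * t + u - α) / 2) /
    Complex.Gamma ((1 / 2 + Complex.I * t - α) / 2)

theorem gammaRatio_zero {α : ℂ} (hα : |α.re| < 1 / 2) (t : ℝ) : gammaRatio α t 0 = 1 := by
  rw [gammaRatio, add_zero]
  refine div_self (Complex.Gamma_ne_zero_of_re_pos ?_)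
  have := (abs_lt.mp hα).2
  simp
  linarith

theorem expGrowthOn_gammaRatio {α : ℂ} {a b : ℝ} (h : α.re - 1 / 2 < a) (t : ℝ) :
    ExpGrowthOn a b (gammaRatio α t) := by
  have h1 := (ExpGrowthOn.gamma (a := a) (b := b) (1 / 2 + Complex.I * t - α)
    (by simp; linarith)).mul
    (ExpGrowthOn.const (Complex.Gamma ((1 / 2 + Complex.I * t - α) / 2))⁻¹)
  have h2 : gammaRatio α t = fun u =>
      Complex.Gamma ((1 / 2 + Complex.I * t - α + u) / 2) *
        (Complex.Gamma ((1 / 2 + Complex.I * t - α) / 2))⁻¹ := by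
    funext u
    rw [gammaRatio, div_eq_mul_inv, sub_add_eq_add_sub]
  rwa [h2]

/-- A family `g t` of functions which on the line `re u = σ` is polynomially bounded in `t` with
exponent `s`, and grows at most exponentially along the line. -/
def FamilyGrowth (σ s : ℝ) (g : ℝ → ℂ → ℂ) : Prop :=
  ∃ C c : ℝ, 0 ≤ C ∧ ∀ t v : ℝ,
    ‖g t (σ + Complex.I * v)‖ ≤ C * (1 + |t|) ^ s * Real.exp (c * |v|)

namespace FamilyGrowth

variable {σ s s' : ℝ} {f g : ℝ → ℂ → ℂ}

theorem mul (hf : FamilyGrowth σ s f) (hg : FamilyGrowth σ s' g) :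
    FamilyGrowth σ (s + s') fun t u => f t u * g t u := by
  obtain ⟨C, c, hC, h⟩ := hf
  obtain ⟨C', c', hC', h'⟩ := hg
  refine ⟨C * C', c + c', by positivity, fun t v => ?_⟩
  rw [norm_mul, Real.rpow_add (by positivity), add_mul, Real.exp_add]
  calc _ ≤ (C * (1 + |t|) ^ s * Real.exp (c * |v|)) *
        (C' * (1 + |t|) ^ s' * Real.exp (c' * |v|)) :=
        mul_le_mul (h t v) (h' t v) (norm_nonneg _) (by positivity)
    _ = _ := by ring

theorem comp_neg (hf : FamilyGrowth σ s f) : FamilyGrowth σ s fun t u => f (-t) u := by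
  obtain ⟨C, c, hC, h⟩ := hf
  exact ⟨C, c, hC, fun t v => by simpa using h (-t) v⟩

theorem of_expGrowthOn {g : ℂ → ℂ} (hg : ExpGrowthOn σ σ g) :
    FamilyGrowth σ 0 fun _ => g := by
  obtain ⟨K, c, hK, -, h⟩ := hg.bound_line
  exact ⟨K, c, hK, fun t v => by simpa using h σ ⟨le_rfl, le_rfl⟩ v⟩

theorem gammaRatio {α : ℂ} (hα : |α.re| < 1 / 2) (hσ : α.re - 1 / 2 < σ) :
    FamilyGrowth σ (σ / 2) (gammaRatio α) := by
  obtain ⟨C, c, hC, -, h⟩ := exists_norm_Gamma_ratio_le hα hσ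
  exact ⟨C, c, hC.le, h⟩

theorem exists_norm_gaussLineIntegral_le (h0 : σ ≠ 0) (hg : FamilyGrowth σ (3 * σ) g) :
    ∃ D : ℝ, 0 ≤ D ∧ ∀ t y : ℝ, 0 < y →
      ‖gaussLineIntegral σ fun u => (y : ℂ) ^ (-u) * g t u‖ ≤
        D * (y / (1 + |t|) ^ 3) ^ (-σ) := by
  obtain ⟨C, c, hC, h⟩ := hg
  refine ⟨C * (Real.exp (σ ^ 2) / |σ| * ∫ v : ℝ, Real.exp (c * |v| - v ^ 2)),
    mul_nonneg hC (mul_nonneg (by positivity) (integral_nonneg fun v => (Real.exp_pos _).le)),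
    fun t y hy => ?_⟩
  have hX : y ^ (-σ) * (1 + |t|) ^ (3 * σ) = (y / (1 + |t|) ^ 3) ^ (-σ) := by
    rw [Real.div_rpow hy.le (by positivity), Real.rpow_mul (by positivity),
      Real.rpow_neg (x := (1 + |t|) ^ 3) (by positivity), div_inv_eq_mul]
    norm_cast
  refine (norm_gaussLineIntegral_le h0 (K := C * (y / (1 + |t|) ^ 3) ^ (-σ)) (c := c)
    fun v => ?_).trans_eq (by ring)
  rw [norm_mul, Complex.norm_cpow_eq_rpow_re_of_pos hy, ← hX]
  have hre : (-((σ : ℂ) + Complex.I * v)).re = -σ := by simp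
  rw [hre]
  calc _ ≤ y ^ (-σ) * (C * (1 + |t|) ^ (3 * σ) * Real.exp (c * |v|)) := by
        gcongr
        exact h t v
    _ = _ := by ring

end FamilyGrowth

/-- The Mellin kernel of `Vweight`, without the factor `e^{u²} / u`. -/
noncomputable def weightKernel (α₁ α₂ α₃ : ℂ) (t : ℝ) (u : ℂ) : ℂ :=
  1 / (2 * Real.pi) * ((Real.pi ^ 2 : ℝ) : ℂ) ^ (-u) *
    (gammaRatio α₁ t u * gammaRatio α₂ t u * gammaRatio α₃ t u) *
    (gammaRatio α₁ (-t) u * gammaRatio α₂ (-t) u * gammaRatio α₃ (-t) u)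

theorem Vweight_eq_gaussLineIntegral (α₁ α₂ α₃ : ℂ) (t : ℝ) {y : ℝ} (hy : 0 < y) :
    Vweight α₁ α₂ α₃ t y =
      gaussLineIntegral 3 fun u => (y : ℂ) ^ (-u) * weightKernel α₁ α₂ α₃ t u := by
  rw [Vweight, gaussLineIntegral, ← integral_const_mul]
  congr 1 with v
  rw [Complex.ofReal_mul, Complex.mul_cpow_ofReal_nonneg (by positivity) hy.le]
  simp only [weightKernel, gammaRatio, Complex.ofReal_neg, Complex.ofReal_ofNat, mul_neg,
    ← sub_eq_add_neg]
  ring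

theorem expGrowthOn_weightKernel {α₁ α₂ α₃ : ℂ} {a b : ℝ} (h₁ : α₁.re - 1 / 2 < a)
    (h₂ : α₂.re - 1 / 2 < a) (h₃ : α₃.re - 1 / 2 < a) (t : ℝ) :
    ExpGrowthOn a b (weightKernel α₁ α₂ α₃ t) :=
  (((ExpGrowthOn.const _).mul (ExpGrowthOn.cpow_neg (by positivity))).mul
    (((expGrowthOn_gammaRatio h₁ t).mul (expGrowthOn_gammaRatio h₂ t)).mul
      (expGrowthOn_gammaRatio h₃ t))).mul
    (((expGrowthOn_gammaRatio h₁ (-t)).mul (expGrowthOn_gammaRatio h₂ (-t))).mul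
      (expGrowthOn_gammaRatio h₃ (-t)))

theorem weightKernel_zero {α₁ α₂ α₃ : ℂ} (h₁ : |α₁.re| < 1 / 2) (h₂ : |α₂.re| < 1 / 2)
    (h₃ : |α₃.re| < 1 / 2) (t : ℝ) : weightKernel α₁ α₂ α₃ t 0 = 1 / (2 * Real.pi) := by
  simp only [weightKernel, gammaRatio_zero h₁, gammaRatio_zero h₂, gammaRatio_zero h₃, neg_zero,
    Complex.cpow_zero, mul_one]

theorem familyGrowth_weightKernel {α₁ α₂ α₃ : ℂ} (h₁ : |α₁.re| < 1 / 2) (h₂ : |α₂.re| < 1 / 2)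
    (h₃ : |α₃.re| < 1 / 2) {σ : ℝ} (hσ₁ : α₁.re - 1 / 2 < σ) (hσ₂ : α₂.re - 1 / 2 < σ)
    (hσ₃ : α₃.re - 1 / 2 < σ) : FamilyGrowth σ (3 * σ) (weightKernel α₁ α₂ α₃) := by
  have hc : FamilyGrowth σ 0 fun _ u => 1 / (2 * Real.pi) * ((Real.pi ^ 2 : ℝ) : ℂ) ^ (-u) :=
    .of_expGrowthOn ((ExpGrowthOn.const _).mul (ExpGrowthOn.cpow_neg (by positivity)))
  have hg := ((FamilyGrowth.gammaRatio h₁ hσ₁).mul (FamilyGrowth.gammaRatio h₂ hσ₂)).mul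
    (FamilyGrowth.gammaRatio h₃ hσ₃)
  have := (hc.mul hg).mul hg.comp_neg
  rwa [show 0 + (σ / 2 + σ / 2 + σ / 2) + (σ / 2 + σ / 2 + σ / 2) = 3 * σ by ring] at this

theorem pow_mul_iteratedDeriv_Vweight {α₁ α₂ α₃ : ℂ} (h₁ : |α₁.re| < 1 / 2)
    (h₂ : |α₂.re| < 1 / 2) (h₃ : |α₃.re| < 1 / 2) (k : ℕ) (t : ℝ) {y : ℝ} (hy : 0 < y) :
    (y : ℂ) ^ k * iteratedDeriv k (Vweight α₁ α₂ α₃ t) y =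
      gaussLineIntegral 3 fun u => (y : ℂ) ^ (-u) *
        ((∏ j ∈ Finset.range k, (-u - j)) * weightKernel α₁ α₂ α₃ t u) := by
  have hg : ExpGrowthOn 3 3 (weightKernel α₁ α₂ α₃ t) :=
    expGrowthOn_weightKernel (by linarith [(abs_lt.mp h₁).2]) (by linarith [(abs_lt.mp h₂).2])
      (by linarith [(abs_lt.mp h₃).2]) t
  have hV : Vweight α₁ α₂ α₃ t =ᶠ[nhds y] fun x : ℝ =>
      gaussLineIntegral 3 fun u => (x : ℂ) ^ (-u) * weightKernel α₁ α₂ α₃ t u :=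
    (eventually_gt_nhds hy).mono fun x hx => Vweight_eq_gaussLineIntegral α₁ α₂ α₃ t hx
  have hyc : (y : ℂ) ^ k ≠ 0 := pow_ne_zero k (by exact_mod_cast hy.ne')
  rw [hV.iteratedDeriv_eq, iteratedDeriv_gaussLineIntegral_cpow hg ⟨le_rfl, le_rfl⟩ three_pos k hy,
    mul_inv_cancel_left₀ hyc]

/-- Rapid decay of the weight function: `y^k V_t^{(k)}(y) ≪ (1 + y/(1+|t|)³)^{-A}`. -/
theorem Vweight_decay (α₁ α₂ α₃ : ℂ)
    (h₁ : |α₁.re| < 1 / 2) (h₂ : |α₂.re| < 1 / 2) (h₃ : |α₃.re| < 1 / 2)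
    (k : ℕ) (A : ℝ) (hA : 0 < A) :
    ∃ C : ℝ, 0 < C ∧ ∀ (t y : ℝ), 0 < y →
      ‖(y : ℂ) ^ k * iteratedDeriv k (Vweight α₁ α₂ α₃ t) y‖ ≤
        C * (1 + y / (1 + |t|) ^ 3) ^ (-A) := by
  have h1 := (abs_lt.mp h₁).2
  have h2 := (abs_lt.mp h₂).2
  have h3 := (abs_lt.mp h₃).2
  obtain ⟨δ, hδ, hδ₁, hδ₂, hδ₃⟩ : ∃ δ : ℝ, 0 < δ ∧ α₁.re - 1 / 2 < -δ ∧ α₂.re - 1 / 2 < -δ ∧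
      α₃.re - 1 / 2 < -δ := by
    obtain ⟨d, hd, hlt⟩ := exists_between
      (lt_min (lt_min (sub_pos.mpr h1) (sub_pos.mpr h2)) (sub_pos.mpr h3))
    rw [lt_min_iff, lt_min_iff] at hlt
    exact ⟨d, hd, by linarith [hlt.1.1], by linarith [hlt.1.2], by linarith [hlt.2]⟩
  set P : ℂ → ℂ := fun u => ∏ j ∈ Finset.range k, (-u - j) with hP
  set H : ℝ → ℂ → ℂ := fun t u => P u * weightKernel α₁ α₂ α₃ t u with hH
  have hgrowth : ∀ σ : ℝ, -δ ≤ σ → FamilyGrowth σ (3 * σ) H := fun σ hσ => by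
    have := (FamilyGrowth.of_expGrowthOn (ExpGrowthOn.prod_neg_sub (a := σ) (b := σ) k)).mul
      (familyGrowth_weightKernel h₁ h₂ h₃ (hδ₁.trans_le hσ) (hδ₂.trans_le hσ) (hδ₃.trans_le hσ))
    rwa [zero_add] at this
  have hexp : ∀ b t y : ℝ, 0 < y → ExpGrowthOn (-δ) b fun u => (y : ℂ) ^ (-u) * H t u :=
    fun b t y hy => (ExpGrowthOn.cpow_neg hy).mul
      ((ExpGrowthOn.prod_neg_sub k).mul (expGrowthOn_weightKernel hδ₁ hδ₂ hδ₃ t))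
  obtain ⟨D₁, hD₁, hleft⟩ := (hgrowth (-δ) le_rfl).exists_norm_gaussLineIntegral_le
    (neg_ne_zero.mpr hδ.ne')
  obtain ⟨D₂, hD₂, hright⟩ := (hgrowth (A + 3) (by linarith)).exists_norm_gaussLineIntegral_le
    (by positivity)
  set E : ℂ := P 0 * (1 / (2 * Real.pi)) *
    (gaussLineIntegral 3 (fun _ => 1) - gaussLineIntegral (-δ) (fun _ => 1)) with hE
  refine ⟨(D₁ + ‖E‖ + D₂ + 1) * 2 ^ A, by positivity, fun t y hy => ?_⟩
  rw [pow_mul_iteratedDeriv_Vweight h₁ h₂ h₃ k t hy]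
  change ‖gaussLineIntegral 3 fun u => (y : ℂ) ^ (-u) * H t u‖ ≤ _
  set X : ℝ := y / (1 + |t|) ^ 3 with hX
  have hX0 : 0 < X := by positivity
  rw [mul_assoc, show (2 : ℝ) ^ A * (1 + X) ^ (-A) = ((1 + X) / 2) ^ (-A) by
    rw [Real.div_rpow (by positivity) zero_le_two, Real.rpow_neg zero_le_two, div_inv_eq_mul,
      mul_comm]]
  rcases le_total X 1 with hX1 | hX1
  · have hshift := (hexp 3 t y hy).gaussLineIntegral_sub_eq (by linarith) three_pos
    have hval : (y : ℂ) ^ (-(0 : ℂ)) * H t 0 = P 0 * (1 / (2 * Real.pi)) := by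
      simp only [hH, neg_zero, Complex.cpow_zero, one_mul, weightKernel_zero h₁ h₂ h₃]
    simp only [hval] at hshift
    have heq : gaussLineIntegral 3 (fun u => (y : ℂ) ^ (-u) * H t u) =
        gaussLineIntegral (-δ) (fun u => (y : ℂ) ^ (-u) * H t u) + E := by
      rw [hE]
      linear_combination -hshift
    have hbase : 1 ≤ ((1 + X) / 2) ^ (-A) :=
      Real.one_le_rpow_of_pos_of_le_one_of_nonpos (by positivity) (by linarith) (by linarith)
    have hXδ : X ^ (- -δ) ≤ 1 := Real.rpow_le_one hX0.le hX1 (by linarith)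
    rw [heq]
    calc _ ≤ D₁ * X ^ (- -δ) + ‖E‖ := (norm_add_le _ _).trans (by gcongr; exact hleft t y hy)
      _ ≤ D₁ * 1 + ‖E‖ := by gcongr
      _ ≤ (D₁ + ‖E‖ + D₂ + 1) * 1 := by linarith
      _ ≤ _ := by gcongr
  · have hshift := ((hexp (A + 3) t y hy).mono (a' := 3) (by linarith) le_rfl).gaussLineIntegral_eq
      three_pos (by linarith)
    rw [hshift]
    calc _ ≤ D₂ * X ^ (-(A + 3)) := hright t y hy
      _ ≤ D₂ * X ^ (-A) := by
        gcongr
        linarith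
      _ ≤ D₂ * ((1 + X) / 2) ^ (-A) := by
        refine mul_le_mul_of_nonneg_left ?_ hD₂
        exact Real.rpow_le_rpow_of_nonpos (by positivity) (by linarith) (by linarith)
      _ ≤ _ := by
        gcongr
        linarith [norm_nonneg E]
end
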